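/- Let R be a regular local ring or an unramified hypersurface, let M be a nonzero finitely generated Cohen–Macaulay R-module of finite projective dimension, and let N be a finitely generated R-module. If Ext_R^n(M,N) = 0 for some n ≤ pd_R(M), then Ext_R^i(M,N) = 0 for all i ≤ n. In particular, over such R, if M is a nonzero finitely generated Cohen–Macaulay R-module of finite projective dimension and Ext_R^n(M,M) = 0 for some n ≥ 1, then pd_R(M) < n. -/

import Mathlib

open CategoryTheory IsLocalRing

universe u

/-- `extMod S n A B` is the `n`-th Ext module `Ext_S^n(A, B)` of `S`-modules `A` and `B`,
realized as an object of `ModuleCat S`. -/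
noncomputable def extMod (S : Type u) [CommRing S] (n : ℕ)
    (A : Type u) [AddCommGroup A] [Module S A] (B : Type u) [AddCommGroup B] [Module S B] :
    ModuleCat.{u} S :=
  ((Ext S (ModuleCat.{u} S) n).obj (Opposite.op (ModuleCat.of S A))).obj (ModuleCat.of S B)

/-- `moduleGrade S M = inf { n | Ext_S^n(M, S) ≠ 0 }`. -/
noncomputable def moduleGrade (S : Type u) [CommRing S]
    (M : Type u) [AddCommGroup M] [Module S M] : ℕ :=
  sInf {n : ℕ | ¬ Subsingleton (extMod S n M S)}

/-- A Noetherian local ring is regular if its maximal ideal can be generated by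
`dim R` many elements. -/
def IsRegularLocal (R : Type u) [CommRing R] [IsLocalRing R] : Prop :=
  IsNoetherianRing R ∧ ∃ s : Finset R, Ideal.span (s : Set R) = maximalIdeal R ∧
    ((s.card : ℕ∞) : WithBot ℕ∞) = ringKrullDim R

/-- A local ring `(R, m, k)` is unramified if it is equicharacteristic
(`char R = char k`), or it has mixed characteristic (`char R ≠ char k`) and
`char k ∉ m²`. -/
def IsUnramifiedLocal (R : Type u) [CommRing R] [IsLocalRing R] : Prop :=
  ringChar R = ringChar (ResidueField R) ∨
    (ringChar R ≠ ringChar (ResidueField R) ∧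
      ((ringChar (ResidueField R) : R) ∉ (maximalIdeal R) ^ 2))

/-- A presentation of the `m`-adic completion of a local ring `R` as `Q/(x)` with
`(Q, n)` a regular local ring and `x ∈ n²` a nonzerodivisor. -/
structure HypersurfacePresentation (R : Type u) [CommRing R] [IsLocalRing R] :
    Type (u + 1) where
  Q : Type u
  [commRing : CommRing Q]
  [localRing : IsLocalRing Q]
  regular : IsRegularLocal Q
  x : Q
  mem_sq : x ∈ (maximalIdeal Q) ^ 2
  nonzerodivisor : x ∈ nonZeroDivisors Q
  equiv : AdicCompletion (maximalIdeal R) R ≃+* Q ⧸ Ideal.span {x}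

/-- A local ring `R` is a hypersurface if it is not regular and its `m`-adic completion
is isomorphic to `Q/(x)` for a regular local ring `(Q, n)` and a nonzerodivisor `x ∈ n²`. -/
def IsHypersurface (R : Type u) [CommRing R] [IsLocalRing R] : Prop :=
  ¬ IsRegularLocal R ∧ Nonempty (HypersurfacePresentation R)

/-- `moduleDepth R M = inf { n | Ext_R^n(k, M) ≠ 0 }`, the depth of a finitely generated
module `M` over a Noetherian local ring `(R, m, k)`. -/
noncomputable def moduleDepth (R : Type u) [CommRing R] [IsLocalRing R]
    (M : Type u) [AddCommGroup M] [Module R M] : ℕ :=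
  sInf {n : ℕ | ¬ Subsingleton (extMod R n (ResidueField R) M)}

/-- A finitely generated module `M` over a Noetherian local ring `R` is Cohen–Macaulay
if `depth M = dim M`, where `dim M = dim (R / ann M)`. -/
def IsCohenMacaulayModule (R : Type u) [CommRing R] [IsLocalRing R]
    (M : Type u) [AddCommGroup M] [Module R M] : Prop :=
  ringKrullDim (R ⧸ Module.annihilator R M) = ((moduleDepth R M : ℕ∞) : WithBot ℕ∞)

/-- The projective dimension of `M` over `R`, characterized by vanishing of `Ext`:
`pd_R M = inf { n | Ext_R^i(M, N) = 0 for all i > n and all modules N }` in `ℕ∞`. -/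
noncomputable def projDim (R : Type u) [CommRing R]
    (M : Type u) [AddCommGroup M] [Module R M] : ℕ∞ :=
  sInf {n : ℕ∞ | ∀ i : ℕ, n < (i : ℕ∞) → ∀ N : ModuleCat.{u} R,
    Subsingleton (((Ext R (ModuleCat.{u} R) i).obj (Opposite.op (ModuleCat.of R M))).obj N)}

open scoped Pointwise TensorProduct

namespace ExtRigidity


section LocalLength

variable {P : Type u} [CommRing P]

/-- The length of the localization of a module at a prime, as an integer (zero if infinite). -/
noncomputable def localLength (p : PrimeSpectrum P) (X : Type u) [AddCommGroup X] [Module P X] :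
    ℤ :=
  ((Module.length (Localization.AtPrime p.asIdeal)
    (LocalizedModule p.asIdeal.primeCompl X)).toNat : ℤ)

/-- No prime properly contained in `p` lies in the support of `X`. -/
def IsIsolatedAt (p : PrimeSpectrum P) (X : Type u) [AddCommGroup X] [Module P X] : Prop :=
  ∀ q ∈ Module.support P X, q ≤ p → q = p

variable {X Y Z : Type u} [AddCommGroup X] [Module P X] [AddCommGroup Y] [Module P Y]
  [AddCommGroup Z] [Module P Z] {p : PrimeSpectrum P}

lemma localLength_nonneg : 0 ≤ localLength p X := Int.natCast_nonneg _

lemma IsIsolatedAt.of_injective (h : IsIsolatedAt p Y) (f : X →ₗ[P] Y)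
    (hf : Function.Injective f) : IsIsolatedAt p X :=
  fun q hq => h q (Module.support_subset_of_injective f hf hq)

lemma IsIsolatedAt.of_surjective (h : IsIsolatedAt p X) (f : X →ₗ[P] Y)
    (hf : Function.Surjective f) : IsIsolatedAt p Y :=
  fun q hq => h q (Module.support_subset_of_surjective f hf hq)

lemma IsIsolatedAt.of_exact (hX : IsIsolatedAt p X) (hZ : IsIsolatedAt p Z) (f : X →ₗ[P] Y)
    (g : Y →ₗ[P] Z) (hfg : Function.Exact f g) : IsIsolatedAt p Y := by
  intro q hq hqp
  by_contra hne
  have h1 : q ∉ Module.support P X := fun h => hne (hX q h hqp)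
  have h2 : q ∉ Module.support P Z := fun h => hne (hZ q h hqp)
  rw [Module.notMem_support_iff'] at h1 h2
  rw [Module.mem_support_iff'] at hq
  obtain ⟨y, hy⟩ := hq
  obtain ⟨r, hr, hry⟩ := h2 (g y)
  rw [← map_smul] at hry
  obtain ⟨x, hx⟩ := (hfg _).1 hry
  obtain ⟨s, hs, hsx⟩ := h1 x
  refine hy (s * r) (fun h => (q.2.mem_or_mem h).elim hs hr) ?_
  rw [mul_smul, ← hx, ← map_smul, hsx, map_zero]

lemma localLength_of_notMem_support (h : p ∉ Module.support P X) : localLength p X = 0 := by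
  rw [Module.notMem_support_iff] at h
  rw [localLength, Module.length_eq_zero]
  simp

lemma length_localization_additive (f : X →ₗ[P] Y) (g : Y →ₗ[P] Z) (hf : Function.Injective f)
    (hg : Function.Surjective g) (hfg : Function.Exact f g) :
    Module.length (Localization.AtPrime p.asIdeal) (LocalizedModule p.asIdeal.primeCompl Y) =
      Module.length (Localization.AtPrime p.asIdeal) (LocalizedModule p.asIdeal.primeCompl X) +
      Module.length (Localization.AtPrime p.asIdeal) (LocalizedModule p.asIdeal.primeCompl Z) :=
  Module.length_eq_add_of_exact (LocalizedModule.map p.asIdeal.primeCompl f)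
    (LocalizedModule.map p.asIdeal.primeCompl g)
    (LocalizedModule.map_injective _ f hf) (LocalizedModule.map_surjective _ g hg)
    (LocalizedModule.map_exact _ f g hfg)

lemma LinearEquiv.length_localization_eq (e : X ≃ₗ[P] Y) :
    Module.length (Localization.AtPrime p.asIdeal) (LocalizedModule p.asIdeal.primeCompl X) =
      Module.length (Localization.AtPrime p.asIdeal) (LocalizedModule p.asIdeal.primeCompl Y) := by
  have h := length_localization_additive (p := p) (e : X →ₗ[P] Y) (0 : Y →ₗ[P] PUnit.{u+1})
    e.injective (Function.surjective_to_subsingleton _)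
    (by rw [LinearMap.exact_iff]; simp)
  rw [h, Module.length_eq_zero (M := LocalizedModule p.asIdeal.primeCompl PUnit.{u+1}), add_zero]

lemma localLength_eq_of_equiv (e : X ≃ₗ[P] Y) : localLength p X = localLength p Y := by
  rw [localLength, localLength, LinearEquiv.length_localization_eq e]

lemma length_localization_quotient_self (p : PrimeSpectrum P) :
    Module.length (Localization.AtPrime p.asIdeal)
      (LocalizedModule p.asIdeal.primeCompl (P ⧸ p.asIdeal)) = 1 := by
  have hsupp : p ∈ Module.support P (P ⧸ p.asIdeal) := by
    rw [Module.mem_support_iff_of_finite, Ideal.annihilator_quotient]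
  rw [Module.length_eq_one_iff, isSimpleModule_iff_toSpanSingleton_surjective]
  refine ⟨(Module.mem_support_iff).1 hsupp, fun x hx y => ?_⟩
  induction x using LocalizedModule.induction_on with
  | h m s =>
  induction y using LocalizedModule.induction_on with
  | h m' s' =>
  obtain ⟨a, rfl⟩ := Ideal.Quotient.mk_surjective m
  obtain ⟨b, rfl⟩ := Ideal.Quotient.mk_surjective m'
  have ha : a ∈ p.asIdeal.primeCompl := fun h => hx (by
    rw [Ideal.Quotient.eq_zero_iff_mem.2 h, LocalizedModule.zero_mk])
  refine ⟨Localization.mk (s * b : P) (s' * ⟨a, ha⟩ : p.asIdeal.primeCompl), ?_⟩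
  rw [LinearMap.toSpanSingleton_apply, LocalizedModule.mk_smul_mk, LocalizedModule.mk_eq]
  refine ⟨1, ?_⟩
  simp only [Submonoid.smul_def, Submonoid.coe_mul, one_smul]
  rw [← Ideal.Quotient.mk_eq_mk, ← Ideal.Quotient.mk_eq_mk]
  simp only [← Submodule.Quotient.mk_smul, smul_eq_mul]
  congr 1
  ring

variable [IsNoetherianRing P]

lemma IsIsolatedAt.length_ne_top [Module.Finite P X] (h : IsIsolatedAt p X) :
    Module.length (Localization.AtPrime p.asIdeal)
      (LocalizedModule p.asIdeal.primeCompl X) ≠ ⊤ := by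
  revert h
  refine IsNoetherianRing.induction_on_isQuotientEquivQuotientPrime P ‹Module.Finite P X›
    (motive := fun X _ _ _ => IsIsolatedAt p X → Module.length (Localization.AtPrime p.asIdeal)
      (LocalizedModule p.asIdeal.primeCompl X) ≠ ⊤) ?_ ?_ ?_
  · intro N _ _ _ _ _
    rw [Module.length_eq_zero]
    simp
  · intro N _ _ _ q e h
    rw [LinearEquiv.length_localization_eq e]
    by_cases hq : q ≤ p
    · have : q = p := h q (by
        rw [e.support_eq, Module.mem_support_iff_of_finite, Ideal.annihilator_quotient]) hq
      rw [this, length_localization_quotient_self]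
      simp
    · have : p ∉ Module.support P (P ⧸ q.asIdeal) := by
        rw [Module.mem_support_iff_of_finite, Ideal.annihilator_quotient]
        exact hq
      rw [Module.notMem_support_iff] at this
      rw [Module.length_eq_zero]
      simp
  · intro N₁ _ _ _ N₂ _ _ _ N₃ _ _ _ f g hf hg hfg h1 h3 h
    rw [length_localization_additive f g hf hg hfg]
    simp [h1 (h.of_injective f hf), h3 (h.of_surjective g hg)]

lemma localLength_pos [Module.Finite P X] (h : IsIsolatedAt p X) (hp : p ∈ Module.support P X) :
    0 < localLength p X := by
  rw [Module.mem_support_iff] at hp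
  have := h.length_ne_top
  have h2 := Module.length_pos (R := Localization.AtPrime p.asIdeal)
    (M := LocalizedModule p.asIdeal.primeCompl X)
  rw [localLength, Nat.cast_pos]
  exact Nat.pos_of_ne_zero (fun h0 => (ENat.toNat_eq_zero.1 h0).elim h2.ne' this)

lemma localLength_additive [Module.Finite P Y] (f : X →ₗ[P] Y) (g : Y →ₗ[P] Z)
    (hf : Function.Injective f) (hg : Function.Surjective g) (hfg : Function.Exact f g)
    (hY : IsIsolatedAt p Y) :
    localLength p Y = localLength p X + localLength p Z := by
  have := Module.Finite.of_injective f hf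
  have := Module.Finite.of_surjective g hg
  rw [localLength, localLength, localLength, length_localization_additive f g hf hg hfg,
    ENat.toNat_add (hY.of_injective f hf).length_ne_top (hY.of_surjective g hg).length_ne_top]
  push_cast
  rfl

lemma localLength_ker_add_range [Module.Finite P Y] (g : Y →ₗ[P] Z) (hY : IsIsolatedAt p Y) :
    localLength p Y = localLength p (LinearMap.ker g) + localLength p (LinearMap.range g) :=
  localLength_additive (LinearMap.ker g).subtype g.rangeRestrict (Submodule.subtype_injective _)
    g.surjective_rangeRestrict (by rw [LinearMap.exact_iff]; simp) hY

end LocalLength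


section EulerMul

variable {P : Type u} [CommRing P]
variable {X Y Z W : Type u} [AddCommGroup X] [Module P X] [AddCommGroup Y] [Module P Y]
  [AddCommGroup Z] [Module P Z] [AddCommGroup W] [Module P W] {p q : PrimeSpectrum P} {t : P}

/-- The difference of the local lengths of the cokernel and the kernel of multiplication. -/
noncomputable def eulerMul (t : P) (p : PrimeSpectrum P) (W : Type u) [AddCommGroup W]
    [Module P W] : ℤ :=
  localLength p (QuotSMulTop t W) - localLength p (Submodule.torsionBy P W t)

/-- Every prime of the support contained in `p` and containing `t` equals `p`. -/
def IsIsolatedAtMod (t : P) (p : PrimeSpectrum P) (W : Type u) [AddCommGroup W]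
    [Module P W] : Prop :=
  ∀ q ∈ Module.support P W, t ∈ q.asIdeal → q ≤ p → q = p

/-- The primes `q` below `p` such that `p` is minimal over `q + (t)`. -/
def dimOneBelow (t : P) (p : PrimeSpectrum P) : Set (PrimeSpectrum P) :=
  {q | q ≤ p ∧ t ∉ q.asIdeal ∧ ∀ r : PrimeSpectrum P, q ≤ r → t ∈ r.asIdeal → r ≤ p → r = p}

lemma IsIsolatedAtMod.of_injective (h : IsIsolatedAtMod t p Y) (f : X →ₗ[P] Y)
    (hf : Function.Injective f) : IsIsolatedAtMod t p X :=
  fun q hq => h q (Module.support_subset_of_injective f hf hq)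

lemma IsIsolatedAtMod.of_surjective (h : IsIsolatedAtMod t p X) (f : X →ₗ[P] Y)
    (hf : Function.Surjective f) : IsIsolatedAtMod t p Y :=
  fun q hq => h q (Module.support_subset_of_surjective f hf hq)

lemma mem_of_mem_support_torsionBy (h : q ∈ Module.support P (Submodule.torsionBy P W t)) :
    t ∈ q.asIdeal := by
  by_contra hq
  obtain ⟨m, hm⟩ := Module.mem_support_iff'.1 h
  exact hm t hq (Subtype.ext (by simp))

lemma mem_support_quotSMulTop_imp (h : q ∈ Module.support P (QuotSMulTop t W)) :
    q ∈ Module.support P W ∧ t ∈ q.asIdeal := by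
  refine ⟨Module.support_subset_of_surjective _ (Submodule.mkQ_surjective _) h, ?_⟩
  by_contra hq
  obtain ⟨m, hm⟩ := Module.mem_support_iff'.1 h
  refine hm t hq ?_
  obtain ⟨w, rfl⟩ := Submodule.mkQ_surjective _ m
  rw [← map_smul, Submodule.mkQ_apply, Submodule.Quotient.mk_eq_zero]
  exact Submodule.smul_mem_pointwise_smul _ _ _ trivial

lemma IsIsolatedAtMod.torsionBy (h : IsIsolatedAtMod t p W) :
    IsIsolatedAt p (Submodule.torsionBy P W t) :=
  fun q hq hqp => h q (Module.support_subset_of_injective _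
    (Submodule.subtype_injective (Submodule.torsionBy P W t)) hq)
    (mem_of_mem_support_torsionBy hq) hqp

lemma IsIsolatedAtMod.quotSMulTop (h : IsIsolatedAtMod t p W) :
    IsIsolatedAt p (QuotSMulTop t W) :=
  fun q hq hqp => h q (mem_support_quotSMulTop_imp hq).1 (mem_support_quotSMulTop_imp hq).2 hqp

lemma isIsolatedAtMod_of_quotSMulTop [Module.Finite P W]
    (h : IsIsolatedAt p (QuotSMulTop t W)) : IsIsolatedAtMod t p W :=
  fun q hq htq hqp => h q (by
    rw [Module.support_quotSMulTop]
    exact ⟨hq, by simpa using htq⟩) hqp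

lemma eulerMul_of_mem_annihilator (h : ∀ w : W, t • w = 0) : eulerMul t p W = 0 := by
  have e1 : t • (⊤ : Submodule P W) = ⊥ := by
    rw [eq_bot_iff]
    intro x hx
    obtain ⟨w, -, rfl⟩ := (Submodule.mem_smul_pointwise_iff_exists _ _ _).1 hx
    simp [h]
  have e2 : Submodule.torsionBy P W t = ⊤ := by
    rw [eq_top_iff]
    exact fun w _ => (Submodule.mem_torsionBy_iff _ _).2 (h w)
  rw [eulerMul, localLength_eq_of_equiv (Submodule.quotEquivOfEqBot _ e1), e2,
    localLength_eq_of_equiv Submodule.topEquiv, sub_self]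

lemma exists_snake_smul (f : X →ₗ[P] Y) (g : Y →ₗ[P] Z) (hf : Function.Injective f)
    (hg : Function.Surjective g) (hfg : Function.Exact f g) (t : P) :
    ∃ (a : Submodule.torsionBy P X t →ₗ[P] Submodule.torsionBy P Y t)
      (b : Submodule.torsionBy P Y t →ₗ[P] Submodule.torsionBy P Z t)
      (δ : Submodule.torsionBy P Z t →ₗ[P] QuotSMulTop t X), Function.Injective a ∧
      Function.Exact a b ∧ Function.Exact b δ ∧ Function.Exact δ (QuotSMulTop.map t f) ∧
      Function.Exact (QuotSMulTop.map t f) (QuotSMulTop.map t g) ∧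
      Function.Surjective (QuotSMulTop.map t g) := by
  have hres : ∀ {A B : Type u} [AddCommGroup A] [Module P A] [AddCommGroup B] [Module P B]
      (h : A →ₗ[P] B), ∀ x ∈ Submodule.torsionBy P A t, h x ∈ Submodule.torsionBy P B t := by
    intro A B _ _ _ _ h x hx
    rw [Submodule.mem_torsionBy_iff] at hx ⊢
    rw [← map_smul, hx, map_zero]
  have hk : ∀ (A : Type u) [AddCommGroup A] [Module P A],
      Function.Exact (Submodule.torsionBy P A t).subtype (LinearMap.lsmul P A t) := by
    intro A _ _ x
    simp
  have hc : ∀ (A : Type u) [AddCommGroup A] [Module P A],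
      Function.Exact (LinearMap.lsmul P A t) (t • (⊤ : Submodule P A)).mkQ := by
    intro A _ _ x
    rw [Submodule.mkQ_apply, Submodule.Quotient.mk_eq_zero,
      Submodule.mem_smul_pointwise_iff_exists]
    simp
  have h₁ : f.comp (LinearMap.lsmul P X t) = (LinearMap.lsmul P Y t).comp f := by ext; simp
  have h₂ : g.comp (LinearMap.lsmul P Y t) = (LinearMap.lsmul P Z t).comp g := by ext; simp
  refine ⟨f.restrict (hres f), g.restrict (hres g),
    SnakeLemma.δ' (LinearMap.lsmul P X t) (LinearMap.lsmul P Y t) (LinearMap.lsmul P Z t)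
      f g hfg f g hfg h₁ h₂ (Submodule.torsionBy P Z t).subtype (hk Z) _ (hc X) hg hf,
    ?_, ?_, ?_, ?_, ?_, ?_⟩
  · intro x y hxy
    exact Subtype.ext (hf (congrArg Subtype.val hxy))
  · intro y
    constructor
    · intro hy
      obtain ⟨x, hx⟩ := (hfg y).1 (congrArg Subtype.val hy)
      refine ⟨⟨x, ?_⟩, Subtype.ext hx⟩
      rw [Submodule.mem_torsionBy_iff]
      apply hf
      rw [map_smul, hx, map_zero]
      exact (Submodule.mem_torsionBy_iff _ _).1 y.2
    · rintro ⟨x, rfl⟩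
      exact Subtype.ext (hfg.apply_apply_eq_zero x)
  · exact SnakeLemma.exact_δ'_right _ _ _ _ _ _ _ _ _ _ _ (Submodule.torsionBy P Y t).subtype
      (hk Y) _ _ _ _ _ _ _ rfl (Submodule.subtype_injective _)
  · exact SnakeLemma.exact_δ'_left _ _ _ _ _ _ _ _ _ _ _ _ _ _ _ (t • (⊤ : Submodule P Y)).mkQ
      (hc Y) _ _ _ (by ext; rfl) (Submodule.mkQ_surjective _)
  · exact QuotSMulTop.map_exact t hfg hg
  · exact QuotSMulTop.map_surjective t hg

variable [IsNoetherianRing P]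

lemma dimOneBelow_antichain (ht : t ∈ p.asIdeal) {q₀ q : PrimeSpectrum P}
    (h₀ : q₀ ∈ dimOneBelow t p) (h : q ∈ dimOneBelow t p) (hle : q₀ ≤ q) : q₀ = q := by
  have hqp : q.asIdeal < p.asIdeal :=
    lt_of_le_of_ne h.1 (fun e => h.2.1 (e ▸ ht))
  have hmin : p.asIdeal ∈ (Ideal.span (insert t (q₀.asIdeal : Set P))).minimalPrimes := by
    refine ⟨⟨p.2, Ideal.span_le.2 (Set.insert_subset ht h₀.1)⟩, fun r hr hrp => ?_⟩
    have := h₀.2.2 ⟨r, hr.1⟩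
      (fun x hx => hr.2 (Ideal.subset_span (Set.mem_insert_of_mem _ hx)))
      (hr.2 (Ideal.subset_span (Set.mem_insert _ _))) hrp
    rw [← this]
  have := Ideal.mem_minimalPrimes_span_of_mem_minimalPrimes_span_insert hqp t
    (q₀.asIdeal : Set P) hmin (q₀.asIdeal : Set P) hle
    (fun x hx => Ideal.le_radical (Ideal.subset_span (Set.mem_insert_of_mem _ hx)))
  rw [Ideal.span_eq] at this
  exact PrimeSpectrum.ext (le_antisymm hle (this.2 ⟨q₀.2, le_rfl⟩ hle))

lemma IsIsolatedAtMod.isIsolatedAt (h : IsIsolatedAtMod t p W) (ht : t ∈ p.asIdeal)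
    (hq : q ∈ dimOneBelow t p) : IsIsolatedAt q W := by
  intro q' hq' hle
  refine dimOneBelow_antichain ht ⟨hle.trans hq.1, fun h' => hq.2.1 (hle h'), ?_⟩ hq hle
  exact fun r hr htr hrp => h r (Module.mem_support_mono hr hq') htr hrp

lemma eulerMul_additive [Module.Finite P Y] (f : X →ₗ[P] Y) (g : Y →ₗ[P] Z)
    (hf : Function.Injective f) (hg : Function.Surjective g) (hfg : Function.Exact f g)
    (h : IsIsolatedAtMod t p Y) : eulerMul t p Y = eulerMul t p X + eulerMul t p Z := by
  have := Module.Finite.of_injective f hf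
  have := Module.Finite.of_surjective g hg
  have key : ∀ {A B C : Type u} [AddCommGroup A] [Module P A] [AddCommGroup B] [Module P B]
      [AddCommGroup C] [Module P C] [Module.Finite P B] (a : A →ₗ[P] B) (b : B →ₗ[P] C),
      Function.Exact a b → IsIsolatedAt p B →
      localLength p B = localLength p (LinearMap.range a) + localLength p (LinearMap.range b) := by
    intro A B C _ _ _ _ _ _ _ a b hab hB
    rw [localLength_ker_add_range b hB, hab.linearMap_ker_eq]
  obtain ⟨a, b, δ, ha, hab, hbδ, hδ, hc, hs⟩ := exists_snake_smul f g hf hg hfg t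
  have hX := h.of_injective f hf
  have hZ := h.of_surjective g hg
  have e1 := localLength_eq_of_equiv (p := p) (LinearEquiv.ofInjective a ha)
  have e2 := key a b hab h.torsionBy
  have e3 := key b δ hbδ hZ.torsionBy
  have e4 := key δ _ hδ hX.quotSMulTop
  have e5 := key _ _ hc h.quotSMulTop
  have e6 := localLength_eq_of_equiv (p := p) (LinearEquiv.ofTop _ (LinearMap.range_eq_top.2 hs))
  simp only [eulerMul]
  linarith

lemma eulerMul_quotient_pos (hq : q ∈ dimOneBelow t p) (ht : t ∈ p.asIdeal) :
    0 < eulerMul t p (P ⧸ q.asIdeal) := by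
  have hsupp : ∀ r : PrimeSpectrum P, r ∈ Module.support P (P ⧸ q.asIdeal) ↔ q ≤ r := by
    intro r
    rw [Module.mem_support_iff_of_finite, Ideal.annihilator_quotient]
    rfl
  have h : IsIsolatedAtMod t p (P ⧸ q.asIdeal) :=
    fun r hr htr hrp => hq.2.2 r ((hsupp r).1 hr) htr hrp
  have h1 : localLength p (Submodule.torsionBy P (P ⧸ q.asIdeal) t) = 0 := by
    have : Submodule.torsionBy P (P ⧸ q.asIdeal) t = ⊥ := by
      rw [eq_bot_iff]
      intro x hx
      rw [Submodule.mem_torsionBy_iff] at hx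
      obtain ⟨y, rfl⟩ := Ideal.Quotient.mk_surjective x
      rw [← Ideal.Quotient.mk_eq_mk, ← Submodule.Quotient.mk_smul,
        Submodule.Quotient.mk_eq_zero, smul_eq_mul] at hx
      rw [Submodule.mem_bot, Ideal.Quotient.eq_zero_iff_mem]
      exact (q.2.mem_or_mem hx).resolve_left hq.2.1
    rw [this]
    apply localLength_of_notMem_support
    rw [Module.support_eq_empty]
    simp
  rw [eulerMul, h1, sub_zero]
  refine localLength_pos h.quotSMulTop ?_
  rw [Module.support_quotSMulTop]
  exact ⟨(hsupp p).2 hq.1, by simpa using ht⟩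

lemma eulerMul_eq_sum [Module.Finite P W] (ht : t ∈ p.asIdeal) (F : Finset (PrimeSpectrum P))
    (hF : ∀ q ∈ F, q ∈ dimOneBelow t p) (h : IsIsolatedAtMod t p W)
    (hW : ∀ q ∈ dimOneBelow t p, q ∈ Module.support P W → q ∈ F) :
    eulerMul t p W = ∑ q ∈ F, eulerMul t p (P ⧸ q.asIdeal) * localLength q W := by
  revert h hW
  refine IsNoetherianRing.induction_on_isQuotientEquivQuotientPrime P ‹Module.Finite P W›
    (motive := fun W _ _ _ => IsIsolatedAtMod t p W →
      (∀ q ∈ dimOneBelow t p, q ∈ Module.support P W → q ∈ F) →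
      eulerMul t p W = ∑ q ∈ F, eulerMul t p (P ⧸ q.asIdeal) * localLength q W) ?_ ?_ ?_
  · intro N _ _ _ _ _ _
    rw [eulerMul_of_mem_annihilator (fun w => Subsingleton.elim _ _), Finset.sum_eq_zero]
    intro q _
    rw [localLength_of_notMem_support, mul_zero]
    rw [Module.support_eq_empty]
    simp
  · intro N _ _ _ r e h hW
    have hsupp : ∀ s : PrimeSpectrum P, s ∈ Module.support P N ↔ r ≤ s := by
      intro s
      rw [e.support_eq, Module.mem_support_iff_of_finite, Ideal.annihilator_quotient]
      rfl
    have hN : eulerMul t p N = eulerMul t p (P ⧸ r.asIdeal) := by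
      have := eulerMul_additive (e : N →ₗ[P] _)
        (0 : (P ⧸ r.asIdeal) →ₗ[P] PUnit.{u+1}) e.injective
        (Function.surjective_to_subsingleton _) (by rw [LinearMap.exact_iff]; simp)
        (h.of_surjective (e : N →ₗ[P] _) e.surjective)
      rw [this, eulerMul_of_mem_annihilator (W := PUnit.{u+1}) (fun w => Subsingleton.elim _ _),
        add_zero]
    have hz : ∀ q ∈ F, q ≠ r → localLength q N = 0 := by
      intro q hq hqr
      apply localLength_of_notMem_support
      intro hqs
      have hle := (hsupp q).1 hqs
      have hr : r ∈ dimOneBelow t p :=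
        ⟨hle.trans (hF q hq).1, fun h' => (hF q hq).2.1 (hle h'),
          fun s hs hts hsp => h s ((hsupp s).2 hs) hts hsp⟩
      exact hqr (dimOneBelow_antichain ht hr (hF q hq) hle).symm
    by_cases hr : r ∈ F
    · rw [Finset.sum_eq_single_of_mem r hr (fun q hq hne => by rw [hz q hq hne, mul_zero]), hN,
        localLength, LinearEquiv.length_localization_eq e, length_localization_quotient_self]
      simp
    · rw [Finset.sum_eq_zero (fun q hq => by
        rw [hz q hq (fun e => hr (e ▸ hq)), mul_zero]), hN]
      by_cases hrp : r ≤ p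
      · by_cases htr : t ∈ r.asIdeal
        · apply eulerMul_of_mem_annihilator
          intro w
          obtain ⟨y, rfl⟩ := Ideal.Quotient.mk_surjective w
          rw [← Ideal.Quotient.mk_eq_mk, ← Submodule.Quotient.mk_smul,
            Submodule.Quotient.mk_eq_zero, smul_eq_mul]
          exact Ideal.mul_mem_right _ _ htr
        · exact absurd (hW r ⟨hrp, htr, fun s hs hts hsp => h s ((hsupp s).2 hs) hts hsp⟩
            ((hsupp r).2 le_rfl)) hr
      · have hns : p ∉ Module.support P (P ⧸ r.asIdeal) := by
          rw [← e.support_eq, hsupp]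
          exact hrp
        rw [eulerMul, localLength_of_notMem_support, localLength_of_notMem_support, sub_zero]
        · exact fun h' => hns (Module.support_subset_of_injective _
            (Submodule.subtype_injective _) h')
        · exact fun h' => hns (mem_support_quotSMulTop_imp h').1
  · intro N₁ _ _ _ N₂ _ _ _ N₃ _ _ _ f g hf hg hfg h1 h3 h hW
    rw [eulerMul_additive f g hf hg hfg h,
      h1 (h.of_injective f hf) (fun q hq hs => hW q hq
        (Module.support_subset_of_injective f hf hs)),
      h3 (h.of_surjective g hg) (fun q hq hs => hW q hq
        (Module.support_subset_of_surjective g hg hs)), ← Finset.sum_add_distrib]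
    refine Finset.sum_congr rfl fun q hq => ?_
    rw [localLength_additive f g hf hg hfg (h.isIsolatedAt ht (hF q hq)), mul_add]

lemma IsIsolatedAtMod.finite_dimOneBelow [Module.Finite P W] (h : IsIsolatedAtMod t p W)
    (ht : t ∈ p.asIdeal) : (dimOneBelow t p ∩ Module.support P W).Finite := by
  have hfin := Ideal.finite_minimalPrimes_of_isNoetherianRing P (Module.annihilator P W)
  refine (hfin.preimage (f := PrimeSpectrum.asIdeal)
    (fun a _ b _ hab => PrimeSpectrum.ext hab)).subset ?_
  rintro q ⟨hq, hs⟩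
  refine ⟨⟨q.2, (Module.mem_support_iff_of_finite).1 hs⟩, fun r hr hrq => ?_⟩
  have := h.isIsolatedAt ht hq ⟨r, hr.1⟩ ((Module.mem_support_iff_of_finite).2 hr.2) hrq
  rw [← this]

end EulerMul


section AltSum

/-- The alternating sum `a n - a (n - 1) + a (n - 2) - ⋯`. -/
def altSum (a : ℕ → ℤ) : ℕ → ℤ
  | 0 => a 0
  | n + 1 => a (n + 1) - altSum a n

lemma altSum_congr {a b : ℕ → ℤ} {n : ℕ} (h : ∀ l ≤ n, a l = b l) : altSum a n = altSum b n := by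
  induction n with
  | zero => exact h 0 le_rfl
  | succ n ih => rw [altSum, altSum, h _ le_rfl, ih fun l hl => h l (hl.trans n.le_succ)]

lemma altSum_sum {ι : Type*} (F : Finset ι) (c : ι → ℤ) (a : ι → ℕ → ℤ) (n : ℕ) :
    altSum (fun l => ∑ q ∈ F, c q * a q l) n = ∑ q ∈ F, c q * altSum (a q) n := by
  induction n with
  | zero => rfl
  | succ n ih =>
    rw [altSum, ih, ← Finset.sum_sub_distrib]
    exact Finset.sum_congr rfl fun q _ => by rw [altSum]; ring

lemma altSum_eq_add_altSum (y c k : ℕ → ℤ) (h0 : y 0 = 0) (hk : k 0 = 0) (n : ℕ)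
    (hy : ∀ l ≤ n, y (l + 1) = c l + k (l + 1)) :
    altSum y (n + 1) = k (n + 1) + altSum (fun l => c l - k l) n := by
  induction n with
  | zero => simp [altSum, h0, hk, hy, add_comm]
  | succ n ih =>
    rw [altSum, ih fun l hl => hy l (hl.trans n.le_succ), altSum, hy _ le_rfl]
    ring

end AltSum

section Kos

variable {P : Type u} [CommRing P]

/-- Families of modules obtained from a family vanishing in degree zero by `n` steps, each step
producing extensions of the `t`-torsion in one degree by the quotient modulo `t` in the previous
degree. -/
inductive Kos : ℕ → (ℕ → ModuleCat.{u} P) → Prop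
  | zero (Y : ℕ → ModuleCat.{u} P) (hfin : ∀ l, Module.Finite P (Y l))
      (h0 : Subsingleton (Y 0)) : Kos 0 Y
  | succ (n : ℕ) (X Y : ℕ → ModuleCat.{u} P) (t : P) (hX : Kos n X)
      (hfin : ∀ l, Module.Finite P (Y l)) (h0 : Subsingleton (Y 0))
      (hY : ∀ l, ∃ (f : QuotSMulTop t (X l) →ₗ[P] Y (l + 1))
        (g : Y (l + 1) →ₗ[P] Submodule.torsionBy P (X (l + 1)) t),
        Function.Injective f ∧ Function.Exact f g ∧ Function.Surjective g) : Kos (n + 1) Y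

lemma Kos.finite {n : ℕ} {Y : ℕ → ModuleCat.{u} P} (h : Kos n Y) (l : ℕ) :
    Module.Finite P (Y l) := by
  cases h with
  | zero _ hfin _ => exact hfin l
  | succ _ _ _ _ _ hfin _ _ => exact hfin l

lemma Kos.subsingleton {n : ℕ} {Y : ℕ → ModuleCat.{u} P} (h : Kos n Y) :
    Subsingleton (Y 0) := by
  cases h with
  | zero _ _ h0 => exact h0
  | succ _ _ _ _ _ _ h0 _ => exact h0

variable {X Y Z W : Type u} [AddCommGroup X] [Module P X] [AddCommGroup Y] [Module P Y]
  [AddCommGroup Z] [Module P Z] [AddCommGroup W] [Module P W] {p q : PrimeSpectrum P} {t : P}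

lemma mem_support_of_exact (f : X →ₗ[P] Y) (g : Y →ₗ[P] Z) (hfg : Function.Exact f g)
    (hq : q ∈ Module.support P Y) : q ∈ Module.support P X ∨ q ∈ Module.support P Z := by
  by_contra! h
  obtain ⟨h1, h2⟩ := h
  rw [Module.notMem_support_iff'] at h1 h2
  rw [Module.mem_support_iff'] at hq
  obtain ⟨y, hy⟩ := hq
  obtain ⟨r, hr, hry⟩ := h2 (g y)
  rw [← map_smul] at hry
  obtain ⟨x, hx⟩ := (hfg _).1 hry
  obtain ⟨s, hs, hsx⟩ := h1 x
  refine hy (s * r) (fun h => (q.2.mem_or_mem h).elim hs hr) ?_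
  rw [mul_smul, ← hx, ← map_smul, hsx, map_zero]

lemma mem_support_torsionBy_of_mem_associatedPrimes [IsNoetherianRing P] (ht : t ∈ p.asIdeal)
    (h : p.asIdeal ∈ associatedPrimes P W) :
    p ∈ Module.support P (Submodule.torsionBy P W t) := by
  obtain ⟨-, x, hx⟩ := isAssociatedPrime_iff.1 h
  have hmem : ∀ r, r ∈ p.asIdeal ↔ r • x = 0 := fun r => by
    rw [hx, Submodule.mem_colon_singleton, Submodule.mem_bot]
  refine Module.mem_support_iff'.2 ⟨⟨x, (Submodule.mem_torsionBy_iff _ _).2 ((hmem t).1 ht)⟩, ?_⟩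
  intro r hr h0
  exact hr ((hmem r).2 (congrArg Subtype.val h0))

lemma mem_associatedPrimes_quotSMulTop [IsNoetherianRing P] [Module.Finite P W]
    (G : Submodule P W) (hG : ∀ w, t • w ∈ G → w ∈ G) (hp : p ∈ Module.support P G)
    (ht : t ∈ p.asIdeal) (hiso : IsIsolatedAt p (QuotSMulTop t G)) :
    p.asIdeal ∈ associatedPrimes P (QuotSMulTop t W) := by
  have hinj : Function.Injective (QuotSMulTop.map t G.subtype) := by
    rw [← LinearMap.ker_eq_bot, eq_bot_iff]
    intro x hx
    obtain ⟨g, rfl⟩ := Submodule.mkQ_surjective _ x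
    rw [LinearMap.mem_ker, Submodule.mkQ_apply, QuotSMulTop.map_apply_mk,
      Submodule.Quotient.mk_eq_zero, Submodule.mem_smul_pointwise_iff_exists] at hx
    obtain ⟨w, -, hw⟩ := hx
    have hwG : w ∈ G := hG w (by rw [hw]; exact g.2)
    rw [Submodule.mem_bot, Submodule.mkQ_apply, Submodule.Quotient.mk_eq_zero,
      Submodule.mem_smul_pointwise_iff_exists]
    exact ⟨⟨w, hwG⟩, trivial, Subtype.ext hw⟩
  refine associatedPrimes.subset_of_injective hinj ?_
  refine Module.associatedPrimes.minimalPrimes_annihilator_subset_associatedPrimes P _ ?_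
  have hs : p ∈ Module.support P (QuotSMulTop t G) := by
    rw [Module.support_quotSMulTop]
    exact ⟨hp, by simpa using ht⟩
  refine ⟨⟨p.2, Module.mem_support_iff_of_finite.1 hs⟩, fun r hr hrp => ?_⟩
  have := hiso ⟨r, hr.1⟩ (Module.mem_support_iff_of_finite.2 hr.2) hrp
  rw [← this]

lemma mem_associatedPrimes_of_mem_support_torsionBy [IsNoetherianRing P] [Module.Finite P W]
    (ht : t ∈ p.asIdeal) (hiso : IsIsolatedAt p (Submodule.torsionBy P W t))
    (hp : p ∈ Module.support P (Submodule.torsionBy P W t)) :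
    p.asIdeal ∈ associatedPrimes P (QuotSMulTop t W) := by
  let G : Submodule P W :=
    { carrier := {w | ∀ q : PrimeSpectrum P, q < p → ∃ s ∉ q.asIdeal, s • w = 0}
      add_mem' := by
        intro a b ha hb q hq
        obtain ⟨s, hs, hsa⟩ := ha q hq
        obtain ⟨r, hr, hrb⟩ := hb q hq
        refine ⟨s * r, fun h => (q.2.mem_or_mem h).elim hs hr, ?_⟩
        rw [smul_add, mul_smul, mul_smul, hrb, smul_zero, smul_comm, hsa, smul_zero, add_zero]
      zero_mem' := fun q _ => ⟨1, q.2.one_notMem, smul_zero _⟩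
      smul_mem' := by
        intro c w hw q hq
        obtain ⟨s, hs, hsa⟩ := hw q hq
        exact ⟨s, hs, by rw [smul_comm, hsa, smul_zero]⟩ }
  have htor : ∀ w ∈ Submodule.torsionBy P W t, w ∈ G := by
    intro w hw q hq
    have : q ∉ Module.support P (Submodule.torsionBy P W t) := fun h => hq.ne (hiso q h hq.le)
    obtain ⟨s, hs, hsw⟩ := Module.notMem_support_iff'.1 this ⟨w, hw⟩
    exact ⟨s, hs, congrArg Subtype.val hsw⟩
  refine mem_associatedPrimes_quotSMulTop G ?_ ?_ ht ?_
  · intro w hw q hq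
    obtain ⟨s, hs, hsw⟩ := hw q hq
    by_cases htq : t ∈ q.asIdeal
    · have hsw' : s • w ∈ Submodule.torsionBy P W t := by
        rw [Submodule.mem_torsionBy_iff, smul_comm, hsw]
      obtain ⟨r, hr, hrw⟩ := htor _ hsw' q hq
      exact ⟨r * s, fun h => (q.2.mem_or_mem h).elim hr hs, by rw [mul_smul, hrw]⟩
    · exact ⟨s * t, fun h => (q.2.mem_or_mem h).elim hs htq, by rw [mul_smul, hsw]⟩
  · exact Module.support_subset_of_injective (Submodule.inclusion htor)
      (Submodule.inclusion_injective _) hp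
  · intro q hq hqp
    by_contra hne
    have hlt : q < p := lt_of_le_of_ne hqp hne
    obtain ⟨g, hg⟩ := Module.mem_support_iff'.1 (mem_support_quotSMulTop_imp hq).1
    obtain ⟨s, hs, hsg⟩ := g.2 q hlt
    exact hg s hs (Subtype.ext hsg)

lemma mem_associatedPrimes_of_dimOneBelow [IsNoetherianRing P] [Module.Finite P W]
    (ht : t ∈ p.asIdeal) (hp : p ∉ Module.support P (Submodule.torsionBy P W t))
    (hq : q ∈ dimOneBelow t p) (hqW : q.asIdeal ∈ associatedPrimes P W) :
    p.asIdeal ∈ associatedPrimes P (QuotSMulTop t W) := by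
  let G : Submodule P W :=
    { carrier := {w | ∀ a ∈ q.asIdeal, ∃ s ∉ p.asIdeal, s • a • w = 0}
      add_mem' := by
        intro v w hv hw a ha
        obtain ⟨s, hs, hsa⟩ := hv a ha
        obtain ⟨r, hr, hrb⟩ := hw a ha
        refine ⟨s * r, fun h => (p.2.mem_or_mem h).elim hs hr, ?_⟩
        rw [smul_add, smul_add, mul_smul, mul_smul, hrb, smul_zero, smul_comm s r, hsa, smul_zero,
          add_zero]
      zero_mem' := fun a _ => ⟨1, p.2.one_notMem, by simp⟩
      smul_mem' := by
        intro c w hw a ha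
        obtain ⟨s, hs, hsa⟩ := hw a ha
        exact ⟨s, hs, by rw [smul_comm a c, smul_comm s c, hsa, smul_zero]⟩ }
  obtain ⟨-, x, hx⟩ := isAssociatedPrime_iff.1 hqW
  have hmem : ∀ r, r ∈ q.asIdeal ↔ r • x = 0 := fun r => by
    rw [hx, Submodule.mem_colon_singleton, Submodule.mem_bot]
  refine mem_associatedPrimes_quotSMulTop G ?_ ?_ ht ?_
  · intro w hw a ha
    obtain ⟨s, hs, hsw⟩ := hw a ha
    have hsw' : s • a • w ∈ Submodule.torsionBy P W t := by
      rw [Submodule.mem_torsionBy_iff, smul_comm t s, smul_comm t a, hsw]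
    obtain ⟨r, hr, hrw⟩ := Module.notMem_support_iff'.1 hp ⟨_, hsw'⟩
    exact ⟨r * s, fun h => (p.2.mem_or_mem h).elim hr hs, by
      rw [mul_smul]; exact congrArg Subtype.val hrw⟩
  · refine Module.mem_support_iff'.2 ⟨⟨x, fun a ha => ⟨1, p.2.one_notMem, ?_⟩⟩, ?_⟩
    · rw [(hmem a).1 ha, smul_zero]
    · intro r hr h0
      exact hr (hq.1 ((hmem r).2 (congrArg Subtype.val h0)))
  · intro r hr hrp
    obtain ⟨hrG, htr⟩ := mem_support_quotSMulTop_imp hr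
    refine hq.2.2 r (fun a ha => ?_) htr hrp
    by_contra har
    obtain ⟨g, hg⟩ := Module.mem_support_iff'.1 hrG
    obtain ⟨s, hs, hsg⟩ := g.2 a ha
    exact hg (s * a) (fun h => (r.2.mem_or_mem h).elim (fun h => hs (hrp h)) har)
      (Subtype.ext (by rw [mul_smul]; exact hsg))

theorem Kos.positivity [IsNoetherianRing P] {n : ℕ} {Y : ℕ → ModuleCat.{u} P} (hY : Kos n Y) :
    ∀ p : PrimeSpectrum P, (∀ l ≤ n, IsIsolatedAt p (Y l)) →
      0 ≤ altSum (fun l => localLength p (Y l)) n ∧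
      (altSum (fun l => localLength p (Y l)) n = 0 → ∀ l ≤ n, p ∉ Module.support P (Y l)) ∧
      ((∃ l ≤ n, p ∈ Module.support P (Y l)) → p.asIdeal ∈ associatedPrimes P (Y (n + 1))) := by
  induction hY with
  | zero Y hfin h0 =>
    intro p _
    have hp : p ∉ Module.support P (Y 0) := by rw [Module.support_eq_empty]; simp
    have hp' : ∀ l ≤ 0, p ∉ Module.support P (Y l) := fun l hl => by
      rw [Nat.le_zero.1 hl]; exact hp
    refine ⟨localLength_nonneg, fun _ => hp', ?_⟩
    rintro ⟨l, hl, hpl⟩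
    exact absurd hpl (hp' l hl)
  | succ n X Y t hX hfin h0 hYX ih =>
    intro p hiso
    have hXfin := hX.finite
    have hX0 := hX.subsingleton
    choose f g hf hfg hg using hYX
    have hY0 : ∀ r, r ∉ Module.support P (Y 0) := fun r => by
      rw [Module.support_eq_empty]; simp
    have hsuppY : ∀ r l, r ∈ Module.support P (Y (l + 1)) →
        r ∈ Module.support P (QuotSMulTop t (X l)) ∨
        r ∈ Module.support P (Submodule.torsionBy P (X (l + 1)) t) :=
      fun r l h => mem_support_of_exact (f l) (g l) (hfg l) h
    by_cases ht : t ∈ p.asIdeal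
    swap
    · have hz : ∀ l, p ∉ Module.support P (Y l) := by
        rintro (_ | l) h
        · exact hY0 p h
        · rcases hsuppY p l h with h | h
          · exact ht (mem_support_quotSMulTop_imp h).2
          · exact ht (mem_of_mem_support_torsionBy h)
      refine ⟨?_, fun _ l _ => hz l, fun ⟨l, _, h⟩ => absurd h (hz l)⟩
      have : ∀ m, altSum (fun l => localLength p (Y l)) m = 0 := by
        intro m
        induction m with
        | zero => exact localLength_of_notMem_support (hz 0)
        | succ m ih => rw [altSum, ih, localLength_of_notMem_support (hz _), sub_zero]
      rw [this]
    have hmod : ∀ l ≤ n, IsIsolatedAtMod t p (X l) := fun l hl =>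
      isIsolatedAtMod_of_quotSMulTop ((hiso (l + 1) (by omega)).of_injective (f l) (hf l))
    have htor : ∀ l ≤ n, IsIsolatedAt p (Submodule.torsionBy P (X (l + 1)) t) := fun l hl =>
      (hiso (l + 1) (by omega)).of_surjective (g l) (hg l)
    have hdim : ∀ l ≤ n, ∀ q ∈ Module.support P (X l), q ≤ p → q ≠ p → q ∈ dimOneBelow t p :=
      fun l hl q hq hqp hne => ⟨hqp, fun h => hne (hmod l hl q hq h hqp), fun r hr htr hrp =>
        hmod l hl r (Module.mem_support_mono hr hq) htr hrp⟩
    have hisoX : ∀ q ∈ dimOneBelow t p, ∀ l ≤ n, IsIsolatedAt q (X l) := fun q hq l hl =>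
      (hmod l hl).isIsolatedAt ht hq
    have hvanish : (∀ q ∈ dimOneBelow t p, ∀ l ≤ n, q ∉ Module.support P (X l)) →
        p ∉ Module.support P (Submodule.torsionBy P (X (n + 1)) t) →
        ∀ l ≤ n + 1, p ∉ Module.support P (Y l) := by
      intro h1 h2
      have hisoX' : ∀ l ≤ n, IsIsolatedAt p (X l) := by
        intro l hl q hq hqp
        by_contra hne
        exact h1 q (hdim l hl q hq hqp hne) l hl hq
      have hX' : ∀ l ≤ n, p ∉ Module.support P (X l) := by
        intro l hl h
        exact h2 (mem_support_torsionBy_of_mem_associatedPrimes ht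
          ((ih p hisoX').2.2 ⟨l, hl, h⟩))
      rintro (_ | l) hl h
      · exact hY0 p h
      · rcases hsuppY p l h with h | h
        · exact hX' l (by omega) (mem_support_quotSMulTop_imp h).1
        · rcases (show l ≤ n by omega).eq_or_lt with rfl | hlt
          · exact h2 h
          · exact hX' (l + 1) hlt (Module.support_subset_of_injective _
              (Submodule.subtype_injective _) h)
    have hfinite : (⋃ l ∈ Finset.range (n + 1),
        dimOneBelow t p ∩ Module.support P (X l)).Finite :=
      Set.Finite.biUnion (Finset.finite_toSet _) fun l hl =>
        (hmod l (by simpa [Nat.lt_succ_iff] using hl)).finite_dimOneBelow ht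
    obtain ⟨F, hF⟩ := hfinite.exists_finset
    have hFmem : ∀ q ∈ F, q ∈ dimOneBelow t p := by
      intro q hq
      obtain ⟨l, -, h⟩ := Set.mem_iUnion₂.1 ((hF q).1 hq)
      exact h.1
    have hmemF : ∀ q ∈ dimOneBelow t p, ∀ l ≤ n, q ∈ Module.support P (X l) → q ∈ F :=
      fun q hq l hl h => (hF q).2 (Set.mem_iUnion₂.2 ⟨l, by simpa [Nat.lt_succ_iff] using hl,
        hq, h⟩)
    have hsum : altSum (fun l => localLength p (Y l)) (n + 1) =
        localLength p (Submodule.torsionBy P (X (n + 1)) t) +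
        ∑ q ∈ F, eulerMul t p (P ⧸ q.asIdeal) * altSum (fun l => localLength q (X l)) n := by
      rw [← altSum_sum, altSum_eq_add_altSum _ (fun l => localLength p (QuotSMulTop t (X l)))
          (fun l => localLength p (Submodule.torsionBy P (X l) t))
          (localLength_of_notMem_support (hY0 p)) _ n
          (fun l hl => localLength_additive (f l) (g l) (hf l) (hg l) (hfg l)
            (hiso _ (Nat.succ_le_succ hl)))]
      · congr 1
        refine altSum_congr fun l hl => ?_
        exact eulerMul_eq_sum ht F hFmem (hmod l hl) (fun q hq h => hmemF q hq l hl h)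
      · apply localLength_of_notMem_support
        intro h
        exact absurd (Module.support_subset_of_injective _ (Submodule.subtype_injective _) h)
          (by rw [Module.support_eq_empty]; simp)
    have hnn : ∀ q ∈ F, 0 ≤ eulerMul t p (P ⧸ q.asIdeal) *
        altSum (fun l => localLength q (X l)) n := fun q hq =>
      mul_nonneg (eulerMul_quotient_pos (hFmem q hq) ht).le (ih q (hisoX q (hFmem q hq))).1
    refine ⟨?_, ?_, ?_⟩
    · rw [hsum]
      exact add_nonneg localLength_nonneg (Finset.sum_nonneg hnn)
    · intro h
      rw [hsum] at h
      have h1 : localLength p (Submodule.torsionBy P (X (n + 1)) t) = 0 := by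
        have := Finset.sum_nonneg hnn
        have := localLength_nonneg (p := p) (X := Submodule.torsionBy P (X (n + 1)) t)
        linarith
      rw [h1, zero_add, Finset.sum_eq_zero_iff_of_nonneg hnn] at h
      apply hvanish
      · intro q hq l hl hql
        have hqF := hmemF q hq l hl hql
        have := (mul_eq_zero.1 (h q hqF)).resolve_left
          (eulerMul_quotient_pos (hFmem q hqF) ht).ne'
        exact (ih q (hisoX q hq)).2.1 this l hl hql
      · intro h
        exact (localLength_pos (htor n le_rfl) h).ne' h1
    · rintro ⟨l, hl, hpl⟩
      refine associatedPrimes.subset_of_injective (hf (n + 1)) ?_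
      by_cases hA : p ∈ Module.support P (Submodule.torsionBy P (X (n + 1)) t)
      · exact mem_associatedPrimes_of_mem_support_torsionBy ht (htor n le_rfl) hA
      · have : ∃ q ∈ dimOneBelow t p, ∃ l ≤ n, q ∈ Module.support P (X l) := by
          by_contra! hcon
          exact hvanish hcon hA l hl hpl
        obtain ⟨q, hq, m, hm, hqm⟩ := this
        exact mem_associatedPrimes_of_dimOneBelow ht hA hq
          ((ih q (hisoX q hq)).2.2 ⟨m, hm, hqm⟩)

end Kos


section Rigidity

variable {P : Type u} [CommRing P]

lemma Kos.of_succ {n : ℕ} {Y : ℕ → ModuleCat.{u} P} (h : Kos (n + 1) Y) : Kos n Y := by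
  induction n generalizing Y with
  | zero => exact Kos.zero Y h.finite h.subsingleton
  | succ n ih =>
    cases h with
    | succ _ X _ t hX hfin h0 hY => exact Kos.succ n X Y t (ih hX) hfin h0 hY

lemma Kos.of_le {m n : ℕ} (hmn : m ≤ n) {Y : ℕ → ModuleCat.{u} P} (h : Kos n Y) : Kos m Y := by
  induction n, hmn using Nat.le_induction with
  | base => exact h
  | succ n _ ih => exact ih h.of_succ

lemma altSum_shift (y e : ℕ → ℤ) (h0 : y 0 = 0) (n : ℕ) (h : ∀ l ≤ n, y (l + 1) = e l) :
    altSum y (n + 1) = altSum e n := by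
  induction n with
  | zero => simp [altSum, h0, h]
  | succ n ih => rw [altSum, ih fun l hl => h l (hl.trans n.le_succ), altSum, h _ le_rfl]

variable [IsNoetherianRing P]

lemma exists_minimal_primeSpectrum (S : Set (PrimeSpectrum P)) (hS : S.Nonempty) :
    ∃ p ∈ S, ∀ q ∈ S, q ≤ p → q = p := by
  obtain ⟨p, hp, hmin⟩ := WellFounded.has_min
    (InvImage.wf (fun p : PrimeSpectrum P => p.asIdeal.height) wellFounded_lt) S hS
  refine ⟨p, hp, fun q hq hqp => ?_⟩
  by_contra hne
  have hlt : q.asIdeal < p.asIdeal := lt_of_le_of_ne hqp fun h => hne (PrimeSpectrum.ext h)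
  exact hmin q hq (Ideal.height_strict_mono_of_isPrime_of_isPrime hlt)

theorem subsingleton_of_kos {n : ℕ} {T E Y : ℕ → ModuleCat.{u} P} (hY : Kos (n + 1) Y)
    [∀ l, Module.Finite P (T l)] (a : ∀ l, T l →ₗ[P] E l) (b : ∀ l, E (l + 1) →ₗ[P] T l)
    (c : ∀ l, T l →ₗ[P] T (l + 2)) (ha0 : Function.Bijective (a 0))
    (ha1 : Function.Injective (a 1)) (hab : ∀ l, Function.Exact (a (l + 1)) (b l))
    (hbc : ∀ l, Function.Exact (b l) (c l)) (hca : ∀ l, Function.Exact (c l) (a (l + 2)))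
    (e : ∀ l ≤ n, Nonempty (E l ≃ₗ[P] Y (l + 1))) (hn : Subsingleton (T n)) :
    ∀ l ≤ n, Subsingleton (T l) := by
  by_contra! hcon
  obtain ⟨l₀, hl₀, hT₀⟩ := hcon
  obtain ⟨p, ⟨l₁, hl₁, hp⟩, hmin⟩ := exists_minimal_primeSpectrum
    {p | ∃ l ≤ n, p ∈ Module.support P (T l)} (by
      obtain ⟨p, hp⟩ := Module.nonempty_support_iff (R := P) (M := T l₀) |>.2
        (by simpa using hT₀)
      exact ⟨p, l₀, hl₀, hp⟩)
  have hT : ∀ l ≤ n, IsIsolatedAt p (T l) := fun l hl q hq hqp => hmin q ⟨l, hl, hq⟩ hqp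
  have hEiso : ∀ l ≤ n, IsIsolatedAt p (E l) := by
    rintro (_ | l) hl
    · exact (hT 0 hl).of_surjective (a 0) ha0.2
    · exact (hT (l + 1) hl).of_exact (hT l (by omega)) (a (l + 1)) (b l) (hab l)
  have hYfin := hY.finite
  have hEfin : ∀ l ≤ n, Module.Finite P (E l) := fun l hl => by
    obtain ⟨f⟩ := e l hl
    exact Module.Finite.of_injective (f : E l →ₗ[P] Y (l + 1)) f.injective
  have hY0 : p ∉ Module.support P (Y 0) := by
    have := hY.subsingleton
    rw [Module.support_eq_empty]
    simp
  have hYiso : ∀ l ≤ n + 1, IsIsolatedAt p (Y l) := by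
    rintro (_ | l) hl
    · have := hY.subsingleton
      intro q hq
      rw [Module.support_eq_empty] at hq
      simp at hq
    · obtain ⟨f⟩ := e l (by omega)
      exact (hEiso l (by omega)).of_surjective (f : E l →ₗ[P] Y (l + 1)) f.surjective
  have hmain : p ∉ Module.support P (T n) := by
    rw [Module.support_eq_empty]
    simp
  obtain ⟨m, rfl⟩ : ∃ m, n = m + 1 := by
    rcases n with _ | m
    · rw [Nat.le_zero.1 hl₁] at hp
      exact absurd hp hmain
    · exact ⟨m, rfl⟩
  have hrange : ∀ l ≤ m, localLength p (LinearMap.range (b l)) =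
      localLength p (T l) - localLength p (LinearMap.range (c l)) := by
    intro l hl
    have := localLength_ker_add_range (c l) (hT l (by omega))
    rw [(hbc l).linearMap_ker_eq] at this
    linarith
  have hEl : ∀ l ≤ m, localLength p (E (l + 1)) = localLength p (LinearMap.range (a (l + 1))) +
      (localLength p (T l) - localLength p (LinearMap.range (c l))) := by
    intro l hl
    have := hEfin (l + 1) (by omega)
    rw [localLength_ker_add_range (b l) (hEiso (l + 1) (by omega)), (hab l).linearMap_ker_eq,
      hrange l hl]
  have hsum : ∀ l ≤ m, altSum (fun l => localLength p (E l)) (l + 1) =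
      localLength p (T (l + 1)) - localLength p (LinearMap.range (c l)) := by
    intro l
    induction l with
    | zero =>
      intro hl
      rw [altSum, altSum, hEl 0 hl, localLength_eq_of_equiv (LinearEquiv.ofInjective _ ha1),
        localLength_eq_of_equiv (LinearEquiv.ofBijective (a 0) ha0)]
      ring
    | succ l ih =>
      intro hl
      have := localLength_ker_add_range (a (l + 2)) (hT (l + 2) (by omega))
      rw [(hca l).linearMap_ker_eq] at this
      rw [altSum, ih (by omega), hEl (l + 1) hl]
      linarith
  obtain ⟨h1, h2, -⟩ := hY.positivity p hYiso
  rw [altSum_shift _ (fun l => localLength p (E l)) (localLength_of_notMem_support hY0) (m + 1)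
    (fun l hl => (localLength_eq_of_equiv (e l hl).some).symm), hsum m le_rfl,
    localLength_of_notMem_support hmain] at h1 h2
  have h3 := h2 (le_antisymm (by
    have := localLength_nonneg (p := p) (X := LinearMap.range (c m)); linarith) h1)
  have hEsupp : ∀ l ≤ m + 1, p ∉ Module.support P (E l) := fun l hl h =>
    h3 (l + 1) (by omega) (by rwa [← (e l hl).some.support_eq])
  have : ∀ l ≤ m + 1, p ∉ Module.support P (T l) := by
    intro l
    induction l using Nat.strong_induction_on with
    | _ l ih =>
      intro hl h
      match l with
      | 0 => exact hEsupp 0 hl (Module.support_subset_of_injective _ ha0.1 h)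
      | 1 => exact hEsupp 1 hl (Module.support_subset_of_injective _ ha1 h)
      | l + 2 =>
        rcases mem_support_of_exact _ _ (hca l) h with h | h
        · exact ih l (by omega) (by omega) h
        · exact hEsupp _ hl h
  exact this l₁ hl₁ hp

end Rigidity


section RestrictedExt

variable {Q P : Type u} [CommRing Q] [CommRing P] [Algebra Q P]

/-- Restriction of scalars from `P`-modules to `Q`-modules. -/
noncomputable abbrev res (Q P : Type u) [CommRing Q] [CommRing P] [Algebra Q P] :
    ModuleCat.{u} P ⥤ ModuleCat.{u} Q :=
  ModuleCat.restrictScalars (algebraMap Q P)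

/-- `Ext_Q^l(X, N)` for a `P`-module `X`, carrying the `P`-module structure coming from `X`. -/
def ExtP (Q : Type u) {P : Type u} [CommRing Q] [CommRing P] [Algebra Q P] (X : ModuleCat.{u} P)
    (N : ModuleCat.{u} Q) (l : ℕ) : Type u :=
  Abelian.Ext ((res Q P).obj X) N l

variable (X : ModuleCat.{u} P) (N : ModuleCat.{u} Q) (l : ℕ)

noncomputable instance : AddCommGroup (ExtP Q X N l) :=
  inferInstanceAs (AddCommGroup (Abelian.Ext ((res Q P).obj X) N l))

/-- The action of `P` on `Ext_Q^l(X, N)`. -/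
noncomputable def ExtP.action : P →+* AddMonoid.End (Abelian.Ext ((res Q P).obj X) N l) where
  toFun p := (Abelian.Ext.mk₀ ((res Q P).map (p • 𝟙 X))).precomp N (zero_add l)
  map_one' := by
    ext e
    change (Abelian.Ext.mk₀ _).comp e (zero_add l) = e
    rw [one_smul, CategoryTheory.Functor.map_id, Abelian.Ext.mk₀_id_comp]
  map_mul' p q := by
    ext e
    change (Abelian.Ext.mk₀ _).comp e (zero_add l) =
      (Abelian.Ext.mk₀ _).comp ((Abelian.Ext.mk₀ _).comp e (zero_add l)) (zero_add l)
    rw [Abelian.Ext.mk₀_comp_mk₀_assoc, ← Functor.map_comp]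
    congr 3
    rw [Linear.smul_comp, Category.id_comp, smul_smul]
  map_zero' := by
    ext e
    change (Abelian.Ext.mk₀ _).comp e (zero_add l) = 0
    rw [zero_smul, Functor.map_zero, Abelian.Ext.mk₀_zero, Abelian.Ext.zero_comp]
  map_add' p q := by
    ext e
    change (Abelian.Ext.mk₀ _).comp e (zero_add l) =
      (Abelian.Ext.mk₀ _).comp e (zero_add l) + (Abelian.Ext.mk₀ _).comp e (zero_add l)
    rw [← Abelian.Ext.add_comp, ← Abelian.Ext.mk₀_add, ← Functor.map_add, add_smul]

noncomputable instance : Module P (ExtP Q X N l) :=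
  Module.compHom (Abelian.Ext ((res Q P).obj X) N l) (ExtP.action X N l)

noncomputable instance : Module Q (ExtP Q X N l) :=
  inferInstanceAs (Module Q (Abelian.Ext ((res Q P).obj X) N l))

instance : IsScalarTower Q P (ExtP Q X N l) := by
  refine IsScalarTower.of_algebraMap_smul fun r e => ?_
  have h : (res Q P).map ((algebraMap Q P r) • 𝟙 X) = r • 𝟙 ((res Q P).obj X) := by
    ext x; rfl
  have key (e : Abelian.Ext ((res Q P).obj X) N l) :
      (Abelian.Ext.mk₀ ((res Q P).map ((algebraMap Q P r) • 𝟙 X))).comp e (zero_add l) =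
        r • e := by
    rw [h, Abelian.Ext.mk₀_smul, Abelian.Ext.smul_comp, Abelian.Ext.mk₀_id_comp]
  exact key e

instance [IsNoetherianRing Q] [Module.Finite Q ((res Q P).obj X)] [Module.Finite Q N] :
    Module.Finite P (ExtP Q X N l) := by
  have : Module.Finite Q (ExtP Q X N l) :=
    inferInstanceAs (Module.Finite Q (Abelian.Ext ((res Q P).obj X) N l))
  exact Module.Finite.of_restrictScalars_finite Q P _

variable {X} {X' : ModuleCat.{u} P}

/-- Functoriality of `ExtP` in the first variable. -/
noncomputable def ExtP.map (f : X ⟶ X') : ExtP Q X' N l →ₗ[P] ExtP Q X N l where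
  toFun e := (Abelian.Ext.mk₀ ((res Q P).map f)).comp e (zero_add l)
  map_add' x y := Abelian.Ext.comp_add _ _ _ _
  map_smul' p e := by
    have key (e : Abelian.Ext ((res Q P).obj X') N l) :
        (Abelian.Ext.mk₀ ((res Q P).map f)).comp
          ((Abelian.Ext.mk₀ ((res Q P).map (p • 𝟙 X'))).comp e (zero_add l)) (zero_add l) =
        (Abelian.Ext.mk₀ ((res Q P).map (p • 𝟙 X))).comp
          ((Abelian.Ext.mk₀ ((res Q P).map f)).comp e (zero_add l)) (zero_add l) := by
      rw [Abelian.Ext.mk₀_comp_mk₀_assoc, Abelian.Ext.mk₀_comp_mk₀_assoc, ← Functor.map_comp,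
        ← Functor.map_comp, Linear.comp_smul, Linear.smul_comp, Category.comp_id,
        Category.id_comp]
    exact key e

/-- The extension class of the restriction of a short exact sequence. -/
noncomputable def resClass (Q : Type u) [CommRing Q] [Algebra Q P]
    {C : ShortComplex (ModuleCat.{u} P)} (hC : C.ShortExact) :
    Abelian.Ext ((res Q P).obj C.X₃) ((res Q P).obj C.X₁) 1 :=
  (hC.map_of_exact (res Q P)).extClass

lemma resClass_comp_smul {C : ShortComplex (ModuleCat.{u} P)} (hC : C.ShortExact) (p : P) :
    (resClass Q hC).comp (Abelian.Ext.mk₀ ((res Q P).map (p • 𝟙 C.X₁))) (add_zero 1) =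
      (Abelian.Ext.mk₀ ((res Q P).map (p • 𝟙 C.X₃))).comp (resClass Q hC) (zero_add 1) :=
  let φ : C ⟶ C :=
    { τ₁ := p • 𝟙 _
      τ₂ := p • 𝟙 _
      τ₃ := p • 𝟙 _ }
  ShortComplex.ShortExact.extClass_naturality (hC.map_of_exact (res Q P))
    (hC.map_of_exact (res Q P)) ((res Q P).mapShortComplex.map φ)

/-- The connecting map of `ExtP` in the first variable. -/
noncomputable def ExtP.connect {C : ShortComplex (ModuleCat.{u} P)} (hC : C.ShortExact) :
    ExtP Q C.X₁ N l →ₗ[P] ExtP Q C.X₃ N (l + 1) where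
  toFun e := (resClass Q hC).comp e (add_comm 1 l)
  map_add' x y := Abelian.Ext.comp_add _ _ _ _
  map_smul' p e := by
    have key (e : Abelian.Ext ((res Q P).obj C.X₁) N l) :
        (resClass Q hC).comp
          ((Abelian.Ext.mk₀ ((res Q P).map (p • 𝟙 C.X₁))).comp e (zero_add l)) (add_comm 1 l) =
        (Abelian.Ext.mk₀ ((res Q P).map (p • 𝟙 C.X₃))).comp
          ((resClass Q hC).comp e (add_comm 1 l)) (zero_add (l + 1)) := by
      rw [← Abelian.Ext.comp_assoc _ _ _ (add_zero 1) (zero_add l) (by omega),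
        ← Abelian.Ext.comp_assoc _ _ _ (zero_add 1) (add_comm 1 l) (by omega),
        resClass_comp_smul]
    exact key e

lemma ExtP.exact_map_connect {C : ShortComplex (ModuleCat.{u} P)} (hC : C.ShortExact) :
    Function.Exact (ExtP.map N l C.f) (ExtP.connect N l hC) := by
  intro x
  constructor
  · intro hx
    exact Abelian.Ext.contravariant_sequence_exact₁ (hC.map_of_exact (res Q P)) N x (add_comm 1 l) hx
  · rintro ⟨y, rfl⟩
    exact ShortComplex.ShortExact.extClass_comp_assoc (hC.map_of_exact (res Q P)) y (h := add_comm 1 l)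

lemma ExtP.exact_connect_map {C : ShortComplex (ModuleCat.{u} P)} (hC : C.ShortExact) :
    Function.Exact (ExtP.connect N l hC) (ExtP.map N (l + 1) C.g) := by
  intro x
  constructor
  · intro hx
    exact Abelian.Ext.contravariant_sequence_exact₃ (hC.map_of_exact (res Q P)) N x hx (add_comm 1 l)
  · rintro ⟨y, rfl⟩
    exact ShortComplex.ShortExact.comp_extClass_assoc (hC.map_of_exact (res Q P)) y (add_comm 1 l)

lemma ExtP.exact_map_map {C : ShortComplex (ModuleCat.{u} P)} (hC : C.ShortExact) :
    Function.Exact (ExtP.map N l C.g) (ExtP.map N l C.f) := by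
  intro x
  constructor
  · intro hx
    exact Abelian.Ext.contravariant_sequence_exact₂ (hC.map_of_exact (res Q P)) N x hx
  · rintro ⟨y, rfl⟩
    have key (y : Abelian.Ext ((res Q P).obj C.X₃) N l) :
        (Abelian.Ext.mk₀ ((res Q P).map C.f)).comp
          ((Abelian.Ext.mk₀ ((res Q P).map C.g)).comp y (zero_add l)) (zero_add l) = 0 := by
      rw [Abelian.Ext.mk₀_comp_mk₀_assoc, ← Functor.map_comp, C.zero, Functor.map_zero,
        Abelian.Ext.mk₀_zero, Abelian.Ext.zero_comp]
    exact key y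

lemma ExtP.map_zero_injective (f : X ⟶ X') [Epi f] :
    Function.Injective (ExtP.map (Q := Q) N 0 f) :=
  Abelian.Ext.precomp_mk₀_injective_of_epi N ((res Q P).map f)

/-- Invariance of `ExtP` under isomorphisms. -/
noncomputable def ExtP.congr (f : X ≅ X') : ExtP Q X' N l ≃ₗ[P] ExtP Q X N l where
  __ := ExtP.map N l f.hom
  invFun := ExtP.map N l f.inv
  left_inv e := by
    have key (e : Abelian.Ext ((res Q P).obj X') N l) :
        (Abelian.Ext.mk₀ ((res Q P).map f.inv)).comp
          ((Abelian.Ext.mk₀ ((res Q P).map f.hom)).comp e (zero_add l)) (zero_add l) = e := by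
      rw [Abelian.Ext.mk₀_comp_mk₀_assoc, ← Functor.map_comp, f.inv_hom_id,
        CategoryTheory.Functor.map_id, Abelian.Ext.mk₀_id_comp]
    exact key e
  right_inv e := by
    have key (e : Abelian.Ext ((res Q P).obj X) N l) :
        (Abelian.Ext.mk₀ ((res Q P).map f.hom)).comp
          ((Abelian.Ext.mk₀ ((res Q P).map f.inv)).comp e (zero_add l)) (zero_add l) = e := by
      rw [Abelian.Ext.mk₀_comp_mk₀_assoc, ← Functor.map_comp, f.hom_inv_id,
        CategoryTheory.Functor.map_id, Abelian.Ext.mk₀_id_comp]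
    exact key e

omit [Algebra Q P] in
lemma Kos.congr {m : ℕ} {Y Y' : ℕ → ModuleCat.{u} P} (hY : Kos m Y)
    (e : ∀ l, Y l ≃ₗ[P] Y' l) : Kos m Y' := by
  cases hY with
  | zero _ hfin h0 =>
    exact Kos.zero _ (fun l => have := hfin l; Module.Finite.equiv (e l))
      ((e 0).symm.toEquiv.subsingleton)
  | succ n X Y t hX hfin h0 hY =>
    refine Kos.succ n X Y' t hX (fun l => have := hfin l; Module.Finite.equiv (e l))
      ((e 0).symm.toEquiv.subsingleton) fun l => ?_
    obtain ⟨f, g, hf, hfg, hg⟩ := hY l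
    refine ⟨(e (l + 1)).toLinearMap ∘ₗ f, g ∘ₗ (e (l + 1)).symm.toLinearMap, ?_, ?_, ?_⟩
    · exact (e (l + 1)).injective.comp hf
    · intro y
      constructor
      · intro hy
        obtain ⟨x, hx⟩ := (hfg _).1 hy
        exact ⟨x, by simp [hx]⟩
      · rintro ⟨x, rfl⟩
        simp [hfg.apply_apply_eq_zero]
    · exact hg.comp (e (l + 1)).symm.surjective

omit [Algebra Q P] in
lemma exists_quotSMulTop_torsion {A B C : Type u} [AddCommGroup A] [Module P A] [AddCommGroup B]
    [Module P B] [AddCommGroup C] [Module P C] (t : P) (δ : A →ₗ[P] B) (γ : B →ₗ[P] C)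
    (e1 : Function.Exact (fun x : A => t • x) δ) (e2 : Function.Exact δ γ)
    (e3 : Function.Exact γ (fun x : C => t • x)) :
    ∃ (f : QuotSMulTop t A →ₗ[P] B) (g : B →ₗ[P] Submodule.torsionBy P C t),
      Function.Injective f ∧ Function.Exact f g ∧ Function.Surjective g := by
  have hker : t • (⊤ : Submodule P A) = LinearMap.ker δ := by
    ext x
    rw [LinearMap.mem_ker, e1 x, Submodule.mem_smul_pointwise_iff_exists]
    constructor
    · rintro ⟨y, -, rfl⟩
      exact ⟨y, rfl⟩
    · rintro ⟨y, rfl⟩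
      exact ⟨y, trivial, rfl⟩
  refine ⟨Submodule.liftQ _ δ hker.le, γ.codRestrict _ fun x => ?_, ?_, ?_, ?_⟩
  · rw [Submodule.mem_torsionBy_iff]
    exact (e3 _).2 ⟨x, rfl⟩
  · rw [← LinearMap.ker_eq_bot]
    exact Submodule.ker_liftQ_eq_bot _ _ _ hker.ge
  · intro y
    have h1 : Set.range (Submodule.liftQ _ δ hker.le) = Set.range δ := by
      rw [← LinearMap.coe_range, Submodule.range_liftQ, LinearMap.coe_range]
    exact Subtype.ext_iff.trans ((e2 y).trans (h1 ▸ Iff.rfl))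
  · rintro ⟨x, hx⟩
    rw [Submodule.mem_torsionBy_iff] at hx
    obtain ⟨y, hy⟩ := (e3 x).1 hx
    exact ⟨y, Subtype.ext hy⟩

lemma res_finite_of_surjective {X X' : ModuleCat.{u} P} [Module.Finite Q ((res Q P).obj X)]
    (f : X ⟶ X') (hf : Function.Surjective f) : Module.Finite Q ((res Q P).obj X') :=
  Module.Finite.of_surjective ((res Q P).map f).hom hf

lemma Kos.extP_quotSMulTop [IsNoetherianRing Q] [Module.Finite Q N]
    {m : ℕ} {X : ModuleCat.{u} P} [Module.Finite Q ((res Q P).obj X)] {t : P}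
    (ht : IsSMulRegular X t) (h : Kos m (fun l => ModuleCat.of P (ExtP Q X N l))) :
    Kos (m + 1) (fun l => ModuleCat.of P (ExtP Q (ModuleCat.of P (QuotSMulTop t X)) N l)) := by
  have hC := ht.smulShortComplex_shortExact
  have hfin : Module.Finite Q ((res Q P).obj (ModuleCat.of P (QuotSMulTop t X))) :=
    res_finite_of_surjective (ModuleCat.ofHom (Submodule.mkQ (t • ⊤))) (Submodule.mkQ_surjective _)
  refine Kos.succ m _ _ t h (fun l => ?_) ?_ fun l => ?_
  · change Module.Finite P (ExtP Q _ N l)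
    infer_instance
  · have hinj := ExtP.map_zero_injective (Q := Q) N (X.smulShortComplex t).g
    have h0 : Subsingleton (ExtP Q (X.smulShortComplex t).X₂ N 0) := h.subsingleton
    exact hinj.subsingleton
  · exact exists_quotSMulTop_torsion t (ExtP.connect (Q := Q) N l hC)
      (ExtP.map (Q := Q) N (l + 1) (X.smulShortComplex t).g)
      (ExtP.exact_map_connect (Q := Q) N l hC) (ExtP.exact_connect_map (Q := Q) N l hC)
      (ExtP.exact_map_map (Q := Q) N (l + 1) hC)

lemma Kos.extP_quotient [IsNoetherianRing Q] [Module.Finite Q N] (rs : List P) :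
    ∀ {m : ℕ} {X : ModuleCat.{u} P} [Module.Finite Q ((res Q P).obj X)]
      (_ : RingTheory.Sequence.IsWeaklyRegular X rs)
      (_ : Kos m (fun l => ModuleCat.of P (ExtP Q X N l))),
      Kos (m + rs.length) (fun l => ModuleCat.of P
        (ExtP Q (ModuleCat.of P (X ⧸ (Ideal.ofList rs • ⊤ : Submodule P X))) N l)) := by
  induction rs with
  | nil =>
    intro m X _ _ h
    refine h.congr fun l => (ExtP.congr N l ?_).symm
    exact (Submodule.quotEquivOfEqBot _ (by simp)).symm.toModuleIso
  | cons t rs ih =>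
    intro m X hX hreg h
    rw [RingTheory.Sequence.isWeaklyRegular_cons_iff] at hreg
    have hfin : Module.Finite Q ((res Q P).obj (ModuleCat.of P (QuotSMulTop t X))) :=
      res_finite_of_surjective (ModuleCat.ofHom (Submodule.mkQ (t • ⊤))) (Submodule.mkQ_surjective _)
    have := ih (X := ModuleCat.of P (QuotSMulTop t X)) hreg.2 (h.extP_quotSMulTop N hreg.1)
    rw [List.length_cons, add_comm rs.length, ← add_assoc]
    exact this.congr fun l => ExtP.congr N l
      (Submodule.quotOfListConsSMulTopEquivQuotSMulTopInner X t rs).toModuleIso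

end RestrictedExt


section PolynomialModule

variable {σ : Type*} {S : Type*} [CommRing S] {M : Type*} [AddCommGroup M] [Module S M]

/-- The coefficient of an element of `S[Z] ⊗ M`. -/
noncomputable def tcoeff (d : σ →₀ ℕ) : MvPolynomial σ S ⊗[S] M →ₗ[S] M :=
  TensorProduct.lift ((LinearMap.lsmul S M).comp (MvPolynomial.lcoeff S d))

@[simp]
lemma tcoeff_tmul (d : σ →₀ ℕ) (p : MvPolynomial σ S) (m : M) :
    tcoeff d (p ⊗ₜ[S] m) = p.coeff d • m := rfl

lemma tcoeff_X_smul [DecidableEq σ] (d : σ →₀ ℕ) (j : σ) (z : MvPolynomial σ S ⊗[S] M) :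
    tcoeff d ((MvPolynomial.X j : MvPolynomial σ S) • z) =
      if j ∈ d.support then tcoeff (d - Finsupp.single j 1) z else 0 := by
  induction z with
  | zero => simp
  | tmul p m =>
    rw [TensorProduct.smul_tmul', smul_eq_mul, tcoeff_tmul, MvPolynomial.coeff_X_mul']
    split_ifs <;> simp
  | add x y hx hy =>
    rw [smul_add, map_add, hx, hy, map_add]
    split_ifs <;> simp

lemma eq_sum_tcoeff (z : MvPolynomial σ S ⊗[S] M) :
    ∃ v : (σ →₀ ℕ) →₀ M, z = v.sum (fun d m => MvPolynomial.monomial d (1 : S) ⊗ₜ[S] m) ∧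
      ∀ d, tcoeff d z = v d := by
  classical
  suffices h : ∃ v : (σ →₀ ℕ) →₀ M,
      z = v.sum (fun d m => MvPolynomial.monomial d (1 : S) ⊗ₜ[S] m) by
    obtain ⟨v, hv⟩ := h
    refine ⟨v, hv, fun d => ?_⟩
    rw [hv, Finsupp.sum, map_sum]
    simp only [tcoeff_tmul, MvPolynomial.coeff_monomial, ite_smul, one_smul, zero_smul]
    rw [Finset.sum_ite_eq']
    simp +contextual [eq_comm]
  have hadd (v w : (σ →₀ ℕ) →₀ M) :
      (v + w).sum (fun d m => MvPolynomial.monomial d (1 : S) ⊗ₜ[S] m) =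
        v.sum (fun d m => MvPolynomial.monomial d (1 : S) ⊗ₜ[S] m) +
        w.sum (fun d m => MvPolynomial.monomial d (1 : S) ⊗ₜ[S] m) :=
    Finsupp.sum_add_index' (fun _ => TensorProduct.tmul_zero _ _)
      (fun _ _ _ => TensorProduct.tmul_add _ _ _)
  induction z with
  | zero => exact ⟨0, by simp⟩
  | add x y hx hy =>
    obtain ⟨v, rfl⟩ := hx
    obtain ⟨w, rfl⟩ := hy
    exact ⟨v + w, (hadd v w).symm⟩
  | tmul p m =>
    induction p using MvPolynomial.induction_on' with
    | monomial d a =>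
      refine ⟨Finsupp.single d (a • m), ?_⟩
      rw [Finsupp.sum_single_index (by simp), ← TensorProduct.smul_tmul, MvPolynomial.smul_monomial,
        smul_eq_mul, mul_one]
    | add p q hp hq =>
      obtain ⟨v, hv⟩ := hp
      obtain ⟨w, hw⟩ := hq
      exact ⟨v + w, by rw [TensorProduct.add_tmul, hv, hw, hadd]⟩

lemma mem_ofList_X_smul_top_iff (l : List σ) (z : MvPolynomial σ S ⊗[S] M) :
    z ∈ (Ideal.ofList (l.map (MvPolynomial.X (R := S))) •
      (⊤ : Submodule (MvPolynomial σ S) (MvPolynomial σ S ⊗[S] M))) ↔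
      ∀ d : σ →₀ ℕ, (∀ j ∈ l, d j = 0) → tcoeff d z = 0 := by
  classical
  constructor
  · intro hz d hd
    rw [Ideal.ofList, ← Submodule.span_univ] at hz
    have hz' := Submodule.smul_induction_on (p := fun z => ∀ r : MvPolynomial σ S,
      tcoeff d (r • z) = 0) hz ?_ ?_
    · simpa using hz' 1
    · intro p hp n _ r
      rw [smul_smul, mul_comm, mul_smul]
      generalize r • n = n
      refine Submodule.span_induction (p := fun p _ => ∀ n : MvPolynomial σ S ⊗[S] M,
        tcoeff d (p • n) = 0) ?_ ?_ ?_ ?_ hp n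
      · rintro _ hx n
        obtain ⟨j, hj, rfl⟩ := List.mem_map.1 hx
        rw [tcoeff_X_smul, if_neg (by simp [hd j hj])]
      · simp
      · intro x y _ _ hx hy n
        rw [add_smul, map_add, hx, hy, add_zero]
      · intro a x _ hx n
        rw [smul_eq_mul, mul_comm, mul_smul, hx]
    · intro x y hx hy r
      rw [smul_add, map_add, hx, hy, add_zero]
  · intro h
    obtain ⟨v, hv, hc⟩ := eq_sum_tcoeff z
    rw [hv]
    refine Submodule.sum_mem _ fun d hd => ?_
    have hne : tcoeff d z ≠ 0 := by rw [hc]; exact Finsupp.mem_support_iff.1 hd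
    have : ∃ j ∈ l, d j ≠ 0 := by
      by_contra! hcon
      exact hne (h d hcon)
    obtain ⟨j, hj, hdj⟩ := this
    have : (MvPolynomial.monomial d (1 : S)) ⊗ₜ[S] (v d) =
        (MvPolynomial.X j : MvPolynomial σ S) •
          ((MvPolynomial.monomial (d - Finsupp.single j 1) (1 : S)) ⊗ₜ[S] (v d)) := by
      rw [TensorProduct.smul_tmul', smul_eq_mul, MvPolynomial.X, MvPolynomial.monomial_mul, one_mul,
        add_tsub_cancel_of_le (by simpa [Nat.one_le_iff_ne_zero] using hdj)]
    beta_reduce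
    rw [this]
    exact Submodule.smul_mem_smul (Ideal.subset_span (List.mem_map_of_mem hj)) trivial

/-- Distinct variables form a weakly regular sequence on `S[Z] ⊗ M`. -/
lemma isWeaklyRegular_X (l : List σ) (hl : l.Nodup) :
    RingTheory.Sequence.IsWeaklyRegular (MvPolynomial σ S ⊗[S] M)
      (l.map (MvPolynomial.X (R := S))) := by
  classical
  refine ⟨fun i hi => ?_⟩
  rw [← List.map_take]
  rw [isSMulRegular_quotient_iff_mem_of_smul_mem]
  intro z hz
  rw [mem_ofList_X_smul_top_iff] at hz ⊢
  intro d hd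
  rw [List.length_map] at hi
  rw [List.getElem_map] at hz
  have hni : ∀ j ∈ l.take i, j ≠ l[i] := by
    rintro j hj rfl
    obtain ⟨k, hk, hkj⟩ := List.mem_take_iff_getElem.1 hj
    have := (List.Nodup.getElem_inj_iff hl).1 hkj
    omega
  have h1 := hz (d + Finsupp.single l[i] 1) fun j hj => by
    simp [hd j hj, (hni j hj)]
  rw [tcoeff_X_smul, if_pos (by simp), add_tsub_cancel_right] at h1
  exact h1

end PolynomialModule

section Twist

variable (A : Type u) [CommRing A] (σ : Type u)

/-- The endomorphism of `A[X][Z]` fixing `Z` and sending `X_j` to `X_j + Z_j`. -/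
noncomputable def twist :
    MvPolynomial σ (MvPolynomial σ A) →+* MvPolynomial σ (MvPolynomial σ A) :=
  MvPolynomial.eval₂Hom
    (MvPolynomial.eval₂Hom (MvPolynomial.C.comp MvPolynomial.C)
      (fun j => MvPolynomial.C (MvPolynomial.X j) + MvPolynomial.X j)) MvPolynomial.X

@[simp]
lemma twist_X (j : σ) : twist A σ (MvPolynomial.X j) = MvPolynomial.X j := by
  simp [twist]

@[simp]
lemma twist_C_X (j : σ) : twist A σ (MvPolynomial.C (MvPolynomial.X j)) =
    MvPolynomial.C (MvPolynomial.X j) + MvPolynomial.X j := by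
  simp [twist]

@[simp]
lemma twist_C_C (a : A) : twist A σ (MvPolynomial.C (MvPolynomial.C a)) =
    MvPolynomial.C (MvPolynomial.C a) := by
  simp [twist]

variable (M : Type u) [AddCommGroup M] [Module (MvPolynomial σ A) M]

/-- The module `M[Z]` with the action of `A[X][Z]` twisted by `twist`. -/
def TwMod : Type u := MvPolynomial σ (MvPolynomial σ A) ⊗[MvPolynomial σ A] M

noncomputable instance : AddCommGroup (TwMod A σ M) :=
  inferInstanceAs (AddCommGroup (MvPolynomial σ (MvPolynomial σ A) ⊗[MvPolynomial σ A] M))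

noncomputable instance : Module (MvPolynomial σ (MvPolynomial σ A)) (TwMod A σ M) :=
  Module.compHom (MvPolynomial σ (MvPolynomial σ A) ⊗[MvPolynomial σ A] M) (twist A σ)

/-- The constant elements of `M[Z]`. -/
noncomputable def TwMod.mk : M →+ TwMod A σ M where
  toFun m := (1 : MvPolynomial σ (MvPolynomial σ A)) ⊗ₜ[MvPolynomial σ A] m
  map_zero' := TensorProduct.tmul_zero _ _
  map_add' := TensorProduct.tmul_add _

variable {A σ M}

lemma TwMod.C_C_smul_mk (a : A) (m : M) :
    (MvPolynomial.C (MvPolynomial.C a) : MvPolynomial σ (MvPolynomial σ A)) • TwMod.mk A σ M m =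
      TwMod.mk A σ M ((MvPolynomial.C a : MvPolynomial σ A) • m) := by
  change (twist A σ _) • ((1 : MvPolynomial σ (MvPolynomial σ A)) ⊗ₜ[MvPolynomial σ A] m) =
    (1 : MvPolynomial σ (MvPolynomial σ A)) ⊗ₜ[MvPolynomial σ A] _
  rw [twist_C_C, TensorProduct.smul_tmul', smul_eq_mul, ← TensorProduct.smul_tmul,
    MvPolynomial.smul_eq_C_mul]

lemma TwMod.C_X_smul_mk (j : σ) (m : M) :
    (MvPolynomial.C (MvPolynomial.X j) : MvPolynomial σ (MvPolynomial σ A)) • TwMod.mk A σ M m =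
      TwMod.mk A σ M ((MvPolynomial.X j : MvPolynomial σ A) • m) +
        (MvPolynomial.X j : MvPolynomial σ (MvPolynomial σ A)) • TwMod.mk A σ M m := by
  change (twist A σ _) • ((1 : MvPolynomial σ (MvPolynomial σ A)) ⊗ₜ[MvPolynomial σ A] m) =
    (1 : MvPolynomial σ (MvPolynomial σ A)) ⊗ₜ[MvPolynomial σ A] _ +
      (twist A σ _) • ((1 : MvPolynomial σ (MvPolynomial σ A)) ⊗ₜ[MvPolynomial σ A] m)
  rw [twist_C_X, twist_X, add_smul]
  congr 1
  rw [TensorProduct.smul_tmul', smul_eq_mul, ← TensorProduct.smul_tmul,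
    MvPolynomial.smul_eq_C_mul]

lemma TwMod.induction {p : TwMod A σ M → Prop} (hadd : ∀ x y, p x → p y → p (x + y))
    (hmk : ∀ m, p (TwMod.mk A σ M m))
    (hX : ∀ j x, p x → p ((MvPolynomial.X j : MvPolynomial σ (MvPolynomial σ A)) • x))
    (x : TwMod A σ M) : p x := by
  have h0 : p 0 := by simpa using hmk 0
  have hX' (j : σ) (x : MvPolynomial σ (MvPolynomial σ A) ⊗[MvPolynomial σ A] M)
      (hx : p x) : p ((MvPolynomial.X j : MvPolynomial σ (MvPolynomial σ A)) • x) := by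
    have := hX j x hx
    change p ((twist A σ _) • x) at this
    rwa [twist_X] at this
  refine TensorProduct.induction_on
    (motive := fun z : MvPolynomial σ (MvPolynomial σ A) ⊗[MvPolynomial σ A] M => p z)
    x h0 (fun q m => ?_) hadd
  induction q using MvPolynomial.induction_on generalizing m with
  | C a =>
    have := hmk (a • m)
    change p ((1 : MvPolynomial σ (MvPolynomial σ A)) ⊗ₜ[MvPolynomial σ A] (a • m)) at this
    rwa [← TensorProduct.smul_tmul, MvPolynomial.smul_eq_C_mul, mul_one] at this
  | add q r hq hr =>
    rw [TensorProduct.add_tmul]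
    exact hadd _ _ (hq m) (hr m)
  | mul_X q j hq =>
    rw [mul_comm, ← smul_eq_mul, ← TensorProduct.smul_tmul']
    exact hX' j _ (hq m)

lemma TwMod.isWeaklyRegular (l : List σ) (hl : l.Nodup) :
    RingTheory.Sequence.IsWeaklyRegular (TwMod A σ M)
      (l.map (MvPolynomial.X (R := MvPolynomial σ A))) := by
  refine (AddEquiv.isWeaklyRegular_congr
    (e := AddEquiv.refl (MvPolynomial σ (MvPolynomial σ A) ⊗[MvPolynomial σ A] M))
    (M₂ := TwMod A σ M) ?_).1 (isWeaklyRegular_X l hl)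
  rw [List.forall₂_same]
  intro r hr x
  obtain ⟨j, -, rfl⟩ := List.mem_map.1 hr
  change _ = (twist A σ _) • x
  rw [twist_X]
  rfl

end Twist


section Diagonal

variable (A : Type u) [CommRing A] (σ : Type u) (Q : Type u) [CommRing Q]
  [Algebra (MvPolynomial σ A) Q] (M : Type u) [AddCommGroup M] [Module (MvPolynomial σ A) M]

section

attribute [local instance] MvPolynomial.algebraMvPolynomial

lemma flat_mvPolynomial (σ S Q : Type u) [CommRing S] [CommRing Q] [Algebra S Q]
    [Module.Flat S Q] : Module.Flat (MvPolynomial σ S) (MvPolynomial σ Q) :=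
  Module.Flat.isBaseChange (R := S) (M := Q) _ _
    (Algebra.IsPushout.out (R := S) (S := MvPolynomial σ S) (R' := Q) (S' := MvPolynomial σ Q))

/-- The base change of `TwMod` along `A[X][Z] → Q[Z]`. -/
def DiagMod : Type u :=
  MvPolynomial σ Q ⊗[MvPolynomial σ (MvPolynomial σ A)] TwMod A σ M

noncomputable instance : AddCommGroup (DiagMod A σ Q M) :=
  inferInstanceAs (AddCommGroup (MvPolynomial σ Q ⊗[MvPolynomial σ (MvPolynomial σ A)] TwMod A σ M))

noncomputable instance : Module (MvPolynomial σ Q) (DiagMod A σ Q M) :=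
  inferInstanceAs (Module (MvPolynomial σ Q)
    (MvPolynomial σ Q ⊗[MvPolynomial σ (MvPolynomial σ A)] TwMod A σ M))

/-- The canonical map from `TwMod` to its base change. -/
noncomputable def DiagMod.mk : TwMod A σ M →+ DiagMod A σ Q M where
  toFun m := (1 : MvPolynomial σ Q) ⊗ₜ[MvPolynomial σ (MvPolynomial σ A)] m
  map_zero' := TensorProduct.tmul_zero _ _
  map_add' := TensorProduct.tmul_add _

variable {A σ Q M}

lemma DiagMod.mk_smul (r : MvPolynomial σ (MvPolynomial σ A)) (x : TwMod A σ M) :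
    DiagMod.mk A σ Q M (r • x) =
      MvPolynomial.map (algebraMap (MvPolynomial σ A) Q) r • DiagMod.mk A σ Q M x := by
  change (1 : MvPolynomial σ Q) ⊗ₜ[MvPolynomial σ (MvPolynomial σ A)] (r • x) =
    algebraMap (MvPolynomial σ (MvPolynomial σ A)) (MvPolynomial σ Q) r •
      ((1 : MvPolynomial σ Q) ⊗ₜ[MvPolynomial σ (MvPolynomial σ A)] x)
  rw [← TensorProduct.smul_tmul, TensorProduct.smul_tmul', Algebra.smul_def, smul_eq_mul]

lemma DiagMod.induction {p : DiagMod A σ Q M → Prop} (hadd : ∀ x y, p x → p y → p (x + y))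
    (hmk : ∀ m, p (DiagMod.mk A σ Q M m))
    (hsmul : ∀ (r : MvPolynomial σ Q) x, p x → p (r • x)) (x : DiagMod A σ Q M) : p x := by
  have h0 : p 0 := by simpa using hmk 0
  refine TensorProduct.induction_on
    (motive := fun z : MvPolynomial σ Q ⊗[MvPolynomial σ (MvPolynomial σ A)] TwMod A σ M => p z)
    x h0 (fun q m => ?_) hadd
  have := hsmul q _ (hmk m)
  change p (q • ((1 : MvPolynomial σ Q) ⊗ₜ[MvPolynomial σ (MvPolynomial σ A)] m)) at this
  rwa [TensorProduct.smul_tmul', smul_eq_mul, mul_one] at this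

/-- Additive maps out of `DiagMod`. -/
lemma DiagMod.exists_lift {B : Type u} [AddCommGroup B] [Module (MvPolynomial σ Q) B]
    (f : TwMod A σ M →+ B)
    (hf : ∀ (r : MvPolynomial σ (MvPolynomial σ A)) x,
      f (r • x) = MvPolynomial.map (algebraMap (MvPolynomial σ A) Q) r • f x) :
    ∃ g : DiagMod A σ Q M →ₗ[MvPolynomial σ Q] B, ∀ x, g (DiagMod.mk A σ Q M x) = f x := by
  let _ : Module (MvPolynomial σ (MvPolynomial σ A)) B :=
    Module.compHom B (algebraMap (MvPolynomial σ (MvPolynomial σ A)) (MvPolynomial σ Q))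
  have _ : IsScalarTower (MvPolynomial σ (MvPolynomial σ A)) (MvPolynomial σ Q) B :=
    ⟨fun a b c => by rw [Algebra.smul_def, mul_smul]; rfl⟩
  let f' : TwMod A σ M →ₗ[MvPolynomial σ (MvPolynomial σ A)] B :=
    { toFun := f, map_add' := f.map_add, map_smul' := hf }
  refine ⟨TensorProduct.AlgebraTensorModule.lift
    ((LinearMap.toSpanSingleton (MvPolynomial σ Q)
      (TwMod A σ M →ₗ[MvPolynomial σ (MvPolynomial σ A)] B) f')), fun x => ?_⟩
  refine (TensorProduct.AlgebraTensorModule.lift_tmul _ _ _).trans ?_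
  rw [LinearMap.toSpanSingleton_apply, one_smul]
  rfl

lemma DiagMod.isWeaklyRegular [Module.Flat (MvPolynomial σ A) Q] (l : List σ) (hl : l.Nodup) :
    RingTheory.Sequence.IsWeaklyRegular (DiagMod A σ Q M)
      (l.map (MvPolynomial.X (R := Q))) := by
  have := flat_mvPolynomial σ (MvPolynomial σ A) Q
  have := (TwMod.isWeaklyRegular (A := A) (M := M) l hl).of_flat_of_isBaseChange
    (S := MvPolynomial σ Q) (TensorProduct.isBaseChange (MvPolynomial σ (MvPolynomial σ A))
      (TwMod A σ M) (MvPolynomial σ Q))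
  rw [List.map_map] at this
  have hX : algebraMap (MvPolynomial σ (MvPolynomial σ A)) (MvPolynomial σ Q) ∘
      MvPolynomial.X = MvPolynomial.X := funext fun j => MvPolynomial.map_X _ j
  rwa [hX] at this

end

end Diagonal


section KosExt

variable {A : Type u} [CommRing A] {σ : Type u} {Q : Type u} [CommRing Q]
  [Algebra (MvPolynomial σ A) Q] {M : Type u} [AddCommGroup M] [Module (MvPolynomial σ A) M]

/-- The constant elements of the base change of `TwMod`. -/
noncomputable def DiagMod.const : M →+ DiagMod A σ Q M :=
  (DiagMod.mk A σ Q M).comp (TwMod.mk A σ M)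

lemma DiagMod.C_smul_const (a : A) (m : M) :
    (MvPolynomial.C (algebraMap (MvPolynomial σ A) Q (MvPolynomial.C a)) : MvPolynomial σ Q) •
      DiagMod.const (A := A) (σ := σ) (Q := Q) m =
      DiagMod.const ((MvPolynomial.C a : MvPolynomial σ A) • m) := by
  rw [← MvPolynomial.map_C]
  simp only [DiagMod.const, AddMonoidHom.comp_apply]
  rw [← DiagMod.mk_smul, TwMod.C_C_smul_mk]

lemma DiagMod.C_X_smul_const (j : σ) (m : M) :
    (MvPolynomial.C (algebraMap (MvPolynomial σ A) Q (MvPolynomial.X j)) : MvPolynomial σ Q) •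
      DiagMod.const (A := A) (σ := σ) (Q := Q) m =
      DiagMod.const ((MvPolynomial.X j : MvPolynomial σ A) • m) +
        (MvPolynomial.X j : MvPolynomial σ Q) • DiagMod.const m := by
  rw [← MvPolynomial.map_C]
  simp only [DiagMod.const, AddMonoidHom.comp_apply]
  rw [← DiagMod.mk_smul, TwMod.C_X_smul_mk, map_add, DiagMod.mk_smul, MvPolynomial.map_X]

lemma DiagMod.induction_const {p : DiagMod A σ Q M → Prop} (hadd : ∀ x y, p x → p y → p (x + y))
    (hconst : ∀ m, p (DiagMod.const m))
    (hsmul : ∀ (r : MvPolynomial σ Q) x, p x → p (r • x)) (x : DiagMod A σ Q M) : p x := by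
  refine DiagMod.induction hadd (fun m => ?_) hsmul x
  refine TwMod.induction (p := fun m => p (DiagMod.mk A σ Q M m)) (fun x y hx hy => ?_) hconst
    (fun j x hx => ?_) m
  · rw [map_add]; exact hadd _ _ hx hy
  · rw [DiagMod.mk_smul]; exact hsmul _ _ hx

lemma DiagMod.finite [Module A M] [IsScalarTower A (MvPolynomial σ A) M] [Module.Finite A M] :
    Module.Finite Q ((res Q (MvPolynomial σ Q)).obj
      (ModuleCat.of (MvPolynomial σ Q) (DiagMod A σ Q M))) := by
  classical
  obtain ⟨T, hT⟩ := Module.Finite.fg_top (R := A) (M := M)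
  let X := (res Q (MvPolynomial σ Q)).obj (ModuleCat.of (MvPolynomial σ Q) (DiagMod A σ Q M))
  let c : M →+ X := DiagMod.const
  let B : Submodule Q X := Submodule.span Q (T.image c : Finset X)
  have hB : B.FG := ⟨_, rfl⟩
  suffices h : ∀ x : DiagMod A σ Q M, (show X from x) ∈ B by
    have : B = ⊤ := eq_top_iff.2 fun x _ => h x
    exact (⟨this ▸ hB⟩ : Module.Finite Q X)
  have hc (m : M) : c m ∈ B := by
    refine Submodule.span_induction (p := fun m _ => c m ∈ B) (fun m hm => ?_) ?_ ?_ ?_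
      (hT ▸ Submodule.mem_top : m ∈ Submodule.span A (T : Set M))
    · exact Submodule.subset_span (by simpa using ⟨m, hm, rfl⟩)
    · rw [map_zero]; exact B.zero_mem
    · intro x y _ _ hx hy
      rw [map_add]; exact B.add_mem hx hy
    · intro a x _ hx
      have := B.smul_mem (algebraMap (MvPolynomial σ A) Q (MvPolynomial.C a)) hx
      refine (congrArg (· ∈ B) ?_).mpr this
      rw [← algebraMap_smul (MvPolynomial σ A) a x]
      exact (DiagMod.C_smul_const a x).symm
  let Z (j : σ) : X →ₗ[Q] X := ((res Q (MvPolynomial σ Q)).map (ModuleCat.ofHom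
    (LinearMap.lsmul (MvPolynomial σ Q) (DiagMod A σ Q M) (MvPolynomial.X j)))).hom
  have hX (j : σ) : B ≤ B.comap (Z j) := by
    refine Submodule.span_le.2 fun x hx => ?_
    simp only [Finset.coe_image, Set.mem_image] at hx
    obtain ⟨m, -, rfl⟩ := hx
    have h1 := DiagMod.C_X_smul_const (A := A) (Q := Q) j m
    have h2 := B.sub_mem (B.smul_mem (algebraMap (MvPolynomial σ A) Q (MvPolynomial.X j)) (hc m))
      (hc ((MvPolynomial.X j : MvPolynomial σ A) • m))
    refine (congrArg (· ∈ B) ?_).mpr h2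
    exact eq_sub_of_add_eq' h1.symm
  refine fun x => DiagMod.induction_const (p := fun x => (show X from x) ∈ B)
    (fun x y hx hy => B.add_mem hx hy) hc (fun r x hx => ?_) x
  induction r using MvPolynomial.induction_on generalizing x with
  | C a => exact B.smul_mem a hx
  | add p q hp hq =>
    have := B.add_mem (hp x hx) (hq x hx)
    convert this using 1
    exact add_smul p q x
  | mul_X p j hp =>
    rw [mul_smul]
    exact hp _ (hX j hx)

omit [Algebra (MvPolynomial σ A) Q] in
lemma tcoeff_zero_smul {S : Type*} [CommRing S] {M : Type*} [AddCommGroup M] [Module S M]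
    (r : MvPolynomial σ S) (z : MvPolynomial σ S ⊗[S] M) :
    tcoeff 0 (r • z) = MvPolynomial.constantCoeff r • tcoeff 0 z := by
  induction z with
  | zero => simp
  | tmul p m =>
    rw [TensorProduct.smul_tmul', tcoeff_tmul, tcoeff_tmul, smul_smul, smul_eq_mul,
      ← MvPolynomial.constantCoeff_eq, map_mul]
  | add x y hx hy => rw [smul_add, map_add, hx, hy, map_add, smul_add]

lemma constantCoeff_twist (r : MvPolynomial σ (MvPolynomial σ A)) :
    MvPolynomial.constantCoeff (twist A σ r) = MvPolynomial.constantCoeff r := by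
  have h : (MvPolynomial.constantCoeff (R := MvPolynomial σ A)).comp (twist A σ) =
      MvPolynomial.constantCoeff := by
    ext <;> simp
  exact congrFun (congrArg DFunLike.coe h) r

lemma DiagMod.exists_retraction [Module Q M] [IsScalarTower (MvPolynomial σ A) Q M] :
    ∃ φ : DiagMod A σ Q M →+ M,
      (∀ m, φ (DiagMod.const m) = m) ∧
        ∀ (r : MvPolynomial σ Q) x, φ (r • x) = MvPolynomial.constantCoeff r • φ x := by
  let _ : Module (MvPolynomial σ Q) M := Module.compHom M MvPolynomial.constantCoeff
  let f : TwMod A σ M →+ M :=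
    (tcoeff 0 : MvPolynomial σ (MvPolynomial σ A) ⊗[MvPolynomial σ A] M →ₗ[_] M).toAddMonoidHom
  have hf (r : MvPolynomial σ (MvPolynomial σ A)) (x : TwMod A σ M) :
      f (r • x) = MvPolynomial.map (algebraMap (MvPolynomial σ A) Q) r • f x := by
    refine (tcoeff_zero_smul (twist A σ r) _).trans ?_
    rw [constantCoeff_twist, ← algebraMap_smul Q, ← MvPolynomial.constantCoeff_map]
    rfl
  obtain ⟨g, hg⟩ := DiagMod.exists_lift (Q := Q) f hf
  refine ⟨g.toAddMonoidHom, fun m => (hg _).trans ?_, fun r x => g.map_smul r x⟩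
  refine (tcoeff_tmul (S := MvPolynomial σ A) (0 : σ →₀ ℕ) 1 m).trans ?_
  simp

lemma DiagMod.C_smul_eq_zero {a : A} (ha : ∀ m : M, (MvPolynomial.C a : MvPolynomial σ A) • m = 0)
    (x : DiagMod A σ Q M) :
    (MvPolynomial.C (algebraMap (MvPolynomial σ A) Q (MvPolynomial.C a)) : MvPolynomial σ Q) •
      x = 0 := by
  refine DiagMod.induction_const (p := fun x => (MvPolynomial.C (algebraMap (MvPolynomial σ A) Q
    (MvPolynomial.C a)) : MvPolynomial σ Q) • x = 0) (fun x y hx hy => ?_) (fun m => ?_)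
    (fun r x hx => ?_) x
  · rw [smul_add, hx, hy, add_zero]
  · rw [C_smul_const, ha, map_zero]
  · rw [smul_comm, hx, smul_zero]

theorem kos_ext [Fintype σ] [IsNoetherianRing Q] [Module.Flat (MvPolynomial σ A) Q]
    [Module A M] [IsScalarTower A (MvPolynomial σ A) M] [Module.Finite A M]
    [Module Q M] [IsScalarTower (MvPolynomial σ A) Q M]
    (hM : IsBaseChange Q (LinearMap.id : M →ₗ[MvPolynomial σ A] M))
    (N : ModuleCat.{u} Q) [Module.Finite Q N] (a : A) (haM : ∀ m : M, a • m = 0)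
    (haN : IsSMulRegular N (algebraMap (MvPolynomial σ A) Q (MvPolynomial.C a))) :
    Kos (Fintype.card σ) (fun l => ModuleCat.of (MvPolynomial σ Q) (ExtP Q
      ((ModuleCat.restrictScalars (MvPolynomial.constantCoeff : MvPolynomial σ Q →+* Q)).obj
        (ModuleCat.of Q M)) N l)) := by
  let X := ModuleCat.of (MvPolynomial σ Q) (DiagMod A σ Q M)
  have hfin : Module.Finite Q ((res Q (MvPolynomial σ Q)).obj X) := DiagMod.finite
  let rs : List (MvPolynomial σ Q) := (Finset.univ : Finset σ).toList.map MvPolynomial.X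
  have hreg : RingTheory.Sequence.IsWeaklyRegular X rs :=
    DiagMod.isWeaklyRegular _ (Finset.nodup_toList _)
  have h0 : Kos 0 (fun l => ModuleCat.of (MvPolynomial σ Q) (ExtP Q X N l)) := by
    refine Kos.zero _ (fun l => inferInstanceAs (Module.Finite _ (ExtP Q X N l))) ?_
    change Subsingleton (Abelian.Ext ((res Q (MvPolynomial σ Q)).obj X) N 0)
    have hs : Subsingleton ((res Q (MvPolynomial σ Q)).obj X ⟶ N) := by
      refine ⟨fun f g => ?_⟩
      have key (f : (res Q (MvPolynomial σ Q)).obj X ⟶ N) : f = 0 := by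
        ext x
        refine haN ?_
        change _ • f.hom x = _ • (0 : N)
        rw [smul_zero, ← map_smul]
        refine (congrArg f.hom (DiagMod.C_smul_eq_zero (A := A) (a := a) (fun m => ?_) x)).trans
          (map_zero _)
        rw [← haM m, ← algebraMap_smul (MvPolynomial σ A) a m]
        rfl
      rw [key f, key g]
    exact Abelian.Ext.addEquiv₀.toEquiv.subsingleton
  have h1 := h0.extP_quotient N rs hreg
  have hlen : 0 + rs.length = Fintype.card σ := by simp [rs]
  rw [hlen] at h1
  refine h1.congr fun l => ExtP.congr N l (Nonempty.some ?_)
  obtain ⟨φ, hφ, hφs⟩ := DiagMod.exists_retraction (A := A) (σ := σ) (Q := Q) (M := M)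
  let D := Ideal.ofList rs • (⊤ : Submodule (MvPolynomial σ Q) (DiagMod A σ Q M))
  have hXD (j : σ) (x : DiagMod A σ Q M) : (MvPolynomial.X j : MvPolynomial σ Q) • x ∈ D :=
    Submodule.smul_mem_smul (Ideal.subset_span
      (List.mem_map_of_mem (Finset.mem_toList.2 (Finset.mem_univ j)))) trivial
  let _ : Module (MvPolynomial σ Q) M := Module.compHom M MvPolynomial.constantCoeff
  let φ' : DiagMod A σ Q M →ₗ[MvPolynomial σ Q] M :=
    { toFun := φ, map_add' := φ.map_add, map_smul' := hφs }
  have hD : D ≤ LinearMap.ker φ' := by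
    refine Submodule.smul_le.2 fun r hr x _ => ?_
    rw [LinearMap.mem_ker]
    refine (hφs r x).trans ?_
    have : MvPolynomial.constantCoeff r = 0 := by
      have hle : Ideal.ofList rs ≤ RingHom.ker (MvPolynomial.constantCoeff (R := Q) (σ := σ)) := by
        refine Ideal.span_le.2 fun x hx => ?_
        obtain ⟨j, -, rfl⟩ := List.mem_map.1 hx
        simp
      exact hle hr
    rw [this, zero_smul]
  let ψ : (DiagMod A σ Q M ⧸ D) →ₗ[MvPolynomial σ Q] M := D.liftQ φ' hD
  have hψ : Function.Bijective ψ := by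
    let _ : Module Q (DiagMod A σ Q M ⧸ D) :=
      Module.compHom _ (MvPolynomial.C : Q →+* MvPolynomial σ Q)
    let _ : Module (MvPolynomial σ A) (DiagMod A σ Q M ⧸ D) :=
      Module.compHom _ (algebraMap (MvPolynomial σ A) Q)
    have _ : IsScalarTower (MvPolynomial σ A) Q (DiagMod A σ Q M ⧸ D) :=
      IsScalarTower.of_algebraMap_smul fun _ _ => rfl
    let f : M →ₗ[MvPolynomial σ A] (DiagMod A σ Q M ⧸ D) :=
      { toFun := fun m => D.mkQ (DiagMod.const m)
        map_add' := fun x y => by rw [map_add, map_add]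
        map_smul' := fun s m => by
          change _ = (MvPolynomial.C (algebraMap (MvPolynomial σ A) Q s) : MvPolynomial σ Q) •
            D.mkQ (DiagMod.const m)
          rw [← map_smul]
          induction s using MvPolynomial.induction_on generalizing m with
          | C a => rw [DiagMod.C_smul_const]
          | add p q hp hq => rw [add_smul, map_add, map_add, hp, hq, map_add, map_add, add_smul,
              map_add]
          | mul_X p j hp =>
            rw [mul_smul, hp, map_mul, map_mul, mul_smul, DiagMod.C_X_smul_const, smul_add, map_add]
            refine left_eq_add.2 ?_
            rw [smul_comm]
            exact (Submodule.Quotient.mk_eq_zero D).2 (hXD _ _) }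
    have hgr (r : MvPolynomial σ Q) (y : DiagMod A σ Q M ⧸ D) :
        (MvPolynomial.C (MvPolynomial.constantCoeff r) : MvPolynomial σ Q) • y = r • y := by
      induction r using MvPolynomial.induction_on generalizing y with
      | C a => rw [MvPolynomial.constantCoeff_C]
      | add p q hp hq => rw [map_add, map_add, add_smul, hp, hq, add_smul]
      | mul_X p j hp =>
        obtain ⟨x, rfl⟩ := D.mkQ_surjective y
        rw [mul_smul, ← map_smul D.mkQ (MvPolynomial.X j),
          show D.mkQ ((MvPolynomial.X j : MvPolynomial σ Q) • x) = 0 from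
            (Submodule.Quotient.mk_eq_zero D).2 (hXD _ _)]
        simp
    have hinv (x : DiagMod A σ Q M) : hM.lift f (φ x) = D.mkQ x := by
      refine DiagMod.induction_const (p := fun x => hM.lift f (φ x) = D.mkQ x)
        (fun x y hx hy => ?_) (fun m => ?_) (fun r x hx => ?_) x
      · rw [map_add, map_add, hx, hy, map_add]
      · rw [hφ]
        exact hM.lift_eq f m
      · rw [hφs, map_smul, hx, map_smul]
        exact hgr r _
    refine ⟨fun x y hxy => ?_, fun m => ⟨D.mkQ (DiagMod.const m), hφ m⟩⟩
    obtain ⟨x, rfl⟩ := D.mkQ_surjective x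
    obtain ⟨y, rfl⟩ := D.mkQ_surjective y
    have : φ x = φ y := hxy
    rw [← hinv, ← hinv, this]
  exact ⟨(LinearEquiv.ofBijective ψ hψ).symm.toModuleIso⟩

end KosExt


section ChangeOfRings

open Abelian

variable {Q R : Type u} [CommRing Q] [CommRing R] [Algebra Q R]

/-- `Ext_R^l(M, N)` viewed as a module over a ring `Q` mapping to `R`. -/
def ExtR (Q : Type u) {R : Type u} [CommRing Q] [CommRing R] [Algebra Q R]
    (M N : ModuleCat.{u} R) (l : ℕ) : Type u :=
  Ext M N l

variable (M N : ModuleCat.{u} R) (l : ℕ)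

noncomputable instance : AddCommGroup (ExtR Q M N l) :=
  inferInstanceAs (AddCommGroup (Ext M N l))

noncomputable instance : Module Q (ExtR Q M N l) :=
  Module.compHom (Ext M N l) (algebraMap Q R)

variable {M}

/-- Functoriality of `ExtR` in the first variable. -/
noncomputable def ExtR.map {M' : ModuleCat.{u} R} (f : M ⟶ M') :
    ExtR Q M' N l →ₗ[Q] ExtR Q M N l where
  toFun e := (Ext.mk₀ f).comp e (zero_add l)
  map_add' _ _ := Ext.comp_add _ _ _ _
  map_smul' _ _ := Ext.comp_smul (R := R) _ _ _ _

/-- The connecting map of `ExtR` in the first variable. -/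
noncomputable def ExtR.connect {C : ShortComplex (ModuleCat.{u} R)} (hC : C.ShortExact) :
    ExtR Q C.X₁ N l →ₗ[Q] ExtR Q C.X₃ N (l + 1) where
  toFun e := hC.extClass.comp e (add_comm 1 l)
  map_add' _ _ := Ext.comp_add _ _ _ _
  map_smul' _ _ := Ext.comp_smul (R := R) _ _ _ _

lemma ExtR.exact_map_connect {C : ShortComplex (ModuleCat.{u} R)} (hC : C.ShortExact) :
    Function.Exact (ExtR.map (Q := Q) N l C.f) (ExtR.connect N l hC) := by
  intro x
  constructor
  · intro hx
    exact Ext.contravariant_sequence_exact₁ hC N x (add_comm 1 l) hx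
  · rintro ⟨y, rfl⟩
    exact ShortComplex.ShortExact.extClass_comp_assoc hC y (h := add_comm 1 l)

lemma ExtR.exact_connect_map {C : ShortComplex (ModuleCat.{u} R)} (hC : C.ShortExact) :
    Function.Exact (ExtR.connect (Q := Q) N l hC) (ExtR.map N (l + 1) C.g) := by
  intro x
  constructor
  · intro hx
    exact Ext.contravariant_sequence_exact₃ hC N x hx (add_comm 1 l)
  · rintro ⟨y, rfl⟩
    exact ShortComplex.ShortExact.comp_extClass_assoc hC y (add_comm 1 l)

lemma ExtR.map_comp {M' M'' : ModuleCat.{u} R} (f : M ⟶ M') (g : M' ⟶ M'')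
    (e : ExtR Q M'' N l) : ExtR.map N l f (ExtR.map N l g e) = ExtR.map N l (f ≫ g) e :=
  Ext.mk₀_comp_mk₀_assoc _ _ _

lemma ExtR.map_zero (M' : ModuleCat.{u} R) (e : ExtR Q M' N l) :
    ExtR.map N l (0 : M ⟶ M') e = 0 := by
  have key (e : Ext M' N l) : (Ext.mk₀ (0 : M ⟶ M')).comp e (zero_add l) = 0 := by
    rw [Ext.mk₀_zero, Ext.zero_comp]
  exact key e

lemma ExtR.exact_map_map {C : ShortComplex (ModuleCat.{u} R)} (hC : C.ShortExact) :
    Function.Exact (ExtR.map (Q := Q) N l C.g) (ExtR.map N l C.f) := by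
  intro x
  constructor
  · intro hx
    exact Ext.contravariant_sequence_exact₂ hC N x hx
  · rintro ⟨y, rfl⟩
    rw [ExtR.map_comp, C.zero, ExtR.map_zero]

lemma ExtR.map_zero_injective {M' : ModuleCat.{u} R} (f : M ⟶ M') [Epi f] :
    Function.Injective (ExtR.map (Q := Q) N 0 f) :=
  Ext.precomp_mk₀_injective_of_epi N f

instance [Projective M] : Subsingleton (ExtR Q M N (l + 1)) :=
  Ext.subsingleton_of_projective M N l

lemma ExtR.connect_surjective {C : ShortComplex (ModuleCat.{u} R)} (hC : C.ShortExact)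
    [Projective C.X₂] : Function.Surjective (ExtR.connect (Q := Q) N l hC) := fun x =>
  (ExtR.exact_connect_map N l hC x).1 (Subsingleton.elim _ _)

lemma ExtR.connect_injective {C : ShortComplex (ModuleCat.{u} R)} (hC : C.ShortExact)
    [Projective C.X₂] : Function.Injective (ExtR.connect (Q := Q) N (l + 1) hC) := by
  rw [injective_iff_map_eq_zero]
  intro x hx
  obtain ⟨y, rfl⟩ := (ExtR.exact_map_connect N (l + 1) hC x).1 hx
  rw [Subsingleton.elim y 0, _root_.map_zero]

/-- The connecting maps are natural. -/
lemma ExtR.connect_naturality {C C' : ShortComplex (ModuleCat.{u} R)} (hC : C.ShortExact)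
    (hC' : C'.ShortExact) (φ : C ⟶ C') (e : ExtR Q C'.X₁ N l) :
    ExtR.connect N l hC (ExtR.map N l φ.τ₁ e) =
      ExtR.map N (l + 1) φ.τ₃ (ExtR.connect N l hC' e) := by
  have key (e : Ext C'.X₁ N l) :
      hC.extClass.comp ((Ext.mk₀ φ.τ₁).comp e (zero_add l)) (add_comm 1 l) =
        (Ext.mk₀ φ.τ₃).comp (hC'.extClass.comp e (add_comm 1 l)) (zero_add (l + 1)) := by
    rw [← Ext.comp_assoc _ _ _ (add_zero 1) (zero_add l) (by omega),
      ← Ext.comp_assoc _ _ _ (zero_add 1) (add_comm 1 l) (by omega),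
      ShortComplex.ShortExact.extClass_naturality]
  exact key e

/-- The map on `Ext` induced by restriction of scalars. -/
noncomputable def ExtR.restrict (M N : ModuleCat.{u} R) (l : ℕ) :
    ExtR Q M N l →ₗ[Q] ExtR Q ((res Q R).obj M) ((res Q R).obj N) l where
  toFun e := Ext.mapExactFunctor (res Q R) e
  map_add' x y := Ext.mapExactFunctor_add _ _ _ _ x y
  map_smul' q e := by
    have key (e : Ext M N l) : (algebraMap Q R q • e).mapExactFunctor (res Q R) =
        q • e.mapExactFunctor (res Q R) := by
      rw [Ext.smul_eq_comp_mk₀, Ext.smul_eq_comp_mk₀, Ext.mapExactFunctor_comp,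
        Ext.mapExactFunctor_mk₀]
      rfl
    exact key e

lemma ExtR.restrict_map {M' : ModuleCat.{u} R} (f : M ⟶ M') (e : ExtR Q M' N l) :
    ExtR.restrict M N l (ExtR.map N l f e) =
      ExtR.map _ l ((res Q R).map f) (ExtR.restrict M' N l e) := by
  refine (Ext.mapExactFunctor_comp (res Q R) (Ext.mk₀ f) e (zero_add l)).trans ?_
  rw [Ext.mapExactFunctor_mk₀]
  rfl

lemma ExtR.restrict_connect {C : ShortComplex (ModuleCat.{u} R)} (hC : C.ShortExact)
    (e : ExtR Q C.X₁ N l) :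
    ExtR.restrict C.X₃ N (l + 1) (ExtR.connect N l hC e) =
      ExtR.connect _ l (hC.map_of_exact (res Q R)) (ExtR.restrict C.X₁ N l e) := by
  refine (Ext.mapExactFunctor_comp (res Q R) hC.extClass e (add_comm 1 l)).trans ?_
  rw [Ext.mapExactFunctor_extClass]
  rfl

end ChangeOfRings

section BaseChange

open Abelian

variable {Q R : Type u} [CommRing Q] [CommRing R] [Algebra Q R] (N : ModuleCat.{u} R) (l : ℕ)

/-- The base change of a module to `R`. -/
noncomputable abbrev bc (R : Type u) [CommRing R] [Algebra Q R] (X : ModuleCat.{u} Q) :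
    ModuleCat.{u} R := ModuleCat.of R (R ⊗[Q] X)

/-- The base change of a morphism to `R`. -/
noncomputable abbrev bcMap {X Y : ModuleCat.{u} Q} (f : X ⟶ Y) : bc R X ⟶ bc R Y :=
  ModuleCat.ofHom (f.hom.baseChange R)

/-- The unit of base change. -/
noncomputable def bcUnit (R : Type u) [CommRing R] [Algebra Q R] (X : ModuleCat.{u} Q) :
    X ⟶ (res Q R).obj (bc R X) :=
  ModuleCat.ofHom (Y := (res Q R).obj (bc R X))
    { toFun := fun x => (1 : R) ⊗ₜ[Q] x
      map_add' := fun x y => TensorProduct.tmul_add _ _ _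
      map_smul' := fun q x => (TensorProduct.smul_tmul q (1 : R) x).symm.trans (by
        rw [Algebra.smul_def, mul_one]
        change _ = algebraMap Q R q • ((1 : R) ⊗ₜ[Q] x)
        rw [TensorProduct.smul_tmul', smul_eq_mul, mul_one]) }

lemma bcUnit_naturality {X Y : ModuleCat.{u} Q} (f : X ⟶ Y) :
    f ≫ bcUnit R Y = bcUnit R X ≫ (res Q R).map (bcMap f) := by
  ext x
  exact (LinearMap.baseChange_tmul f.hom (1 : R) x).symm

/-- The comparison map `Ext_R^l(R ⊗ X, N) → Ext_Q^l(X, N)`. -/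
noncomputable def bcExt (X : ModuleCat.{u} Q) :
    ExtR Q (bc R X) N l →ₗ[Q] ExtR Q X ((res Q R).obj N) l :=
  ExtR.map _ l (bcUnit R X) ∘ₗ ExtR.restrict (bc R X) N l

lemma bcExt_map {X Y : ModuleCat.{u} Q} (f : X ⟶ Y) (e : ExtR Q (bc R Y) N l) :
    bcExt N l X (ExtR.map N l (bcMap f) e) = ExtR.map _ l f (bcExt N l Y e) := by
  simp only [bcExt, LinearMap.comp_apply]
  rw [ExtR.restrict_map, ExtR.map_comp, ExtR.map_comp, bcUnit_naturality]

/-- The base change of a short complex. -/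
noncomputable abbrev bcComplex (R : Type u) [CommRing R] [Algebra Q R]
    (C : ShortComplex (ModuleCat.{u} Q)) : ShortComplex (ModuleCat.{u} R) where
  f := bcMap (R := R) C.f
  g := bcMap C.g
  zero := by
    rw [bcMap, bcMap, ← ModuleCat.ofHom_comp, ← LinearMap.baseChange_comp, ← ModuleCat.hom_comp,
      C.zero]
    simp

lemma bcExt_connect {C : ShortComplex (ModuleCat.{u} Q)} (hC : C.ShortExact)
    (hC' : (bcComplex R C).ShortExact) (e : ExtR Q (bc R C.X₁) N l) :
    bcExt N (l + 1) C.X₃ (ExtR.connect N l hC' e) =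
      ExtR.connect _ l hC (bcExt N l C.X₁ e) := by
  let φ : C ⟶ (bcComplex R C).map (res Q R) :=
    { τ₁ := bcUnit R C.X₁
      τ₂ := bcUnit R C.X₂
      τ₃ := bcUnit R C.X₃
      comm₁₂ := (bcUnit_naturality C.f).symm
      comm₂₃ := (bcUnit_naturality C.g).symm }
  have h1 := ExtR.restrict_connect (Q := Q) N l hC' e
  have h2 := ExtR.connect_naturality (Q := Q) _ l hC (hC'.map_of_exact (res Q R)) φ
    (ExtR.restrict _ N l e)
  simp only [bcExt, LinearMap.comp_apply]
  exact (congrArg _ h1).trans h2.symm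

lemma bcExt_zero_bijective (X : ModuleCat.{u} Q) : Function.Bijective (bcExt N 0 X) := by
  have key (f : bc R X ⟶ N) : bcExt N 0 X (Ext.mk₀ f) = Ext.mk₀ (bcUnit R X ≫ (res Q R).map f) := by
    change (Ext.mk₀ (bcUnit R X)).comp (Ext.mapExactFunctor (res Q R) (Ext.mk₀ f)) (zero_add 0) = _
    rw [Ext.mapExactFunctor_mk₀, Ext.mk₀_comp_mk₀]
  constructor
  · intro x y h
    obtain ⟨f, rfl⟩ := (Ext.mk₀_bijective _ _).2 x
    obtain ⟨g, rfl⟩ := (Ext.mk₀_bijective _ _).2 y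
    rw [key, key] at h
    have h := (Ext.mk₀_bijective _ _).1 h
    congr 1
    have h' (x : X) : f.hom (1 ⊗ₜ x) = g.hom (1 ⊗ₜ x) := congr($h x)
    ext z
    induction z using TensorProduct.induction_on with
    | zero => rw [_root_.map_zero, _root_.map_zero]
    | add a b ha hb => rw [map_add, map_add, ha, hb]
    | tmul r x =>
      have : (r ⊗ₜ[Q] x : R ⊗[Q] X) = r • ((1 : R) ⊗ₜ[Q] x) := by
        rw [TensorProduct.smul_tmul', smul_eq_mul, mul_one]
      rw [this, map_smul, map_smul]
      exact congr(r • $(h' x))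
  · intro x
    obtain ⟨g, rfl⟩ := (Ext.mk₀_bijective _ _).2 x
    let _ : Module Q N := Module.compHom N (algebraMap Q R)
    have _ : IsScalarTower Q R N := ⟨fun q r n => by
      rw [Algebra.smul_def, mul_smul]; rfl⟩
    let g' : X →ₗ[Q] N := { toFun := fun x => g.hom x, map_add' := map_add g.hom, map_smul' := map_smul g.hom }
    refine ⟨Ext.mk₀ (ModuleCat.ofHom (LinearMap.liftBaseChange R g')), ?_⟩
    rw [key]
    congr 1
    ext x
    change LinearMap.liftBaseChange R g' (1 ⊗ₜ x) = _
    rw [LinearMap.liftBaseChange_tmul, one_smul]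
    rfl

end BaseChange


section Hypersurface

variable {Q R : Type u} [CommRing Q] [CommRing R] [Algebra Q R]

/-- `R` is the quotient of `Q` by a nonzerodivisor `f`. -/
structure IsHyperQuotient (Q R : Type u) [CommRing Q] [CommRing R] [Algebra Q R] (f : Q) : Prop where
  surjective : Function.Surjective (algebraMap Q R)
  ker : RingHom.ker (algebraMap Q R) = Ideal.span {f}
  regular : IsSMulRegular Q f

variable {f : Q} (H : IsHyperQuotient Q R f)

include H

lemma IsHyperQuotient.algebraMap_eq_zero : algebraMap Q R f = 0 := by
  rw [← RingHom.mem_ker, H.ker]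
  exact Ideal.mem_span_singleton_self f

lemma IsHyperQuotient.exists_tmul {X : Type u} [AddCommGroup X] [Module Q X] (z : R ⊗[Q] X) :
    ∃ x, z = 1 ⊗ₜ x := by
  induction z using TensorProduct.induction_on with
  | zero => exact ⟨0, (TensorProduct.tmul_zero _ _).symm⟩
  | add a b ha hb =>
    obtain ⟨x, rfl⟩ := ha
    obtain ⟨y, rfl⟩ := hb
    exact ⟨x + y, (TensorProduct.tmul_add _ _ _).symm⟩
  | tmul r x =>
    obtain ⟨q, rfl⟩ := H.surjective r
    exact ⟨q • x, by rw [← TensorProduct.smul_tmul, Algebra.smul_def, mul_one]⟩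

lemma IsHyperQuotient.tmul_eq_zero {X : Type u} [AddCommGroup X] [Module Q X] {x : X}
    (hx : (1 : R) ⊗ₜ[Q] x = 0) : ∃ y, x = f • y := by
  have hk : Ideal.span {f} = LinearMap.ker (Algebra.linearMap Q R) := by
    rw [← H.ker]
    rfl
  let e : (Q ⧸ Ideal.span {f}) ≃ₗ[Q] R := (Submodule.quotEquivOfEq _ _ hk).trans
    ((Algebra.linearMap Q R).quotKerEquivOfSurjective H.surjective)
  have he : e 1 = 1 := map_one (algebraMap Q R)
  have h1 : TensorProduct.mk Q (Q ⧸ Ideal.span {f}) X 1 x = 0 := by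
    apply (TensorProduct.congr e (LinearEquiv.refl Q X)).injective
    rw [map_zero, ← hx, TensorProduct.mk_apply, TensorProduct.congr_tmul, he]
    rfl
  rw [← LinearMap.mem_ker, LinearMap.ker_tensorProductMk, Submodule.ideal_span_singleton_smul,
    Submodule.mem_smul_pointwise_iff_exists] at h1
  obtain ⟨y, -, rfl⟩ := h1
  exact ⟨y, rfl⟩

lemma IsHyperQuotient.smul_tmul {X : Type u} [AddCommGroup X] [Module Q X] (x : X) :
    (1 : R) ⊗ₜ[Q] (f • x) = 0 := by
  rw [← TensorProduct.smul_tmul, Algebra.smul_def, H.algebraMap_eq_zero, zero_mul,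
    TensorProduct.zero_tmul]

lemma IsHyperQuotient.bcComplex_shortExact {C : ShortComplex (ModuleCat.{u} Q)}
    (hC : C.ShortExact) (hf : IsSMulRegular C.X₃ f) : (bcComplex R C).ShortExact := by
  have hex := (ShortComplex.ShortExact.moduleCat_exact_iff_function_exact C).1 hC.exact
  have hsurj : Function.Surjective C.g.hom := hC.moduleCat_surjective_g
  refine ModuleCat.shortComplex_shortExact _ ?_ ?_ ?_
  · have h := lTensor_exact R (f := C.f.hom) (g := C.g.hom) hex hsurj
    exact h
  · change Function.Injective (C.f.hom.baseChange R)
    rw [injective_iff_map_eq_zero]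
    intro z hz
    obtain ⟨x, rfl⟩ := H.exists_tmul z
    rw [LinearMap.baseChange_tmul] at hz
    obtain ⟨y, hy⟩ := H.tmul_eq_zero hz
    have h1 : f • C.g.hom y = f • 0 := by
      rw [← map_smul, ← hy, smul_zero]
      exact (hex _).2 ⟨x, rfl⟩
    obtain ⟨w, hw⟩ := (hex y).1 (hf h1)
    have hx : x = f • w := by
      apply hC.moduleCat_injective_f
      rw [map_smul]
      exact hy.trans congr(f • $(hw.symm))
    rw [hx, H.smul_tmul]
  · exact LinearMap.lTensor_surjective R hsurj

lemma IsHyperQuotient.regular_projective (X : ModuleCat.{u} Q) :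
    IsSMulRegular X.projectiveShortComplex.X₂ f := by
    intro a b hab
    apply Finsupp.ext
    intro i
    apply (Shrink.linearEquiv Q Q).injective
    apply H.regular
    have h := congr(Shrink.linearEquiv Q Q ((show X →₀ Shrink Q from $hab) i))
    exact ((map_smul (Shrink.linearEquiv Q Q) f _).symm.trans h).trans
      (map_smul (Shrink.linearEquiv Q Q) f _)

lemma IsHyperQuotient.bcExt_bijective (N : ModuleCat.{u} R) (l : ℕ) (X : ModuleCat.{u} Q)
    (hX : IsSMulRegular X f) : Function.Bijective (bcExt N l X) := by
  induction l generalizing X with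
  | zero => exact bcExt_zero_bijective N X
  | succ l ih =>
    have hC := X.shortExact_projectiveShortComplex
    have hC' := H.bcComplex_shortExact hC hX
    have hG := H.regular_projective X
    have hX' : IsSMulRegular X.projectiveShortComplex.X₁ f := by
      intro a b hab
      exact Subtype.ext (hG congr(Subtype.val $hab))
    have hb := ih _ hX'
    have : Projective X.projectiveShortComplex.X₂ :=
      (IsProjective.iff_projective _).1 inferInstance
    have : Projective (bcComplex R X.projectiveShortComplex).X₂ :=
      (IsProjective.iff_projective (R ⊗[Q] X.projectiveShortComplex.X₂)).1 inferInstance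
    constructor
    · rw [injective_iff_map_eq_zero]
      intro x hx
      obtain ⟨k, rfl⟩ := ExtR.connect_surjective (Q := Q) N l hC' x
      rw [bcExt_connect N l hC hC'] at hx
      obtain ⟨h, hh⟩ := (ExtR.exact_map_connect _ l hC _).1 hx
      obtain ⟨h', rfl⟩ := (ih _ hG).2 h
      rw [← bcExt_map] at hh
      rw [← hb.1 hh]
      exact (ExtR.exact_map_connect N l hC' _).2 ⟨h', rfl⟩
    · intro x
      obtain ⟨y, rfl⟩ := ExtR.connect_surjective _ l hC x
      obtain ⟨z, rfl⟩ := hb.2 y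
      exact ⟨_, bcExt_connect N l hC hC' z⟩

end Hypersurface


lemma exists_linearMap_comp_eq {A M₁ M₂ M₃ : Type*} [Ring A] [AddCommGroup M₁] [AddCommGroup M₂]
    [AddCommGroup M₃] [Module A M₁] [Module A M₂] [Module A M₃] (g : M₁ →ₗ[A] M₂)
    (hg : Function.Surjective g) (h : M₁ →ₗ[A] M₃) (hgh : ∀ x, g x = 0 → h x = 0) :
    ∃ b : M₂ →ₗ[A] M₃, ∀ x, b (g x) = h x := by
  refine ⟨(LinearMap.ker g).liftQ h (fun x hx => hgh x hx) ∘ₗ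
    (g.quotKerEquivOfSurjective hg).symm.toLinearMap, fun x => ?_⟩
  have : (g.quotKerEquivOfSurjective hg).symm (g x) = Submodule.Quotient.mk x := by
    rw [LinearEquiv.symm_apply_eq]
    rfl
  rw [LinearMap.comp_apply, LinearEquiv.coe_coe, this]
  exact (LinearMap.ker g).liftQ_apply h x

section Period

variable {Q R : Type u} [CommRing Q] [CommRing R] [Algebra Q R] {f : Q}
  (H : IsHyperQuotient Q R f) {F M : Type u} [AddCommGroup F] [Module Q F] [AddCommGroup M]
  [Module R M] [Module Q M] [IsScalarTower Q R M] (p : F →ₗ[Q] M)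

include H

lemma IsHyperQuotient.ker_liftBaseChange (z : R ⊗[Q] LinearMap.ker p) :
    (LinearMap.ker p).subtype.baseChange R z ∈ LinearMap.ker (p.liftBaseChange R) := by
  obtain ⟨x, rfl⟩ := H.exists_tmul z
  rw [LinearMap.baseChange_tmul, LinearMap.mem_ker, LinearMap.liftBaseChange_tmul, one_smul]
  exact x.2

/-- The natural map from the base change of the first syzygy to the syzygy of the base change. -/
noncomputable def syzMap : R ⊗[Q] LinearMap.ker p →ₗ[R] LinearMap.ker (p.liftBaseChange R) :=
  LinearMap.codRestrict _ ((LinearMap.ker p).subtype.baseChange R) (H.ker_liftBaseChange p)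

lemma syzMap_tmul (x : LinearMap.ker p) : (syzMap H p (1 ⊗ₜ x)).1 = 1 ⊗ₜ[Q] x.1 := by
  rw [syzMap, LinearMap.codRestrict_apply, LinearMap.baseChange_tmul]
  rfl

lemma IsHyperQuotient.smul_eq_zero (m : M) : f • m = 0 := by
  rw [← algebraMap_smul R, H.algebraMap_eq_zero, zero_smul]

/-- Multiplication by `f` from the free cover to the syzygy. -/
noncomputable def mulf : F →ₗ[Q] LinearMap.ker p :=
  LinearMap.codRestrict _ (f • LinearMap.id) (fun x => by
    rw [LinearMap.mem_ker, LinearMap.smul_apply, map_smul]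
    exact H.smul_eq_zero _)

lemma tmul_mulf_eq_zero {x : F} (hx : p x = 0) : (1 : R) ⊗ₜ[Q] mulf H p x = 0 := by
  have : mulf H p x = f • (⟨x, hx⟩ : LinearMap.ker p) := rfl
  rw [this, H.smul_tmul]

lemma tmul_mulf_eq {x y : F} (hx : p x = p y) :
    (1 : R) ⊗ₜ[Q] mulf H p x = 1 ⊗ₜ[Q] mulf H p y := by
  rw [← sub_eq_zero, ← TensorProduct.tmul_sub, ← map_sub]
  exact tmul_mulf_eq_zero H p (by rw [map_sub, hx, sub_self])

variable (hp : Function.Surjective p)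

/-- The map from `M` to the base change of the first syzygy. -/
noncomputable def periodMap : M →ₗ[R] R ⊗[Q] LinearMap.ker p where
  toFun m := 1 ⊗ₜ mulf H p (Function.surjInv hp m)
  map_add' a b := by
    rw [← TensorProduct.tmul_add, ← map_add]
    apply tmul_mulf_eq
    simp only [map_add, Function.surjInv_eq]
  map_smul' r a := by
    obtain ⟨q, rfl⟩ := H.surjective r
    rw [RingHom.id_apply, TensorProduct.smul_tmul', smul_eq_mul, mul_one,
      ← mul_one (algebraMap Q R q), ← Algebra.smul_def, TensorProduct.smul_tmul, ← map_smul]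
    apply tmul_mulf_eq
    simp only [map_smul, Function.surjInv_eq, smul_assoc, one_smul]

lemma periodMap_apply (x : F) : periodMap H p hp (p x) = (1 : R) ⊗ₜ[Q] mulf H p x :=
  tmul_mulf_eq H p (Function.surjInv_eq hp _)

lemma baseChange_periodMap (m : M) :
    (LinearMap.ker p).subtype.baseChange R (periodMap H p hp m) = 0 := by
  obtain ⟨x, rfl⟩ := hp m
  rw [periodMap_apply, LinearMap.baseChange_tmul]
  exact H.smul_tmul x

lemma syzMap_periodMap (m : M) : syzMap H p (periodMap H p hp m) = 0 :=
  Subtype.ext (baseChange_periodMap H p hp m)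

lemma exact_periodMap_syzMap : Function.Exact (periodMap H p hp) (syzMap H p) := by
  intro z
  refine ⟨fun hz => ?_, fun ⟨x, hx⟩ => ?_⟩
  · obtain ⟨x, rfl⟩ := H.exists_tmul z
    have h1 : (1 : R) ⊗ₜ[Q] x.1 = 0 := by rw [← syzMap_tmul H p x, hz]; rfl
    obtain ⟨y, hy⟩ := H.tmul_eq_zero h1
    refine ⟨p y, ?_⟩
    rw [periodMap_apply]
    congr 1
    exact Subtype.ext hy.symm
  · rw [← hx, syzMap_periodMap]

lemma periodMap_injective (hf : IsSMulRegular F f) : Function.Injective (periodMap H p hp) := by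
  rw [injective_iff_map_eq_zero]
  intro m hm
  obtain ⟨x, rfl⟩ := hp m
  rw [periodMap_apply] at hm
  obtain ⟨y, hy⟩ := H.tmul_eq_zero hm
  have h2 : x = y.1 := hf congr(Subtype.val $hy)
  rw [h2]
  exact y.2

lemma syzMap_surjective : Function.Surjective (syzMap H p) := by
  intro k
  obtain ⟨z, hz⟩ := H.exists_tmul k.1
  have hk := LinearMap.mem_ker.1 k.2
  rw [hz, LinearMap.liftBaseChange_tmul, one_smul] at hk
  exact ⟨1 ⊗ₜ ⟨z, hk⟩, Subtype.ext ((syzMap_tmul H p _).trans hz.symm)⟩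

end Period


section ChangeOfRingsSequence

variable {Q R : Type u} [CommRing Q] [CommRing R] [Algebra Q R] {f : Q}

/-- The identity as a map to the restriction of scalars. -/
noncomputable def toRes (Q R M : Type u) [CommRing Q] [CommRing R] [Algebra Q R] [AddCommGroup M]
    [Module R M] [Module Q M] [IsScalarTower Q R M] :
    ModuleCat.of Q M ⟶ (res Q R).obj (ModuleCat.of R M) :=
  ModuleCat.ofHom (Y := (res Q R).obj (ModuleCat.of R M))
    { toFun := fun m => m
      map_add' := fun _ _ => rfl
      map_smul' := fun q m => (algebraMap_smul R q m).symm }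

/-- Restriction of `Ext` from `R` to `Q`. -/
noncomputable def extRes (Q : Type u) {R : Type u} [CommRing Q] [CommRing R] [Algebra Q R]
    (M : Type u) [AddCommGroup M] [Module R M] [Module Q M] [IsScalarTower Q R M]
    (N : ModuleCat.{u} R) (l : ℕ) :
    ExtR Q (ModuleCat.of R M) N l →ₗ[Q] ExtR Q (ModuleCat.of Q M) ((res Q R).obj N) l :=
  ExtR.map _ l (toRes Q R M) ∘ₗ ExtR.restrict (ModuleCat.of R M) N l

variable (H : IsHyperQuotient Q R f) {F M : Type u} [AddCommGroup F] [Module Q F]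
  [Module.Free Q F] [AddCommGroup M]
  [Module R M] [Module Q M] [IsScalarTower Q R M] (p : F →ₗ[Q] M) (hp : Function.Surjective p)
  (N : ModuleCat.{u} R)

include H in
lemma extRes_zero_bijective : Function.Bijective (extRes Q M N 0) := by
  have key (f : ModuleCat.of R M ⟶ N) : extRes Q M N 0 (Abelian.Ext.mk₀ f) =
      Abelian.Ext.mk₀ (toRes Q R M ≫ (res Q R).map f) := by
    change (Abelian.Ext.mk₀ (toRes Q R M)).comp
      (Abelian.Ext.mapExactFunctor (res Q R) (Abelian.Ext.mk₀ f)) (zero_add 0) = _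
    rw [Abelian.Ext.mapExactFunctor_mk₀, Abelian.Ext.mk₀_comp_mk₀]
  constructor
  · intro x y h
    obtain ⟨f, rfl⟩ := (Abelian.Ext.mk₀_bijective _ _).2 x
    obtain ⟨g, rfl⟩ := (Abelian.Ext.mk₀_bijective _ _).2 y
    rw [key, key] at h
    have h := (Abelian.Ext.mk₀_bijective _ _).1 h
    congr 1
    ext z
    exact congr($h z)
  · intro x
    obtain ⟨g, rfl⟩ := (Abelian.Ext.mk₀_bijective _ _).2 x
    refine ⟨Abelian.Ext.mk₀ (ModuleCat.ofHom (Y := N)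
      { toFun := fun m => g.hom m, map_add' := map_add g.hom, map_smul' := fun r m => ?_ }), ?_⟩
    · obtain ⟨q, rfl⟩ := H.surjective r
      rw [algebraMap_smul]
      exact map_smul g.hom q m
    · exact key _

/-- The base changed cover. -/
noncomputable abbrev bcCover (R : Type u) [CommRing R] [Algebra Q R] [Module R M]
    [IsScalarTower Q R M] : ShortComplex (ModuleCat.{u} R) :=
  (p.liftBaseChange R).shortComplexKer

/-- The periodicity sequence. -/
noncomputable abbrev period : ShortComplex (ModuleCat.{u} R) where
  X₁ := ModuleCat.of R M
  X₂ := bc R (ModuleCat.of Q (LinearMap.ker p))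
  X₃ := ModuleCat.of R (LinearMap.ker (p.liftBaseChange R))
  f := ModuleCat.ofHom (periodMap H p hp)
  g := ModuleCat.ofHom (syzMap H p)
  zero := by
    ext m
    exact Subtype.ext_iff.1 (syzMap_periodMap H p hp m)

omit [Module.Free Q F] in
include hp in
lemma liftBaseChange_surjective : Function.Surjective (p.liftBaseChange R) := fun m => by
  obtain ⟨x, rfl⟩ := hp m
  exact ⟨1 ⊗ₜ x, by rw [LinearMap.liftBaseChange_tmul, one_smul]⟩

omit [Module.Free Q F] in
lemma period_shortExact (hf : IsSMulRegular F f) : (period H p hp).ShortExact :=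
  ModuleCat.shortComplex_shortExact _ (exact_periodMap_syzMap H p hp)
    (periodMap_injective H p hp hf) (syzMap_surjective H p)

/-- The comparison of the covers over `Q` and over `R`. -/
noncomputable def coverHom : p.shortComplexKer ⟶ (bcCover p R).map (res Q R) where
  τ₁ := bcUnit R _ ≫ (res Q R).map (ModuleCat.ofHom (syzMap H p))
  τ₂ := bcUnit R _
  τ₃ := toRes Q R M
  comm₁₂ := by
    ext x
    exact syzMap_tmul H p x
  comm₂₃ := by
    ext x
    exact (LinearMap.liftBaseChange_tmul R p _ _).trans (one_smul _ _)

variable (l : ℕ)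

omit [Module.Free Q F] in
lemma extRes_connect (hS : p.shortComplexKer.ShortExact) (hS' : (bcCover p R).ShortExact)
    (w : ExtR Q (ModuleCat.of R (LinearMap.ker (p.liftBaseChange R))) N l) :
    extRes Q M N (l + 1) (ExtR.connect N l hS' w) =
      ExtR.connect _ l hS (bcExt N l _ (ExtR.map N l (ModuleCat.ofHom (syzMap H p)) w)) := by
  have h1 := ExtR.restrict_connect (Q := Q) N l hS' w
  have h2 := ExtR.connect_naturality (Q := Q) _ l hS (hS'.map_of_exact (res Q R))
    (coverHom H p) (ExtR.restrict _ N l w)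
  have h3 := ExtR.restrict_map (Q := Q) N l (ModuleCat.ofHom (syzMap H p)) w
  refine (congrArg _ h1).trans (h2.symm.trans (congrArg _ ?_))
  refine Eq.trans ?_ (congrArg (ExtR.map _ l (bcUnit R _)) h3.symm)
  exact (ExtR.map_comp (Q := Q) _ l _ _ _).symm

include H hp in
/-- The change of rings sequence. -/
theorem exists_changeOfRings_sequence (hf : IsSMulRegular F f) :
    ∃ (b : ∀ l, ExtR Q (ModuleCat.of Q M) ((res Q R).obj N) (l + 1) →ₗ[Q]
        ExtR Q (ModuleCat.of R M) N l)
      (c : ∀ l, ExtR Q (ModuleCat.of R M) N l →ₗ[Q] ExtR Q (ModuleCat.of R M) N (l + 2)),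
      Function.Injective (extRes Q M N 1) ∧
      (∀ l, Function.Exact (extRes Q M N (l + 1)) (b l)) ∧
      (∀ l, Function.Exact (b l) (c l)) ∧
      (∀ l, Function.Exact (c l) (extRes Q M N (l + 2))) := by
  have hS : p.shortComplexKer.ShortExact := LinearMap.shortExact_shortComplexKer hp
  have hS' : (bcCover p R).ShortExact :=
    LinearMap.shortExact_shortComplexKer (liftBaseChange_surjective p hp)
  have hP := period_shortExact H p hp hf
  have : Projective p.shortComplexKer.X₂ := (IsProjective.iff_projective F).1 inferInstance
  have : Projective (bcCover p R).X₂ :=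
    (IsProjective.iff_projective (R ⊗[Q] F)).1 inferInstance
  have hθL (l : ℕ) := H.bcExt_bijective N l (ModuleCat.of Q (LinearMap.ker p))
    (fun a b hab => Subtype.ext (hf congr(Subtype.val $hab)))
  have hθF (l : ℕ) := H.bcExt_bijective N l (ModuleCat.of Q F) hf
  let incl : ModuleCat.of Q (LinearMap.ker p) ⟶ ModuleCat.of Q F :=
    ModuleCat.ofHom (LinearMap.ker p).subtype
  let κ : bc R (ModuleCat.of Q (LinearMap.ker p)) ⟶
    ModuleCat.of R (LinearMap.ker (p.liftBaseChange R)) := ModuleCat.ofHom (syzMap H p)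
  have hlift (l : ℕ) (z : ExtR Q (bc R (ModuleCat.of Q (LinearMap.ker p))) N l)
      (hz : ExtR.connect ((res Q R).obj N) l hS (bcExt N l _ z) = 0) :
      ∃ h : ExtR Q (bc R (ModuleCat.of Q F)) N l, z = ExtR.map N l (bcMap incl) h := by
    obtain ⟨h, hh⟩ := (ExtR.exact_map_connect _ l hS _).1 hz
    obtain ⟨h', rfl⟩ := (hθF l).2 h
    refine ⟨h', (hθL l).1 ?_⟩
    rw [bcExt_map]
    exact hh.symm
  let g (l : ℕ) := ExtR.connect ((res Q R).obj N) l hS ∘ₗ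
    bcExt N l (ModuleCat.of Q (LinearMap.ker p))
  have hg (l : ℕ) : Function.Surjective (g l) :=
    (ExtR.connect_surjective _ l hS).comp (hθL l).2
  have hcond (l : ℕ) (z) (hz : g l z = 0) : ExtR.map N l (period H p hp).f z = 0 := by
    obtain ⟨h, rfl⟩ := hlift l z hz
    rw [ExtR.map_comp]
    have : (period H p hp).f ≫ bcMap incl = 0 := by
      ext m
      exact baseChange_periodMap H p hp m
    rw [this, ExtR.map_zero]
  choose b hb using fun l => exists_linearMap_comp_eq (g l) (hg l)
    (ExtR.map N l (period H p hp).f) (hcond l)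
  have hres (l : ℕ) (w) : extRes Q M N (l + 1) (ExtR.connect N l hS' w) =
      g l (ExtR.map N l κ w) := extRes_connect H p N l hS hS' w
  refine ⟨b, fun l => ExtR.connect N (l + 1) hS' ∘ₗ ExtR.connect N l hP, ?_, ?_, ?_, ?_⟩
  · rw [injective_iff_map_eq_zero]
    intro x hx
    obtain ⟨w, rfl⟩ := ExtR.connect_surjective (Q := Q) N 0 hS' x
    rw [hres] at hx
    obtain ⟨h, hh⟩ := hlift 0 _ hx
    have hfac : κ ≫ (bcCover p R).f = bcMap incl := rfl
    rw [← hfac, ← ExtR.map_comp] at hh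
    have : Epi κ := hP.epi_g
    rw [ExtR.map_zero_injective N κ hh]
    exact (ExtR.exact_map_connect N 0 hS' _).2 ⟨h, rfl⟩
  · intro l y
    constructor
    · intro hy
      obtain ⟨z, rfl⟩ := hg l y
      rw [hb] at hy
      obtain ⟨w, rfl⟩ := (ExtR.exact_map_map N l hP z).1 hy
      exact ⟨_, hres l w⟩
    · rintro ⟨t, rfl⟩
      obtain ⟨w, rfl⟩ := ExtR.connect_surjective (Q := Q) N l hS' t
      rw [hres, hb]
      exact (ExtR.exact_map_map N l hP _).2 ⟨w, rfl⟩
  · intro l t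
    constructor
    · intro ht
      have h1 := (injective_iff_map_eq_zero _).1 (ExtR.connect_injective N l hS') _ ht
      obtain ⟨z, rfl⟩ := (ExtR.exact_map_connect N l hP t).1 h1
      exact ⟨_, hb l z⟩
    · rintro ⟨y, rfl⟩
      obtain ⟨z, rfl⟩ := hg l y
      rw [hb, LinearMap.comp_apply, (ExtR.exact_map_connect N l hP _).2 ⟨z, rfl⟩, map_zero]
  · intro l x
    constructor
    · intro hx
      obtain ⟨w, rfl⟩ := ExtR.connect_surjective (Q := Q) N (l + 1) hS' x
      rw [hres] at hx
      have h1 := (injective_iff_map_eq_zero _).1 (ExtR.connect_injective _ l hS) _ hx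
      have h2 := (injective_iff_map_eq_zero _).1 (hθL (l + 1)).1 _ h1
      obtain ⟨t, rfl⟩ := (ExtR.exact_connect_map N l hP w).1 h2
      exact ⟨t, rfl⟩
    · rintro ⟨t, rfl⟩
      rw [LinearMap.comp_apply, hres, (ExtR.exact_connect_map N l hP _).2 ⟨t, rfl⟩, map_zero]

end ChangeOfRingsSequence


section Shift

open Abelian

variable {Q : Type u} [CommRing Q]

lemma subsingleton_ext_pi (X : ModuleCat.{u} Q) (l : ℕ) (Y : ModuleCat.{u} Q)
    (h : Subsingleton (Ext X Y l)) (n : ℕ) :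
    Subsingleton (Ext X (ModuleCat.of Q (Fin n → Y)) l) := by
  refine subsingleton_of_forall_eq 0 fun e => ?_
  let φ : (ModuleCat.of Q (Fin n → Y) ⟶ ModuleCat.of Q (Fin n → Y)) →+
      Ext X (ModuleCat.of Q (Fin n → Y)) l :=
    { toFun := fun f => e.comp (Ext.mk₀ f) (add_zero l)
      map_zero' := by rw [Ext.mk₀_zero, Ext.comp_zero]
      map_add' := fun f g => by rw [Ext.mk₀_add, Ext.comp_add] }
  let π (i : Fin n) : ModuleCat.of Q (Fin n → Y) ⟶ Y := ModuleCat.ofHom (LinearMap.proj i)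
  let ι (i : Fin n) : Y ⟶ ModuleCat.of Q (Fin n → Y) :=
    ModuleCat.ofHom (LinearMap.single Q (fun _ => Y) i)
  have hid : 𝟙 (ModuleCat.of Q (Fin n → Y)) = ∑ i, π i ≫ ι i := by
    ext1
    rw [ModuleCat.hom_sum]
    refine LinearMap.ext fun x => ?_
    rw [LinearMap.sum_apply]
    exact (Finset.univ_sum_single x).symm
  have h1 : φ (𝟙 _) = e := Ext.comp_mk₀_id e
  rw [← h1, hid, map_sum]
  refine Finset.sum_eq_zero fun i _ => ?_
  change e.comp (Ext.mk₀ (π i ≫ ι i)) (add_zero l) = 0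
  rw [← Ext.mk₀_comp_mk₀, ← Ext.comp_assoc _ _ _ (add_zero l) (add_zero 0) (by omega),
    h.elim (e.comp (Ext.mk₀ (π i)) (add_zero l)) 0, Ext.zero_comp]

/-- The covariant connecting map is an isomorphism when the middle term has no `Ext`. -/
lemma nonempty_extShift (X : ModuleCat.{u} Q) {S : ShortComplex (ModuleCat.{u} Q)}
    (hS : S.ShortExact) (l : ℕ) (h0 : Subsingleton (Ext X S.X₂ l))
    (h1 : Subsingleton (Ext X S.X₂ (l + 1))) :
    Nonempty (Ext X S.X₃ l ≃ₗ[Q] Ext X S.X₁ (l + 1)) := by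
  refine ⟨LinearEquiv.ofBijective (hS.extClass.postcompOfLinear Q X rfl) ⟨?_, ?_⟩⟩
  · rw [injective_iff_map_eq_zero]
    intro x hx
    obtain ⟨y, rfl⟩ := Ext.covariant_sequence_exact₃ X hS x rfl hx
    rw [h0.elim y 0, Ext.zero_comp]
  · intro x
    exact Ext.covariant_sequence_exact₁ X hS x (h1.elim _ _) rfl

end Shift

section ConstExt

variable {Q P : Type u} [CommRing Q] [CommRing P] [Algebra Q P] (ρ : P →+* Q)
  (hρ : ∀ q, ρ (algebraMap Q P q) = q) (M : ModuleCat.{u} Q) (N : ModuleCat.{u} Q) (l : ℕ)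

/-- The restriction of scalars along a retraction and back is the identity. -/
noncomputable def resRetract (hρ : ∀ q, ρ (algebraMap Q P q) = q) (M : ModuleCat.{u} Q) :
    (res Q P).obj ((ModuleCat.restrictScalars ρ).obj M) ≅ M where
  hom := ModuleCat.ofHom (X := (res Q P).obj ((ModuleCat.restrictScalars ρ).obj M)) (Y := M)
    (@LinearMap.mk _ _ _ _ (RingHom.id Q) _ _ _ _ _ _ (AddHom.mk (fun m => m) (fun _ _ => rfl))
      (fun q m => congrArg (fun r : Q => r • (show M from m)) (hρ q)))
  inv := ModuleCat.ofHom (X := M) (Y := (res Q P).obj ((ModuleCat.restrictScalars ρ).obj M))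
    (@LinearMap.mk _ _ _ _ (RingHom.id Q) _ _ _ _ _ _ (AddHom.mk (fun m => m) (fun _ _ => rfl))
      (fun q m => (congrArg (fun r : Q => r • (show M from m)) (hρ q)).symm))
  hom_inv_id := rfl
  inv_hom_id := rfl

include hρ in
lemma nonempty_extP_equiv : Nonempty (
    (ModuleCat.restrictScalars ρ).obj (ModuleCat.of Q (Abelian.Ext M N l)) ≃ₗ[P]
      ExtP Q ((ModuleCat.restrictScalars ρ).obj M) N l) := by
  let i := resRetract ρ hρ M
  have hsmul (p : P) (e : Abelian.Ext M N l) :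
      (Abelian.Ext.mk₀ i.hom).comp (ρ p • e) (zero_add l) =
      (Abelian.Ext.mk₀ ((res Q P).map (p • 𝟙 ((ModuleCat.restrictScalars ρ).obj M)))).comp
        ((Abelian.Ext.mk₀ i.hom).comp e (zero_add l)) (zero_add l) := by
    have h : (res Q P).map (p • 𝟙 ((ModuleCat.restrictScalars ρ).obj M)) ≫ i.hom =
        ρ p • i.hom := rfl
    rw [Abelian.Ext.mk₀_comp_mk₀_assoc, h, Abelian.Ext.mk₀_smul, Abelian.Ext.smul_comp,
      Abelian.Ext.comp_smul]
  exact ⟨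
    { toFun := fun e => (Abelian.Ext.mk₀ i.hom).comp (show Abelian.Ext M N l from e) (zero_add l)
      invFun := fun e => (Abelian.Ext.mk₀ i.inv).comp (show Abelian.Ext _ N l from e) (zero_add l)
      map_add' := fun _ _ => Abelian.Ext.comp_add _ _ _ _
      map_smul' := fun p e => hsmul p e
      left_inv := fun e => (Abelian.Ext.mk₀_comp_mk₀_assoc _ _ _).trans (by
        rw [i.inv_hom_id, Abelian.Ext.mk₀_id_comp])
      right_inv := fun e => (Abelian.Ext.mk₀_comp_mk₀_assoc _ _ _).trans (by
        rw [i.hom_inv_id, Abelian.Ext.mk₀_id_comp]) }⟩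

end ConstExt

section Main

lemma finite_of_surjective_ringHom {P R E : Type*} [CommRing P] [CommRing R] [AddCommGroup E]
    [Module R E] [Module.Finite R E] {mE : Module P E} (g : P →+* R) (hg : Function.Surjective g)
    (h : ∀ (p : P) (x : E), p • x = g p • x) : Module.Finite P E := by
  obtain ⟨S, hS⟩ := (inferInstance : Module.Finite R E).1
  refine ⟨S, eq_top_iff.2 fun x _ => ?_⟩
  have hx : x ∈ Submodule.span R (S : Set E) := hS ▸ trivial
  induction hx using Submodule.span_induction with
  | mem x hx => exact Submodule.subset_span hx
  | zero => exact Submodule.zero_mem _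
  | add x y _ _ hx hy => exact Submodule.add_mem _ (hx trivial) (hy trivial)
  | smul r x _ hx =>
    obtain ⟨q, rfl⟩ := hg r
    rw [← h]
    exact Submodule.smul_mem _ _ (hx trivial)

variable {Q R : Type u} [CommRing Q] [CommRing R] [Algebra Q R] {f : Q}
  {A : Type u} [CommRing A] {σ : Type u}
  [Algebra (MvPolynomial σ A) Q] {M : Type u} [AddCommGroup M] [Module (MvPolynomial σ A) M]

/-- Rigidity of `Ext` over a quotient `R = Q/(f)` where `Q` is flat over `A[σ]`. -/
theorem rigid_of_hyperQuotient [Fintype σ] [IsNoetherianRing Q] [Module.Flat (MvPolynomial σ A) Q]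
    [Module A M] [IsScalarTower A (MvPolynomial σ A) M] [Module.Finite A M]
    [Module Q M] [IsScalarTower (MvPolynomial σ A) Q M]
    (hM : IsBaseChange Q (LinearMap.id : M →ₗ[MvPolynomial σ A] M))
    (a : A) (haM : ∀ m : M, a • m = 0)
    (haQ : IsSMulRegular Q (algebraMap (MvPolynomial σ A) Q (MvPolynomial.C a)))
    (H : IsHyperQuotient Q R f) [Module R M] [IsScalarTower Q R M] [Module.Finite R M]
    (hvan : ∀ l ≤ Fintype.card σ, Subsingleton (Abelian.Ext (ModuleCat.of Q M) (ModuleCat.of Q Q) l))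
    (N : ModuleCat.{u} R) [Module.Finite R N] {n : ℕ} (hn : n < Fintype.card σ)
    (h : Subsingleton (Abelian.Ext (ModuleCat.of R M) N n)) :
    ∀ l ≤ n, Subsingleton (Abelian.Ext (ModuleCat.of R M) N l) := by
  have hRn : IsNoetherianRing R := isNoetherianRing_of_surjective Q R _ H.surjective
  have hQR : Module.Finite Q R := Module.Finite.of_surjective (Algebra.linearMap Q R) H.surjective
  have hQM : Module.Finite Q M := Module.Finite.trans R M
  have hQN : Module.Finite Q ((res Q R).obj N) := by
    let _ : Module Q N := Module.compHom N (algebraMap Q R)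
    have _ : IsScalarTower Q R N := ⟨fun q r n => by rw [Algebra.smul_def, mul_smul]; rfl⟩
    exact Module.Finite.trans (R := Q) R N
  obtain ⟨r, p, hp⟩ := Module.Finite.exists_fin' Q M
  obtain ⟨b, c, ha1, hab, hbc, hca⟩ := exists_changeOfRings_sequence H p hp N (IsSMulRegular.pi fun _ => H.regular)
  obtain ⟨r', p', hp'⟩ := Module.Finite.exists_fin' Q ((res Q R).obj N)
  have hS := LinearMap.shortExact_shortComplexKer hp'
  let ρ : MvPolynomial σ Q →+* Q := MvPolynomial.constantCoeff
  let N₁ := ModuleCat.of Q (LinearMap.ker p')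
  have hfin : Module.Finite Q N₁ := inferInstanceAs (Module.Finite Q (LinearMap.ker p'))
  have haG : IsSMulRegular (Fin r' → Q) (algebraMap (MvPolynomial σ A) Q (MvPolynomial.C a)) :=
    IsSMulRegular.pi fun _ => haQ
  have hK := kos_ext hM N₁ a haM (fun x y hxy => Subtype.ext (haG congr(Subtype.val $hxy)))
  let F := ModuleCat.restrictScalars.{u} ρ
  let T (l : ℕ) := F.obj (ModuleCat.of Q (ExtR Q (ModuleCat.of R M) N l))
  let E (l : ℕ) := F.obj (ModuleCat.of Q (ExtR Q (ModuleCat.of Q M) ((res Q R).obj N) l))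
  have hT (l : ℕ) : Module.Finite (MvPolynomial σ Q) (T l) := by
    have h1 : Module.Finite R (Abelian.Ext (ModuleCat.of R M) N l) := inferInstance
    exact finite_of_surjective_ringHom (R := R) (E := Abelian.Ext (ModuleCat.of R M) N l)
      ((algebraMap Q R).comp ρ) (H.surjective.comp fun q => ⟨_, MvPolynomial.constantCoeff_C σ q⟩)
      (P := MvPolynomial σ Q) (mE := (T l).isModule) (fun _ _ => rfl)
  exact subsingleton_of_kos (T := T) (E := E) (n := n) (hK.of_le hn)
    (fun l => (F.map (ModuleCat.ofHom (extRes Q M N l))).hom)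
    (fun l => (F.map (ModuleCat.ofHom (b l))).hom)
    (fun l => (F.map (ModuleCat.ofHom (c l))).hom)
    (extRes_zero_bijective H N) ha1 hab hbc hca
    (fun l hl => by
      obtain ⟨e1⟩ := nonempty_extShift (ModuleCat.of Q M) hS l
        (subsingleton_ext_pi _ _ (ModuleCat.of Q Q) (hvan l (by omega)) _)
        (subsingleton_ext_pi _ _ (ModuleCat.of Q Q) (hvan (l + 1) (by omega)) _)
      obtain ⟨e2⟩ := nonempty_extP_equiv ρ (MvPolynomial.constantCoeff_C σ) (ModuleCat.of Q M) N₁ (l + 1)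
      exact ⟨(F.mapIso e1.toModuleIso).toLinearEquiv.trans e2⟩) h

end Main


section Bridge

variable {S : Type u} [CommRing S] {X : ModuleCat.{u} S} (P : ProjectiveResolution X)
  (Y : ModuleCat.{u} S)

lemma isZero_ext_iff_exactAt (n : ℕ) :
    Limits.IsZero (((Ext S (ModuleCat.{u} S) n).obj (Opposite.op X)).obj Y) ↔
      (P.complex.linearYonedaObj S Y).ExactAt n :=
  (P.isoExt n Y).isZero_iff.trans (HomologicalComplex.exactAt_iff_isZero_homology _ _).symm

include P in
lemma subsingleton_derivedExt_succ_iff (n : ℕ) :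
    Subsingleton (((Ext S (ModuleCat.{u} S) (n + 1)).obj (Opposite.op X)).obj Y) ↔
      Subsingleton (Abelian.Ext X Y (n + 1)) := by
  rw [← ModuleCat.isZero_iff_subsingleton, isZero_ext_iff_exactAt P,
    HomologicalComplex.exactAt_iff' _ n (n + 1) (n + 2) (by simp) (by simp),
    ShortComplex.moduleCat_exact_iff]
  refine ⟨fun h => ⟨fun a b => ?_⟩, fun h f hf => ?_⟩
  · suffices ∀ a : Abelian.Ext X Y (n + 1), a = 0 by rw [this a, this b]
    intro a
    obtain ⟨f, hf, rfl⟩ := P.extMk_surjective a (n + 2) rfl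
    rw [P.extMk_eq_zero_iff f _ _ hf n rfl]
    exact h f hf
  · exact (P.extMk_eq_zero_iff f (n + 2) rfl hf n rfl).1 (Subsingleton.elim _ _)

include P in
lemma subsingleton_derivedExt_zero_iff :
    Subsingleton (((Ext S (ModuleCat.{u} S) 0).obj (Opposite.op X)).obj Y) ↔
      Subsingleton (Abelian.Ext X Y 0) := by
  rw [← ModuleCat.isZero_iff_subsingleton, isZero_ext_iff_exactAt P,
    HomologicalComplex.exactAt_iff' _ 0 0 1 (by simp) (by simp),
    ShortComplex.moduleCat_exact_iff, Abelian.Ext.addEquiv₀.subsingleton_congr]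
  obtain ⟨q, hq, hdq, hker⟩ : ∃ q : P.complex.X 0 ⟶ X, Epi q ∧ P.complex.d 1 0 ≫ q = 0 ∧
      ∀ f : P.complex.X 0 ⟶ Y, P.complex.d 1 0 ≫ f = 0 → ∃ g : X ⟶ Y, q ≫ g = f :=
    ⟨P.π.f 0, (inferInstance : Epi (P.π.f 0)), P.complex_d_comp_π_f_zero, fun f hf =>
      ⟨P.exact₀.desc f hf, P.exact₀.g_desc f hf⟩⟩
  refine ⟨fun h => ⟨fun a b => ?_⟩, fun h f hf => ?_⟩
  · suffices ∀ a : X ⟶ Y, a = 0 by rw [this a, this b]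
    intro a
    obtain ⟨g, hg⟩ := h (q ≫ a) (show P.complex.d 1 0 ≫ q ≫ a = 0 by
      rw [← Category.assoc, hdq, Limits.zero_comp])
    have key : ∀ g : P.complex.X 0 ⟶ Y, P.complex.d 0 0 ≫ g = q ≫ a → a = 0 := fun g hg => by
      rw [P.complex.shape 0 0 (by simp), Limits.zero_comp] at hg
      exact (cancel_epi q).1 (hg.symm.trans Limits.comp_zero.symm)
    exact key g hg
  · obtain ⟨g, hg⟩ := hker f hf
    refine ⟨0, ?_⟩
    rw [map_zero, ← hg, Subsingleton.elim g 0]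
    exact Limits.comp_zero.symm

end Bridge

/-- The derived-functor and derived-category versions of `Ext` vanish simultaneously. -/
theorem subsingleton_derivedExt_iff {S : Type u} [CommRing S] (X Y : ModuleCat.{u} S) (n : ℕ) :
    Subsingleton (((Ext S (ModuleCat.{u} S) n).obj (Opposite.op X)).obj Y) ↔
      Subsingleton (Abelian.Ext X Y n) := by
  cases n with
  | zero => exact subsingleton_derivedExt_zero_iff (projectiveResolution X) Y
  | succ n => exact subsingleton_derivedExt_succ_iff (projectiveResolution X) Y n


open Abelian RingTheory.Sequence

section LocalExt

variable {R : Type u} [CommRing R]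

lemma subsingleton_ext_X₂ (X : ModuleCat.{u} R) {S : ShortComplex (ModuleCat.{u} R)}
    (hS : S.ShortExact) (n : ℕ) (h₁ : Subsingleton (Ext X S.X₁ n))
    (h₃ : Subsingleton (Ext X S.X₃ n)) : Subsingleton (Ext X S.X₂ n) := by
  refine subsingleton_of_forall_eq 0 fun e => ?_
  obtain ⟨y, rfl⟩ := Ext.covariant_sequence_exact₂ X hS e (h₃.elim _ _)
  rw [h₁.elim y 0, Ext.zero_comp]

lemma subsingleton_ext_congr_right (X : ModuleCat.{u} R) {Y Y' : ModuleCat.{u} R} (e : Y ≅ Y')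
    (n : ℕ) (h : Subsingleton (Ext X Y n)) : Subsingleton (Ext X Y' n) := by
  refine subsingleton_of_forall_eq 0 fun x => ?_
  have : (x.comp (Ext.mk₀ e.inv) (add_zero n)).comp (Ext.mk₀ e.hom) (add_zero n) = x := by
    rw [Ext.comp_assoc_of_third_deg_zero, Ext.mk₀_comp_mk₀, e.inv_hom_id, Ext.comp_mk₀_id]
  rw [← this, h.elim (x.comp (Ext.mk₀ e.inv) (add_zero n)) 0, Ext.zero_comp]

lemma subsingleton_ext_congr_left {X X' : ModuleCat.{u} R} (e : X ≅ X') (Y : ModuleCat.{u} R)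
    (n : ℕ) (h : Subsingleton (Ext X Y n)) : Subsingleton (Ext X' Y n) := by
  refine subsingleton_of_forall_eq 0 fun x => ?_
  have : (Ext.mk₀ e.inv).comp ((Ext.mk₀ e.hom).comp x (zero_add n)) (zero_add n) = x := by
    rw [Ext.mk₀_comp_mk₀_assoc, e.inv_hom_id, Ext.mk₀_id_comp]
  rw [← this, h.elim ((Ext.mk₀ e.hom).comp x (zero_add n)) 0, Ext.comp_zero]

/-- The short complex of an exact pair of linear maps. -/
abbrev sesOf {X Y Z : Type u} [AddCommGroup X] [Module R X] [AddCommGroup Y] [Module R Y]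
    [AddCommGroup Z] [Module R Z] {f : X →ₗ[R] Y} {g : Y →ₗ[R] Z} (h : Function.Exact f g) :
    ShortComplex (ModuleCat.{u} R) :=
  ShortComplex.mk (ModuleCat.ofHom f) (ModuleCat.ofHom g)
    (ModuleCat.hom_ext h.linearMap_comp_eq_zero)

lemma sesOf_shortExact {X Y Z : Type u} [AddCommGroup X] [Module R X] [AddCommGroup Y] [Module R Y]
    [AddCommGroup Z] [Module R Z] {f : X →ₗ[R] Y} {g : Y →ₗ[R] Z} (h : Function.Exact f g)
    (hf : Function.Injective f) (hg : Function.Surjective g) : (sesOf h).ShortExact :=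
  ModuleCat.shortComplex_shortExact _ h hf hg

/-- The exact sequence `0 → R/(I : x) → R/I → R/(I + x) → 0`. -/
lemma exists_colon_exact (I : Ideal R) (x : R) :
    ∃ (f : (R ⧸ I.colon {x}) →ₗ[R] R ⧸ I) (g : (R ⧸ I) →ₗ[R] R ⧸ I ⊔ Ideal.span {x}),
      Function.Injective f ∧ Function.Exact f g ∧ Function.Surjective g := by
  let f : R ⧸ I.colon {x} →ₗ[R] R ⧸ I := Submodule.liftQ _ (I.mkQ.comp (LinearMap.mulRight R x)) (by
    intro y hy
    have : y * x ∈ I := Submodule.mem_colon_singleton.1 hy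
    exact (Submodule.Quotient.mk_eq_zero I).2 this)
  let g : R ⧸ I →ₗ[R] R ⧸ I ⊔ Ideal.span {x} := Submodule.factor le_sup_left
  have hf : Function.Injective f := by
    refine LinearMap.ker_eq_bot.1 (Submodule.ker_liftQ_eq_bot _ _ _ fun y hy => ?_)
    have : y * x ∈ I := (Submodule.Quotient.mk_eq_zero I).1 hy
    exact Submodule.mem_colon_singleton.2 this
  refine ⟨f, g, hf, fun y => ?_, Submodule.factor_surjective _⟩
  obtain ⟨y, rfl⟩ := I.mkQ_surjective y
  constructor
  · intro hy
    have : y ∈ I ⊔ Ideal.span {x} := (Submodule.Quotient.mk_eq_zero _).1 hy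
    obtain ⟨a, ha, b, hb, rfl⟩ := Submodule.mem_sup.1 this
    obtain ⟨c, rfl⟩ := Ideal.mem_span_singleton'.1 hb
    refine ⟨Submodule.mkQ _ c, (Submodule.Quotient.eq I).2 ?_⟩
    change c * x - (a + c * x) ∈ I
    simpa using ha
  · rintro ⟨z, hz⟩
    obtain ⟨z, rfl⟩ := Submodule.mkQ_surjective _ z
    rw [← hz]
    refine (Submodule.Quotient.mk_eq_zero _).2 ?_
    exact Ideal.mem_sup_right (Ideal.mul_mem_left _ _ (Ideal.mem_span_singleton_self x))

lemma quotSMulTop_quotient (I : Ideal R) (x : R) :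
    Nonempty ((R ⧸ I ⊔ Ideal.span {x}) ≃ₗ[R] QuotSMulTop x (R ⧸ I)) := by
  refine ⟨(Submodule.quotientQuotientEquivQuotientSup I (Ideal.span {x})).symm.trans
    (Submodule.quotEquivOfEq _ _ ?_)⟩
  rw [Ideal.span, Submodule.map_span, Set.image_singleton]
  refine le_antisymm ?_ ?_
  · rw [Submodule.span_singleton_le_iff_mem]
    refine ⟨I.mkQ 1, trivial, ?_⟩
    change x • I.mkQ 1 = I.mkQ x
    rw [← map_smul, smul_eq_mul, mul_one]
  · rintro _ ⟨z, -, rfl⟩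
    obtain ⟨z, rfl⟩ := I.mkQ_surjective z
    refine Submodule.mem_span_singleton.2 ⟨z, ?_⟩
    change z • I.mkQ x = x • I.mkQ z
    rw [← map_smul, ← map_smul, smul_eq_mul, smul_eq_mul, mul_comm]

lemma subsingleton_ext_of_subsingleton_right (M L : ModuleCat.{u} R) [Subsingleton L] (n : ℕ) :
    Subsingleton (Ext M L n) :=
  subsingleton_of_forall_eq 0 fun e => by
    rw [← Ext.comp_mk₀_id e, (ModuleCat.isZero_of_subsingleton L).eq_of_src (𝟙 _) 0, Ext.mk₀_zero,
      Ext.comp_zero]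

variable [IsLocalRing R]

lemma subsingleton_of_smul_surjective {E : Type*} [AddCommGroup E] [Module R E] [Module.Finite R E]
    {x : R} (hx : x ∈ maximalIdeal R) (h : ∀ e : E, ∃ e' : E, x • e' = e) : Subsingleton E := by
  refine Submodule.subsingleton_iff R |>.1 (subsingleton_of_bot_eq_top ?_)
  refine (Submodule.eq_bot_of_le_smul_of_le_jacobson_bot (maximalIdeal R) ⊤ Module.Finite.fg_top
    (fun e _ => ?_) (maximalIdeal_le_jacobson _)).symm
  obtain ⟨e', rfl⟩ := h e
  exact Submodule.smul_mem_smul hx trivial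

lemma isRegular_of_isWeaklyRegular_maximalIdeal {M : Type*} [AddCommGroup M] [Module R M]
    [Module.Finite R M] [Nontrivial M] {rs : List R} (h : IsWeaklyRegular M rs)
    (hrs : ∀ r ∈ rs, r ∈ maximalIdeal R) : IsRegular M rs := by
  refine ⟨h, fun htop => ?_⟩
  have hle : Ideal.ofList rs ≤ maximalIdeal R := Ideal.span_le.2 hrs
  exact not_subsingleton M ((Submodule.subsingleton_iff R).1 (subsingleton_of_bot_eq_top
    (Submodule.eq_bot_of_le_smul_of_le_jacobson_bot _ ⊤ Module.Finite.fg_top htop.le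
      (hle.trans (maximalIdeal_le_jacobson _))).symm))

variable [IsNoetherianRing R]

lemma subsingleton_ext_of_quotSMulTop_right (M L : ModuleCat.{u} R) [Module.Finite R M]
    [Module.Finite R L] {x : R} (hx : x ∈ maximalIdeal R) (hL : IsSMulRegular L x) (n : ℕ)
    (h : Subsingleton (Ext M (ModuleCat.of R (QuotSMulTop x L)) n)) :
    Subsingleton (Ext M L n) := by
  refine subsingleton_of_smul_surjective hx fun e => ?_
  obtain ⟨y, hy⟩ := Ext.covariant_sequence_exact₂ M hL.smulShortComplex_shortExact e (h.elim _ _)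
  have key (y : Ext M L n) : y.comp (Ext.mk₀ (x • 𝟙 L)) (add_zero n) = x • y := by
    rw [Ext.mk₀_smul, Ext.comp_smul, Ext.comp_mk₀_id]
  exact ⟨y, (key y).symm.trans hy⟩

lemma subsingleton_ext_of_quotSMulTop_left (M N : ModuleCat.{u} R) [Module.Finite R M]
    [Module.Finite R N] {x : R} (hx : x ∈ maximalIdeal R) (hM : IsSMulRegular M x) (n : ℕ)
    (h : Subsingleton (Ext (ModuleCat.of R (QuotSMulTop x M)) N (n + 1))) :
    Subsingleton (Ext M N n) := by
  refine subsingleton_of_smul_surjective hx fun e => ?_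
  obtain ⟨y, hy⟩ := Ext.contravariant_sequence_exact₁ hM.smulShortComplex_shortExact N e
    (add_comm 1 n) (h.elim _ _)
  have key (y : Ext M N n) : (Ext.mk₀ (x • 𝟙 M)).comp y (zero_add n) = x • y := by
    rw [Ext.mk₀_smul, Ext.smul_comp, Ext.mk₀_id_comp]
  exact ⟨y, (key y).symm.trans hy⟩

lemma subsingleton_ext_of_isWeaklyRegular (M N : ModuleCat.{u} R) [Module.Finite R M]
    [Module.Finite R N] (rs : List R) (hrs : ∀ r ∈ rs, r ∈ maximalIdeal R)
    (reg : IsWeaklyRegular M rs) (n : ℕ)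
    (h : Subsingleton (Ext (ModuleCat.of R (M ⧸ Ideal.ofList rs • (⊤ : Submodule R M))) N
      (n + rs.length))) : Subsingleton (Ext M N n) := by
  induction rs generalizing M n with
  | nil =>
    refine subsingleton_ext_congr_left (LinearEquiv.toModuleIso ?_) N n h
    exact Submodule.quotEquivOfEqBot _ (by rw [Ideal.ofList_nil, Submodule.bot_smul])
  | cons x rs ih =>
    simp only [List.mem_cons, forall_eq_or_imp] at hrs
    rw [isWeaklyRegular_cons_iff] at reg
    refine subsingleton_ext_of_quotSMulTop_left M N hrs.1 reg.1 n ?_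
    refine ih (ModuleCat.of R (QuotSMulTop x M)) hrs.2 reg.2 (n + 1) ?_
    rw [List.length_cons, ← add_assoc, add_right_comm] at h
    exact subsingleton_ext_congr_left
      (Submodule.quotOfListConsSMulTopEquivQuotSMulTopInner M x rs).toModuleIso N _ h

lemma subsingleton_ext_quotient (M : ModuleCat.{u} R) [Module.Finite R M] (n : ℕ)
    (h : Subsingleton (Ext M (ModuleCat.of R (ResidueField R)) n)) (I : Ideal R) :
    Subsingleton (Ext M (ModuleCat.of R (R ⧸ I)) n) := by
  induction I using IsNoetherian.induction with
  | hgt I ih =>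
  change Ideal R at I
  by_cases htop : I = ⊤
  · have : Subsingleton (R ⧸ I) := Submodule.Quotient.subsingleton_iff.2 htop
    exact subsingleton_ext_of_subsingleton_right M (ModuleCat.of R (R ⧸ I)) n
  have hlt {x : R} (hxI : x ∉ I) : I < I ⊔ Ideal.span {x} := lt_of_le_of_ne le_sup_left
    fun h => hxI (h ▸ Ideal.mem_sup_right (Ideal.mem_span_singleton_self x))
  by_cases hI : I.IsPrime
  · by_cases hm : I = maximalIdeal R
    · exact hm ▸ h
    obtain ⟨x, hx, hxI⟩ := SetLike.exists_of_lt ((le_maximalIdeal htop).lt_of_ne hm)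
    have hreg : IsSMulRegular (R ⧸ I) x := by
      rw [isSMulRegular_iff_right_eq_zero_of_smul]
      intro y hy
      obtain ⟨y, rfl⟩ := I.mkQ_surjective y
      have : x * y ∈ I := (Submodule.Quotient.mk_eq_zero I).1 hy
      exact (Submodule.Quotient.mk_eq_zero I).2 ((hI.mem_or_mem this).resolve_left hxI)
    obtain ⟨e⟩ := quotSMulTop_quotient I x
    exact subsingleton_ext_of_quotSMulTop_right M (ModuleCat.of R (R ⧸ I)) hx hreg n
      (subsingleton_ext_congr_right M e.toModuleIso n (ih _ (hlt hxI)))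
  · rw [Ideal.isPrime_iff] at hI
    push Not at hI
    obtain ⟨x, y, hxy, hx, hy⟩ := hI htop
    obtain ⟨f, g, hf, hfg, hg⟩ := exists_colon_exact I x
    refine subsingleton_ext_X₂ M (sesOf_shortExact hfg hf hg) n (ih _ ?_) (ih _ (hlt hx))
    refine lt_of_le_of_ne (fun z hz => Submodule.mem_colon_singleton.2 (I.mul_mem_right _ hz))
      fun h => hy (h ▸ Submodule.mem_colon_singleton.2 ?_)
    rwa [smul_eq_mul, mul_comm]

/-- Vanishing of `Ext^n(M, k)` forces vanishing of `Ext^n(M, L)` for finitely generated `L`. -/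
theorem subsingleton_ext_of_residueField (M : ModuleCat.{u} R) [Module.Finite R M] (n : ℕ)
    (h : Subsingleton (Ext M (ModuleCat.of R (ResidueField R)) n)) (L : Type u) [AddCommGroup L]
    [Module R L] [hL : Module.Finite R L] : Subsingleton (Ext M (ModuleCat.of R L) n) := by
  induction hL using IsNoetherianRing.induction_on_isQuotientEquivQuotientPrime R with
  | subsingleton N => exact subsingleton_ext_of_subsingleton_right M (ModuleCat.of R N) n
  | quotient N p e =>
    exact subsingleton_ext_congr_right M e.symm.toModuleIso n (subsingleton_ext_quotient M n h p.1)
  | exact N₁ N₂ N₃ f g hf hg hfg h1 h3 =>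
    exact subsingleton_ext_X₂ M (sesOf_shortExact hfg hf hg) n h1 h3

lemma hasProjectiveDimensionLT_of_residueField (M : ModuleCat.{u} R) [Module.Finite R M] (n : ℕ)
    (h : Subsingleton (Ext M (ModuleCat.of R (ResidueField R)) n)) :
    HasProjectiveDimensionLT M n :=
  ModuleCat.hasProjectiveDimensionLT_of_forall_finite M n fun L _ =>
    subsingleton_ext_of_residueField M n h L

/-- A finite length module has projective dimension at most that of the residue field. -/
lemma hasProjectiveDimensionLT_of_support {n : ℕ}
    (h : HasProjectiveDimensionLT (ModuleCat.of R (ResidueField R)) n) (L : Type u) [AddCommGroup L]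
    [Module R L] [hL : Module.Finite R L] (hs : ∀ p ∈ Module.support R L, p = closedPoint R) :
    HasProjectiveDimensionLT (ModuleCat.of R L) n := by
  induction hL using IsNoetherianRing.induction_on_isQuotientEquivQuotientPrime R with
  | subsingleton N =>
    have := (ModuleCat.isZero_of_subsingleton (ModuleCat.of R N)).hasProjectiveDimensionLT_zero
    exact hasProjectiveDimensionLT_of_ge _ 0 n (Nat.zero_le _)
  | quotient N p e =>
    have hp : p = closedPoint R := hs p (by
      rw [e.support_eq, Module.mem_support_iff_of_finite, Ideal.annihilator_quotient])
    subst hp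
    exact hasProjectiveDimensionLT_of_iso
      (X := ModuleCat.of R (ResidueField R)) e.symm.toModuleIso n
  | exact N₁ N₂ N₃ f g hf hg hfg h1 h3 =>
    exact (sesOf_shortExact hfg hf hg).hasProjectiveDimensionLT_X₂ n
      (h1 fun p hp => hs p (Module.support_subset_of_injective f hf hp))
      (h3 fun p hp => hs p (Module.support_subset_of_surjective g hg hp))

lemma hasProjectiveDimensionLT_residueField {rs : List R} (h : IsRegular R rs)
    (hm : Ideal.ofList rs = maximalIdeal R) :
    HasProjectiveDimensionLT (ModuleCat.of R (ResidueField R)) (rs.length + 1) := by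
  have h1 := ModuleCat.projectiveDimension_quotient_eq_add_length_of_isWeaklyRegular
    (ModuleCat.of R R) rs h.1 (fun r hr => hm ▸ Ideal.subset_span hr)
  have hR : Projective (ModuleCat.of R R) := (IsProjective.iff_projective R).1 inferInstance
  rw [ModuleCat.projectiveDimension_eq_zero_of_projective (ModuleCat.of R R), zero_add] at h1
  have e : (R ⧸ Ideal.ofList rs • (⊤ : Submodule R R)) ≃ₗ[R] ResidueField R :=
    Submodule.quotEquivOfEq _ _ (by rw [smul_eq_mul, Ideal.mul_top, hm])
  rw [projectiveDimension_eq_of_iso e.toModuleIso] at h1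
  exact (projectiveDimension_le_iff _ _).1 h1.le

lemma hasProjectiveDimensionLE_of_isWeaklyRegular (M : ModuleCat.{u} R) [Module.Finite R M]
    [Nontrivial M] {rs : List R} (hrs : ∀ r ∈ rs, r ∈ maximalIdeal R) (reg : IsWeaklyRegular M rs)
    (hs : ∀ p ∈ Module.support R (M ⧸ Ideal.ofList rs • (⊤ : Submodule R M)), p = closedPoint R)
    {c e : ℕ} (hk : HasProjectiveDimensionLT (ModuleCat.of R (ResidueField R)) (e + 1))
    (hc : e = c + rs.length) : HasProjectiveDimensionLE M c := by
  have h1 := ModuleCat.projectiveDimension_quotient_eq_add_length_of_isWeaklyRegular M rs reg hrs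
  have h2 := hasProjectiveDimensionLT_of_support hk _ hs
  rw [← HasProjectiveDimensionLE, ← projectiveDimension_le_iff, h1, hc, Nat.cast_add,
    ENat.WithBot.add_le_add_natCast_right_iff, projectiveDimension_le_iff] at h2
  exact h2

lemma subsingleton_ext_ring (M : ModuleCat.{u} R) [Module.Finite R M] {xs rs : List R}
    (hxs : ∀ r ∈ xs, r ∈ maximalIdeal R) (hx : IsWeaklyRegular M xs)
    (hs : ∀ p ∈ Module.support R (M ⧸ Ideal.ofList xs • (⊤ : Submodule R M)), p = closedPoint R)
    (hrs : ∀ r ∈ rs, r ∈ maximalIdeal R) (hr : IsWeaklyRegular R rs) (l : ℕ)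
    (hl : l + xs.length < rs.length) : Subsingleton (Ext M (ModuleCat.of R R) l) := by
  refine subsingleton_ext_of_isWeaklyRegular M _ xs hxs hx l ?_
  refine ModuleCat.subsingleton_ext_of_exists_isRegular (maximalIdeal R) _ (fun p hp => ?_) _
    (lt_top_iff_ne_top.2 ?_) rs hrs (isRegular_of_isWeaklyRegular_maximalIdeal hr hrs) _ hl
  · rw [hs p hp]
    exact le_refl (maximalIdeal R)
  · change maximalIdeal R • (⊤ : Ideal R) ≠ ⊤
    rw [smul_eq_mul, Ideal.mul_top]
    exact Ideal.IsPrime.ne_top'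

end LocalExt

section Top

variable {Q R : Type u} [CommRing Q] [CommRing R] [Algebra Q R] {f : Q}
  {M : Type u} [AddCommGroup M] [Module Q M] [Module R M] [IsScalarTower Q R M] [Module.Finite R M]

/-- Over a hypersurface quotient, finite projective dimension is bounded by the one over the
ambient ring minus one. -/
lemma subsingleton_ext_of_hyperQuotient (H : IsHyperQuotient Q R f) (c : ℕ)
    (hQ : HasProjectiveDimensionLT (ModuleCat.of Q M) (c + 2)) (N : ModuleCat.{u} R) {g : ℕ}
    (hR : ∀ l, g < l → Subsingleton (Ext (ModuleCat.of R M) N l)) (l : ℕ) (hl : c + 1 ≤ l) :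
    Subsingleton (Ext (ModuleCat.of R M) N l) := by
  have hQR : Module.Finite Q R := Module.Finite.of_surjective (Algebra.linearMap Q R) H.surjective
  have hQM : Module.Finite Q M := Module.Finite.trans R M
  obtain ⟨r, p, hp⟩ := Module.Finite.exists_fin' Q M
  obtain ⟨b, c', ha1, hab, hbc, hca⟩ :=
    exists_changeOfRings_sequence H p hp N (IsSMulRegular.pi fun _ => H.regular)
  have step (l : ℕ) (hl : c + 1 ≤ l) (h : Subsingleton (Ext (ModuleCat.of R M) N (l + 2))) :
      Subsingleton (Ext (ModuleCat.of R M) N l) := by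
    refine subsingleton_of_forall_eq 0 fun e => ?_
    have hE : Subsingleton (ExtR Q (ModuleCat.of Q M) ((res Q R).obj N) (l + 1)) :=
      HasProjectiveDimensionLT.subsingleton (ModuleCat.of Q M) (c + 2) (l + 1) (by omega) _
    obtain ⟨y, rfl⟩ := (hbc l e).1 (h.elim _ _)
    rw [hE.elim y 0, _root_.map_zero]
    rfl
  obtain ⟨d, hd⟩ : ∃ d, g < l + 2 * d := ⟨g + 1, by omega⟩
  induction d generalizing l with
  | zero => exact hR l hd
  | succ d ih => exact step l hl (ih (l + 2) (by omega) (by omega))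

end Top


section Completion

lemma exists_lift_adicCompletion {S B : Type*} [CommRing S] [CommRing B] (J : Ideal S)
    (K : Ideal B) [IsAdicComplete K B] (φ : S →+* B) (h : J.map φ ≤ K) :
    ∃ ψ : AdicCompletion J S →+* B, ψ.comp (algebraMap S (AdicCompletion J S)) = φ := by
  have hle (n : ℕ) : J ^ n ≤ (K ^ n).comap φ := by
    rw [← Ideal.map_le_iff_le_comap, Ideal.map_pow]
    exact Ideal.pow_right_mono h n
  let f (n : ℕ) : AdicCompletion J S →+* B ⧸ K ^ n :=
    (Ideal.quotientMap (K ^ n) φ (hle n)).comp (AdicCompletion.evalₐ J n : _ →+* S ⧸ J ^ n)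
  have hf {m n : ℕ} (hmn : m ≤ n) : (Ideal.Quotient.factorPow K hmn).comp (f n) = f m := by
    ext x
    induction x using AdicCompletion.induction_on with
    | _ x =>
    simp only [f, RingHom.comp_apply, RingHom.coe_coe, AdicCompletion.evalₐ_mk,
      Ideal.quotientMap_mk]
    change Ideal.Quotient.mk (K ^ m) _ = _
    rw [Ideal.Quotient.eq, ← map_sub]
    refine hle m ?_
    have := x.2 hmn
    rw [SModEq.sub_mem] at this
    rw [← neg_mem_iff, neg_sub]
    simpa using this
  refine ⟨IsAdicComplete.liftRingHom K f hf, ?_⟩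
  ext x
  refine sub_eq_zero.1 (IsHausdorff.haus (I := K) inferInstance _ fun n => ?_)
  rw [SModEq.zero]
  simp only [smul_eq_mul, Ideal.mul_top]
  rw [← Ideal.Quotient.eq]
  simp [f]

structure CompletionData {S : Type u} [CommRing S] (J : Ideal S) (C : Type u) [CommRing C]
    [Algebra S C] : Prop where
  noetherian : IsNoetherianRing C
  flat : Module.Flat S C
  complete : IsAdicComplete (J.map (algebraMap S C)) C
  surj : ∀ c : C, ∃ s : S, c - algebraMap S C s ∈ J.map (algebraMap S C)
  lift : ∀ (B : Type u) [CommRing B] (K : Ideal B) [IsAdicComplete K B] (φ : S →+* B),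
    J.map φ ≤ K → ∃ ψ : C →+* B, ψ.comp (algebraMap S C) = φ

lemma isNoetherianRing_of_isAdicComplete {S C : Type u} [CommRing S] [IsNoetherianRing S]
    [CommRing C] [Algebra S C] (J : Ideal S) [IsAdicComplete (J.map (algebraMap S C)) C]
    (hsurj : ∀ c : C, ∃ s : S, c - algebraMap S C s ∈ J.map (algebraMap S C)) :
    IsNoetherianRing C := by
  obtain ⟨r, j, hj⟩ := Submodule.fg_iff_exists_fin_generating_family.1 J.fg_of_isNoetherianRing
  let φ : MvPolynomial (Fin r) S →+* C :=
    MvPolynomial.eval₂Hom (algebraMap S C) fun i => algebraMap S C (j i)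
  let I := MvPolynomial.idealOfVars (Fin r) S
  let D := AdicCompletion I (MvPolynomial (Fin r) S)
  have hmap : I.map φ = J.map (algebraMap S C) := by
    have hI : I.map φ = Ideal.span (Set.range (φ ∘ MvPolynomial.X)) := by
      rw [Set.range_comp, ← Ideal.map_span]
    rw [hI, ← hj, ← Ideal.span, Ideal.map_span, ← Set.range_comp]
    congr 2
    ext i
    simp [φ]
  obtain ⟨ψ, hψ⟩ := exists_lift_adicCompletion I (J.map (algebraMap S C)) φ hmap.le
  have : IsAdicComplete (I.map (algebraMap _ D)) D :=
    AdicCompletion.isAdicComplete_self I (Ideal.fg_of_isNoetherianRing _)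
  have hmap' : (I.map (algebraMap _ D)).map ψ = J.map (algebraMap S C) := by
    rw [Ideal.map_map, hψ, hmap]
  have hD : IsNoetherianRing D :=
    isNoetherianRing_of_ringEquiv _ (MvPowerSeries.toAdicCompletionAlgEquiv (Fin r) S).toRingEquiv
  have : IsHausdorff ((I.map (algebraMap _ D)).map ψ) C := by
    rw [hmap']; infer_instance
  refine isNoetherianRing_of_surjective D C ψ
    (surjective_of_mk_map_comp_surjective ψ (I := I.map (algebraMap _ D)) fun y => ?_)
  obtain ⟨y, rfl⟩ := Ideal.Quotient.mk_surjective y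
  obtain ⟨s, hs⟩ := hsurj y
  refine ⟨algebraMap (MvPolynomial (Fin r) S) D (MvPolynomial.C s), ?_⟩
  have hψs : ψ (algebraMap (MvPolynomial (Fin r) S) D (MvPolynomial.C s)) = algebraMap S C s := by
    rw [← RingHom.comp_apply ψ, hψ]
    simp [φ]
  rw [RingHom.comp_apply, eq_comm, Ideal.Quotient.eq, hmap', hψs]
  exact hs

theorem completionData_adicCompletion {S : Type u} [CommRing S] [IsNoetherianRing S]
    (J : Ideal S) : CompletionData J (AdicCompletion J S) := by
  have hsurj : ∀ c : AdicCompletion J S, ∃ s : S, c - algebraMap S (AdicCompletion J S) s ∈ J.map (algebraMap S (AdicCompletion J S)) := by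
    intro c
    obtain ⟨s, hs⟩ := Ideal.Quotient.mk_surjective (AdicCompletion.evalOneₐ J c)
    refine ⟨s, ?_⟩
    rw [← AdicCompletion.ker_evalOneₐ_eq_map _ J.fg_of_isNoetherianRing, RingHom.mem_ker]
    change AdicCompletion.evalOneₐ J _ = 0
    rw [map_sub, ← hs]
    simp
  have := AdicCompletion.isAdicComplete_self J J.fg_of_isNoetherianRing
  exact ⟨isNoetherianRing_of_isAdicComplete J hsurj, AdicCompletion.flat_of_isNoetherian J,
    AdicCompletion.isAdicComplete_self J J.fg_of_isNoetherianRing, hsurj,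
    fun B _ K _ φ h => exists_lift_adicCompletion J K φ h⟩

end Completion


section PolynomialRegular

open RingTheory.Sequence MvPolynomial

variable {σ A : Type*} [CommRing A]

lemma isWeaklyRegular_map_X (l : List σ) (hl : l.Nodup) :
    IsWeaklyRegular (MvPolynomial σ A) (l.map (X : σ → MvPolynomial σ A)) := by
  refine ⟨fun i hi => ?_⟩
  have hspan : (Ideal.ofList ((l.map (X : σ → MvPolynomial σ A)).take i) •
      (⊤ : Submodule (MvPolynomial σ A) (MvPolynomial σ A))) =
      Ideal.span (X '' {s | s ∈ l.take i}) := by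
    rw [smul_eq_mul, Ideal.mul_top, Ideal.ofList]
    congr 1
    ext x
    simp [← List.map_take]
  rw [isSMulRegular_quotient_iff_mem_of_smul_mem, hspan]
  intro p hp
  simp only [List.getElem_map, smul_eq_mul] at hp
  rw [mem_ideal_span_X_image] at hp ⊢
  intro m hm
  obtain ⟨j, hj, hj'⟩ := hp (m + Finsupp.single (l[i]'(by simpa using hi)) 1) (by
    rw [mem_support_iff, mul_comm, coeff_mul_X]
    exact mem_support_iff.1 hm)
  refine ⟨j, hj, ?_⟩
  have hne : l[i]'(by simpa using hi) ≠ j := by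
    rintro rfl
    obtain ⟨k, hk, hk'⟩ := List.mem_take_iff_getElem.1 hj
    have := (List.Nodup.getElem_inj_iff hl).1 hk'
    omega
  simpa [Finsupp.single_apply, hne] using hj'

lemma ofList_map_X (l : List σ) (hl : ∀ i, i ∈ l) :
    Ideal.ofList (l.map (X : σ → MvPolynomial σ A)) = idealOfVars σ A := by
  rw [Ideal.ofList, idealOfVars]
  congr 1
  ext x
  simp [hl]

lemma mem_idealOfVars_iff (p : MvPolynomial σ A) :
    p ∈ idealOfVars σ A ↔ constantCoeff p = 0 := by
  rw [idealOfVars, ← Set.image_univ, mem_ideal_span_X_image]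
  constructor
  · intro h
    by_contra h0
    obtain ⟨i, -, hi⟩ := h 0 (by simpa [mem_support_iff, constantCoeff_eq] using h0)
    simp at hi
  · intro h m hm
    by_contra! h0
    have : m = 0 := by ext i; simpa using h0 i
    subst this
    exact (mem_support_iff.1 hm) h

lemma isWeaklyRegular_mvPolynomial (l : List σ) (hl : l.Nodup) (hl' : ∀ i, i ∈ l) {rs : List A}
    (hrs : IsWeaklyRegular A rs) :
    IsWeaklyRegular (MvPolynomial σ A) (l.map (X : σ → MvPolynomial σ A) ++ rs.map C) := by
  rw [isWeaklyRegular_append_iff]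
  refine ⟨isWeaklyRegular_map_X l hl, ?_⟩
  rw [← algebraMap_eq, isWeaklyRegular_map_algebraMap_iff]
  set N : Submodule (MvPolynomial σ A) (MvPolynomial σ A) :=
    Ideal.ofList (l.map (X : σ → MvPolynomial σ A)) • ⊤ with hN
  let f : MvPolynomial σ A →ₗ[A] A := (aeval (fun _ => (0 : A))).toLinearMap
  have hf : Function.Surjective f := fun a => ⟨C a, by simp [f]⟩
  have hker : N.restrictScalars A = LinearMap.ker f := by
    ext p
    rw [hN, smul_eq_mul, Ideal.mul_top, ofList_map_X l hl', Submodule.restrictScalars_mem,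
      mem_idealOfVars_iff, LinearMap.mem_ker]
    simp [f, aeval_zero']
  exact (((Submodule.Quotient.restrictScalarsEquiv A N).symm ≪≫ₗ
    Submodule.quotEquivOfEq _ _ hker ≪≫ₗ f.quotKerEquivOfSurjective hf).isWeaklyRegular_congr rs).2
    hrs

end PolynomialRegular

section ResidueData

variable {S B : Type*} [CommRing S] [CommRing B] [IsLocalRing B]

/-- `φ : S → B` induces an isomorphism of `S ⧸ I` with the residue field of `B`. -/
structure ResidueData (I : Ideal S) (φ : S →+* B) : Prop where
  mem_iff : ∀ s, φ s ∈ maximalIdeal B ↔ s ∈ I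
  surj : ∀ b, ∃ s, b - φ s ∈ maximalIdeal B

namespace ResidueData

variable {I : Ideal S} {φ : S →+* B} (h : ResidueData I φ)

include h

lemma map_le : I.map φ ≤ maximalIdeal B :=
  Ideal.map_le_iff_le_comap.2 fun s hs => (h.mem_iff s).2 hs

lemma isMaximal : I.IsMaximal := by
  have hsurj : Function.Surjective ((residue B).comp φ) := by
    intro y
    obtain ⟨b, rfl⟩ := residue_surjective y
    obtain ⟨s, hs⟩ := h.surj b
    refine ⟨s, ?_⟩
    rw [← residue_eq_zero_iff, map_sub, sub_eq_zero] at hs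
    exact hs.symm
  have : I = RingHom.ker ((residue B).comp φ) := by
    ext s
    rw [RingHom.mem_ker, RingHom.comp_apply, residue_eq_zero_iff, h.mem_iff]
  rw [this]
  exact RingHom.ker_isMaximal_of_surjective _ hsurj

lemma isLocalRing [IsAdicComplete I S] : IsLocalRing S :=
  have := h.isMaximal
  isLocalRing_of_isAdicComplete_maximal I

lemma maximalIdeal_eq [IsLocalRing S] : maximalIdeal S = I :=
  (IsLocalRing.eq_maximalIdeal h.isMaximal).symm

lemma mvPolynomial {σ : Type*} (g : σ → B) (hg : ∀ i, g i ∈ maximalIdeal B) :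
    ResidueData (MvPolynomial.idealOfVars σ S ⊔ I.map MvPolynomial.C)
      (MvPolynomial.eval₂Hom φ g) := by
  have hvars : ∀ p ∈ MvPolynomial.idealOfVars σ S,
      MvPolynomial.eval₂Hom φ g p ∈ maximalIdeal B := by
    intro p hp
    have : MvPolynomial.idealOfVars σ S ≤ (maximalIdeal B).comap (MvPolynomial.eval₂Hom φ g) := by
      rw [MvPolynomial.idealOfVars, Ideal.span_le]
      rintro _ ⟨i, rfl⟩
      simpa using hg i
    exact this hp
  have hdecomp : ∀ p : MvPolynomial σ S, p - MvPolynomial.C (MvPolynomial.constantCoeff p) ∈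
      MvPolynomial.idealOfVars σ S := by
    intro p
    rw [mem_idealOfVars_iff]
    simp
  refine ⟨fun p => ⟨fun hp => ?_, fun hp => ?_⟩, fun b => ?_⟩
  · have h1 := sub_mem hp (hvars _ (hdecomp p))
    rw [← map_sub, sub_sub_cancel, MvPolynomial.coe_eval₂Hom, MvPolynomial.eval₂_C,
      h.mem_iff] at h1
    rw [← sub_add_cancel p (MvPolynomial.C (MvPolynomial.constantCoeff p))]
    exact add_mem (Ideal.mem_sup_left (hdecomp p))
      (Ideal.mem_sup_right (Ideal.mem_map_of_mem _ h1))
  · have : MvPolynomial.idealOfVars σ S ⊔ I.map MvPolynomial.C ≤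
        (maximalIdeal B).comap (MvPolynomial.eval₂Hom φ g) := by
      refine sup_le (fun p hp => hvars p hp) (Ideal.map_le_iff_le_comap.2 fun s hs => ?_)
      simpa using (h.mem_iff s).2 hs
    exact this hp
  · obtain ⟨s, hs⟩ := h.surj b
    exact ⟨MvPolynomial.C s, by simpa using hs⟩

end ResidueData

lemma ResidueData.completion {S B C : Type u} [CommRing S] [CommRing B] [IsLocalRing B]
    [CommRing C] [Algebra S C] {I : Ideal S} {φ : S →+* B} (h : ResidueData I φ)
    (hC : CompletionData I C) (ψ : C →+* B) (hψ : ψ.comp (algebraMap S C) = φ) :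
    ResidueData (I.map (algebraMap S C)) ψ := by
  have hle : I.map (algebraMap S C) ≤ (maximalIdeal B).comap ψ := by
    rw [← Ideal.map_le_iff_le_comap, Ideal.map_map, hψ]
    exact h.map_le
  have hφ (s : S) : ψ (algebraMap S C s) = φ s := RingHom.congr_fun hψ s
  refine ⟨fun c => ⟨fun hc => ?_, fun hc => hle hc⟩, fun b => ?_⟩
  · obtain ⟨s, hs⟩ := hC.surj c
    have h1 := sub_mem hc (hle hs)
    rw [← map_sub, sub_sub_cancel, hφ, h.mem_iff] at h1
    rw [← sub_add_cancel c (algebraMap S C s)]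
    exact add_mem hs (Ideal.mem_map_of_mem _ h1)
  · obtain ⟨s, hs⟩ := h.surj b
    exact ⟨algebraMap S C s, by rwa [hφ]⟩

end ResidueData


section CompleteNakayama

lemma isPrecomplete_pi {A : Type*} [CommRing A] (I : Ideal A) [IsPrecomplete I A] (r : ℕ) :
    IsPrecomplete I (Fin r → A) := by
  have hmem (n : ℕ) (v : Fin r → A) :
      v ∈ (I ^ n • ⊤ : Submodule A (Fin r → A)) ↔ ∀ i, v i ∈ (I ^ n • ⊤ : Submodule A A) := by
    constructor
    · intro hv i
      have := Submodule.mem_map_of_mem (f := LinearMap.proj (R := A) (φ := fun _ : Fin r => A) i) hv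
      rw [Submodule.map_smul''] at this
      exact Submodule.smul_mono le_rfl le_top this
    · intro hv
      rw [← Finset.univ_sum_single v]
      refine sum_mem fun i _ => ?_
      have : Pi.single i (v i) = v i • (Pi.single i 1 : Fin r → A) := by
        rw [← Pi.single_smul, smul_eq_mul, mul_one]
      rw [this]
      have h := hv i
      rw [smul_eq_mul, Ideal.mul_top] at h
      exact Submodule.smul_mem_smul h trivial
  refine ⟨fun f hf => ?_⟩
  have (i : Fin r) : ∃ L : A, ∀ n, f n i ≡ L [SMOD (I ^ n • ⊤ : Submodule A A)] := by
    refine IsPrecomplete.prec inferInstance fun {m n} hmn => ?_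
    have := hf hmn
    rw [SModEq.sub_mem, hmem] at this
    rw [SModEq.sub_mem]
    exact this i
  choose L hL using this
  refine ⟨L, fun n => ?_⟩
  rw [SModEq.sub_mem, hmem]
  intro i
  exact SModEq.sub_mem.1 (hL i n)

/-- Nakayama's lemma over a complete ring, without finiteness assumptions. -/
lemma span_eq_top_of_isPrecomplete {A M : Type*} [CommRing A] (I : Ideal A) [IsPrecomplete I A]
    [AddCommGroup M] [Module A M] [IsHausdorff I M] (N : Submodule A M) (hN : N.FG)
    (h : N ⊔ I • ⊤ = ⊤) : N = ⊤ := by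
  obtain ⟨r, s, rfl⟩ := Submodule.fg_iff_exists_fin_generating_family.1 hN
  have := isPrecomplete_pi I r
  rw [← Fintype.range_linearCombination A s] at h ⊢
  refine LinearMap.range_eq_top.2 (surjective_of_mkQ_comp_surjective (I := I) ?_)
  rw [← LinearMap.range_eq_top, LinearMap.range_comp,
    Submodule.map_mkQ_eq_top, sup_comm, h]

variable {A B M : Type*} [CommRing A] [CommRing B] [IsLocalRing B] [IsNoetherianRing B]
  [Algebra A B] [AddCommGroup M] [Module A M] [Module B M] [IsScalarTower A B M]
  [Module.Finite B M] {I : Ideal A}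

lemma isHausdorff_of_map_ne_top (h : I.map (algebraMap A B) ≠ ⊤) : IsHausdorff I M := by
  have : IsHausdorff (I.map (algebraMap A B)) M := IsHausdorff.of_isLocalRing _ M h
  exact IsHausdorff.map_algebraMap_iff.1 this

omit [IsNoetherianRing B] [Module.Finite B M] in
lemma ResidueData.span_restrictScalars (h : ResidueData I (algebraMap A B)) (F : Set M) :
    (Submodule.span B F).restrictScalars A ≤ Submodule.span A F ⊔
      (maximalIdeal B • Submodule.span B F).restrictScalars A := by
  intro x hx
  have hx' : x ∈ Submodule.span B F := hx
  clear hx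
  induction hx' using Submodule.span_induction with
  | mem x hx => exact Submodule.mem_sup_left (Submodule.subset_span hx)
  | zero => exact zero_mem _
  | add x y _ _ hx hy => exact add_mem hx hy
  | smul b x hx' hx =>
    obtain ⟨y, hy, z, hz, rfl⟩ := Submodule.mem_sup.1 hx
    obtain ⟨a, ha⟩ := h.surj b
    have : b • (y + z) = a • y + ((b - algebraMap A B a) • y + b • z) := by
      rw [sub_smul, algebraMap_smul B a y, smul_add]
      abel
    rw [this]
    have h1 : (b - algebraMap A B a) • y ∈ maximalIdeal B • Submodule.span B F :=
      Submodule.smul_mem_smul ha (Submodule.span_le_restrictScalars A B F hy)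
    have h2 : b • z ∈ maximalIdeal B • Submodule.span B F := Submodule.smul_mem _ b hz
    exact add_mem (Submodule.mem_sup_left (Submodule.smul_mem _ _ hy))
      (Submodule.mem_sup_right (add_mem h1 h2))

lemma ResidueData.exists_fg_sup (h : ResidueData I (algebraMap A B)) (n : ℕ) :
    ∃ N : Submodule A M, N.FG ∧
      N ⊔ (maximalIdeal B ^ n • (⊤ : Submodule B M)).restrictScalars A = ⊤ := by
  induction n with
  | zero => exact ⟨⊥, Submodule.fg_bot, by simp⟩
  | succ n ih =>
    obtain ⟨N, hN, hN'⟩ := ih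
    obtain ⟨F, hF⟩ : (maximalIdeal B ^ n • (⊤ : Submodule B M)).FG := IsNoetherian.noetherian _
    refine ⟨N ⊔ Submodule.span A F, hN.sup ⟨F, rfl⟩, ?_⟩
    have := h.span_restrictScalars (F : Set M)
    rw [hF, ← mul_smul, ← pow_succ'] at this
    rw [eq_top_iff, ← hN', sup_assoc]
    exact sup_le_sup_left this _

theorem ResidueData.finite [IsAdicComplete I A] (h : ResidueData I (algebraMap A B)) (t : ℕ)
    (ht : maximalIdeal B ^ t • (⊤ : Submodule B M) ≤ I.map (algebraMap A B) • ⊤) :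
    Module.Finite A M := by
  have : IsHausdorff I M := isHausdorff_of_map_ne_top (B := B) fun h0 => by
    have := h.map_le
    rw [h0, top_le_iff] at this
    exact Ideal.IsPrime.ne_top' this
  obtain ⟨N, hN, hN'⟩ := h.exists_fg_sup (M := M) t
  have : N = ⊤ := by
    refine span_eq_top_of_isPrecomplete I N hN (top_le_iff.1 ?_)
    refine hN'.ge.trans (sup_le_sup_left (fun x hx => ?_) _)
    have := ht hx
    rw [← Submodule.restrictScalars_mem A, Ideal.smul_restrictScalars] at this
    simpa using this
  exact ⟨this ▸ hN⟩

end CompleteNakayama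

section Annihilator

open RingTheory.Sequence

lemma exists_annihilator_of_pow_smul_mem {A M : Type*} [CommRing A] [AddCommGroup M] [Module A M]
    [Module.Finite A M] (X : Ideal A) (π : A) (t : ℕ)
    (h : ∀ m : M, π ^ t • m ∈ (X • ⊤ : Submodule A M)) :
    ∃ (a : A) (N : ℕ), a - π ^ N ∈ X ∧ ∀ m : M, a • m = 0 := by
  obtain ⟨p, hp, -, hc, h0⟩ :=
    LinearMap.exists_monic_and_natDegree_eq_and_coeff_mem_pow_and_aeval_eq_zero
      A (LinearMap.lsmul A M (π ^ t)) X (by rintro _ ⟨m, rfl⟩; exact h m)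
  refine ⟨p.eval (π ^ t), t * p.natDegree, ?_, fun m => ?_⟩
  · rw [Polynomial.eval_eq_sum_range, Finset.sum_range_succ, hp.coeff_natDegree, one_mul, ← pow_mul,
      add_sub_cancel_right]
    refine sum_mem fun k hk => Ideal.mul_mem_right _ _ (Ideal.pow_le_self ?_ (hc k))
    have := Finset.mem_range.1 hk
    omega
  · have h1 : Polynomial.aeval (LinearMap.lsmul A M (π ^ t)) p m = 0 := by rw [h0]; rfl
    rw [← h1, ← Polynomial.coe_aeval_eq_eval]
    have : (LinearMap.lsmul A M (π ^ t)) = Algebra.lsmul A A M (π ^ t) := rfl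
    rw [this, Polynomial.aeval_algHom_apply]
    rfl

lemma isSMulRegular_of_sub_pow_mem {Q : Type*} [CommRing Q] [IsLocalRing Q] [IsNoetherianRing Q]
    {xs : List Q} {π a : Q} (h : IsWeaklyRegular Q (xs ++ [π])) (hxs : ∀ x ∈ xs, x ∈ maximalIdeal Q)
    (N : ℕ) (ha : a - π ^ N ∈ Ideal.ofList xs) : IsSMulRegular Q a := by
  by_cases hu : a ∈ maximalIdeal Q
  · rw [isWeaklyRegular_append_iff, isWeaklyRegular_singleton_iff] at h
    have h2 : IsWeaklyRegular Q (xs ++ [a]) := by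
      rw [isWeaklyRegular_append_iff, isWeaklyRegular_singleton_iff]
      refine ⟨h.1, ?_⟩
      have hN := h.2.pow N
      rw [isSMulRegular_quotient_iff_mem_of_smul_mem] at hN ⊢
      intro x hx
      refine hN x ?_
      have : π ^ N • x = a • x - (a - π ^ N) • x := by rw [sub_smul]; abel
      rw [this]
      exact sub_mem hx (Submodule.smul_mem_smul ha trivial)
    have := IsLocalRing.isWeaklyRegular_of_perm_of_subset_maximalIdeal h2
      (List.perm_append_comm (l₁ := xs) (l₂ := [a])) (by simpa [or_imp, forall_and] using ⟨hxs, hu⟩)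
    rw [List.singleton_append, isWeaklyRegular_cons_iff] at this
    exact this.1
  · have : IsUnit a := by simpa using hu
    exact this.isSMulRegular Q

end Annihilator


section BaseChange

theorem isBaseChange_of_completion {A S Q M : Type u} [CommRing A] [CommRing S] [CommRing Q]
    [Algebra A S] [Algebra S Q] [Algebra A Q] [IsScalarTower A S Q] [IsLocalRing Q]
    {J : Ideal S} (hQ : CompletionData J Q) {I : Ideal A} [IsPrecomplete I A]
    (hI : I.map (algebraMap A Q) ≠ ⊤)
    [AddCommGroup M] [Module A M] [Module S M] [Module Q M] [IsScalarTower A S M]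
    [IsScalarTower S Q M] [IsScalarTower A Q M] [Module.Finite A M]
    (t : ℕ) (ht : ∀ j ∈ J ^ t, ∀ m : M, j • m ∈ (I • ⊤ : Submodule A M)) :
    IsBaseChange Q (LinearMap.id : M →ₗ[S] M) := by
  have := hQ.noetherian
  have : Module.Finite S M := Module.Finite.of_restrictScalars_finite A S M
  have hpow (n : ℕ) (q : Q) :
      ∃ s : S, q - algebraMap S Q s ∈ (J ^ n).map (algebraMap S Q) := by
    induction n generalizing q with
    | zero => exact ⟨0, by simp [Ideal.map_top]⟩
    | succ n ih =>
      obtain ⟨s, hs⟩ := ih q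
      obtain ⟨j, hj, hj'⟩ : ∃ j : S, j ∈ J ^ n ∧ (q - algebraMap S Q s) - algebraMap S Q j ∈
          (J ^ (n + 1)).map (algebraMap S Q) := by
        generalize q - algebraMap S Q s = q' at hs ⊢
        rw [Ideal.map] at hs
        induction hs using Submodule.span_induction with
        | mem x hx =>
          obtain ⟨j, hj, rfl⟩ := hx
          exact ⟨j, hj, by simp⟩
        | zero => exact ⟨0, zero_mem _, by simp⟩
        | add x y _ _ hx hy =>
          obtain ⟨a, ha, ha'⟩ := hx
          obtain ⟨b, hb, hb'⟩ := hy
          refine ⟨a + b, add_mem ha hb, ?_⟩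
          rw [map_add, add_sub_add_comm]
          exact add_mem ha' hb'
        | smul c x hx' hx =>
          obtain ⟨a, ha, ha'⟩ := hx
          obtain ⟨r, hr⟩ := hQ.surj c
          refine ⟨r * a, Ideal.mul_mem_left _ _ ha, ?_⟩
          have : c • x - algebraMap S Q (r * a) = c * (x - algebraMap S Q a) +
              (c - algebraMap S Q r) * algebraMap S Q a := by
            rw [map_mul, smul_eq_mul]; ring
          rw [this]
          refine add_mem (Ideal.mul_mem_left _ _ ha') ?_
          rw [pow_succ', Ideal.map_mul]
          exact Ideal.mul_mem_mul hr (Ideal.mem_map_of_mem _ ha)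
      refine ⟨s + j, ?_⟩
      rw [map_add, ← sub_sub]
      exact hj'
  let T := Q ⊗[S] M
  have : IsHausdorff I T := isHausdorff_of_map_ne_top (B := Q) hI
  let i : M →ₗ[A] T := (TensorProduct.mk S Q M 1).restrictScalars A
  have htop : (LinearMap.range i) ⊔ I • ⊤ = ⊤ := by
    rw [eq_top_iff]
    rintro x -
    induction x using TensorProduct.induction_on with
    | zero => exact zero_mem _
    | add x y hx hy => exact add_mem hx hy
    | tmul q m =>
      obtain ⟨s, hs⟩ := hpow t q
      have h1 : q ⊗ₜ[S] m = i (s • m) + (q - algebraMap S Q s) ⊗ₜ[S] m := by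
        simp only [i, LinearMap.restrictScalars_apply, TensorProduct.mk_apply,
          TensorProduct.tmul_smul, TensorProduct.sub_tmul, TensorProduct.smul_tmul',
          Algebra.algebraMap_eq_smul_one]
        abel
      rw [h1]
      refine Submodule.add_mem_sup ⟨_, rfl⟩ ?_
      generalize q - algebraMap S Q s = q' at hs
      clear h1
      rw [Ideal.map] at hs
      induction hs using Submodule.span_induction generalizing m with
      | mem x hx =>
        obtain ⟨j, hj, rfl⟩ := hx
        have : (algebraMap S Q j) ⊗ₜ[S] m = i (j • m) := by
          simp only [i, LinearMap.restrictScalars_apply, TensorProduct.mk_apply,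
            TensorProduct.tmul_smul, TensorProduct.smul_tmul', Algebra.algebraMap_eq_smul_one]
        rw [this]
        have := Submodule.mem_map_of_mem (f := i) (ht j hj m)
        rw [Submodule.map_smul''] at this
        exact Submodule.smul_mono le_rfl le_top this
      | zero => rw [TensorProduct.zero_tmul]; exact zero_mem _
      | add x y _ _ hx hy => rw [TensorProduct.add_tmul]; exact add_mem (hx m) (hy m)
      | smul c x hx' hx =>
        have h2 : (c • x) ⊗ₜ[S] m = c • (x ⊗ₜ[S] m) := by rw [TensorProduct.smul_tmul']
        have h3 := hx m
        have h4 : (I • ⊤ : Submodule A T) =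
            (I.map (algebraMap A Q) • (⊤ : Submodule Q T)).restrictScalars A := by
          rw [Ideal.smul_restrictScalars, Submodule.restrictScalars_top]
        rw [h2]
        rw [h4, Submodule.restrictScalars_mem] at h3 ⊢
        exact Submodule.smul_mem _ _ h3
  have hsurj : Function.Surjective i := LinearMap.range_eq_top.1
    (span_eq_top_of_isPrecomplete I _ (by
      rw [LinearMap.range_eq_map]; exact (Module.Finite.fg_top).map i) htop)
  let e : T →ₗ[Q] M := LinearMap.liftBaseChange Q (LinearMap.id : M →ₗ[S] M)
  have he (m : M) : e (i m) = m :=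
    (LinearMap.liftBaseChange_tmul Q (LinearMap.id : M →ₗ[S] M) 1 m).trans (one_smul Q m)
  have hbij : Function.Bijective e := by
    refine ⟨fun a b hab => ?_, fun m => ⟨i m, he m⟩⟩
    obtain ⟨a, rfl⟩ := hsurj a
    obtain ⟨b, rfl⟩ := hsurj b
    rw [he, he] at hab
    rw [hab]
  exact IsBaseChange.of_equiv (LinearEquiv.ofBijective e hbij) fun m => he m

end BaseChange


section HyperQuotient

open RingTheory.Sequence

lemma ringKrullDim_eq_length_of_isRegular {B : Type*} [CommRing B] [IsLocalRing B]
    [IsNoetherianRing B] {zs : List B} (h : IsRegular B zs) (t : ℕ)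
    (ht : maximalIdeal B ^ t ≤ Ideal.ofList zs) : ringKrullDim B = zs.length := by
  have hne : Ideal.ofList zs ≠ ⊤ := fun h0 => h.2 (by rw [h0]; simp)
  have : Nontrivial (B ⧸ Ideal.ofList zs) := Ideal.Quotient.nontrivial_iff.2 hne
  have h0 : ringKrullDim (B ⧸ Ideal.ofList zs) = 0 := by
    rw [← ringKrullDimZero_iff_ringKrullDim_eq_zero,
      Ideal.krullDimLE_zero_quotient_iff_forall_minimalPrimes_isMaximal]
    intro J hJ
    have hJp : J.IsPrime := hJ.1.1
    have : maximalIdeal B ≤ J := hJp.le_of_pow_le (ht.trans hJ.1.2)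
    rw [← (maximalIdeal.isMaximal B).eq_of_le hJp.ne_top this]
    exact maximalIdeal.isMaximal B
  rw [← ringKrullDim_add_length_eq_ringKrullDim_of_isRegular zs h, h0, zero_add]

lemma eq_closedPoint_of_mem_support {R M : Type*} [CommRing R] [IsLocalRing R] [AddCommGroup M]
    [Module R M] [Module.Finite R M] (t : ℕ) (h : ∀ r ∈ maximalIdeal R, ∀ x : M, r ^ t • x = 0)
    (p : PrimeSpectrum R) (hp : p ∈ Module.support R M) : p = closedPoint R := by
  rw [Module.mem_support_iff_of_finite] at hp
  have : maximalIdeal R ≤ p.asIdeal := fun r hr =>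
    p.2.mem_of_pow_mem t (hp (Module.mem_annihilator.2 (h r hr)))
  exact PrimeSpectrum.ext ((maximalIdeal.isMaximal R).eq_of_le p.2.ne_top this).symm

lemma exists_eq_span_singleton_of_projective {Q : Type*} [CommRing Q] [IsLocalRing Q]
    [IsNoetherianRing Q] (K : Ideal Q) (hK : K ≠ ⊥) [Module.Projective Q K] :
    ∃ f : Q, K = Ideal.span {f} ∧ IsSMulRegular Q f := by
  have := Module.free_of_flat_of_isLocalRing (R := Q) (P := K)
  let b := Module.Free.chooseBasis Q K
  have hsub : Subsingleton (Module.Free.ChooseBasisIndex Q K) := by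
    refine ⟨fun i j => ?_⟩
    by_contra hij
    have h1 : (b j : Q) • b i - (b i : Q) • b j = 0 := by
      ext
      simp [mul_comm]
    have h2 := congrArg (fun v => b.repr v i) h1
    have h3 : (b j : Q) = 0 := by
      simpa [Finsupp.single_apply, hij, Ne.symm hij] using h2
    exact b.ne_zero j (Subtype.ext h3)
  have : Nontrivial K := Submodule.nontrivial_iff_ne_bot.2 hK
  obtain ⟨i⟩ : Nonempty (Module.Free.ChooseBasisIndex Q K) := b.index_nonempty
  have : Unique (Module.Free.ChooseBasisIndex Q K) := ⟨⟨i⟩, fun j => Subsingleton.elim _ _⟩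
  refine ⟨b i, le_antisymm (fun x hx => ?_) ?_, ?_⟩
  · have := b.sum_repr ⟨x, hx⟩
    rw [Fintype.sum_unique] at this
    rw [Ideal.mem_span_singleton']
    refine ⟨b.repr ⟨x, hx⟩ i, ?_⟩
    have h := congrArg Subtype.val this
    rw [Subsingleton.elim default i] at h
    simpa using h
  · rw [Ideal.span_singleton_le_iff_mem]
    exact (b i).2
  · rw [isSMulRegular_iff_right_eq_zero_of_smul]
    intro x hx
    have h1 : x • b i = 0 := by
      ext
      simpa [mul_comm] using hx
    have h2 := congrArg (fun v => b.repr v i) h1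
    simpa using h2

theorem exists_isHyperQuotient {Q B : Type u} [CommRing Q] [CommRing B] [IsLocalRing Q]
    [IsLocalRing B] [IsNoetherianRing Q] [IsNoetherianRing B] [Algebra Q B]
    (hsurj : Function.Surjective (algebraMap Q B)) {rs : List Q} (hr : IsWeaklyRegular Q rs)
    (hm : Ideal.ofList rs = maximalIdeal Q) {zs : List B} (hz : IsWeaklyRegular B zs)
    (hzm : ∀ z ∈ zs, z ∈ maximalIdeal B) (t : ℕ) (ht : maximalIdeal B ^ t ≤ Ideal.ofList zs)
    (hlen : rs.length = zs.length + 1) : ∃ f : Q, IsHyperQuotient Q B f := by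
  have hrreg : IsRegular Q rs := isRegular_of_isWeaklyRegular_maximalIdeal hr
    fun r h => hm ▸ Ideal.subset_span h
  have hzreg : IsRegular B zs := isRegular_of_isWeaklyRegular_maximalIdeal hz hzm
  have : IsLocalHom (algebraMap Q B) := IsLocalHom.of_surjective _ hsurj
  have hmem (r : Q) : algebraMap Q B r ∈ maximalIdeal B ↔ r ∈ maximalIdeal Q := by
    simp only [mem_maximalIdeal, map_mem_nonunits_iff]
  have : Module.Finite Q B := Module.Finite.of_surjective (Algebra.linearMap Q B) hsurj
  obtain ⟨zs', rfl⟩ : ∃ zs' : List Q, zs'.map (algebraMap Q B) = zs := by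
    exact ⟨zs.map (Function.surjInv hsurj), by
      rw [List.map_map, (Function.rightInverse_surjInv hsurj).comp_eq_id, List.map_id]⟩
  have hk := hasProjectiveDimensionLT_residueField hrreg hm
  have hpd : HasProjectiveDimensionLE (ModuleCat.of Q B) 1 := by
    refine hasProjectiveDimensionLE_of_isWeaklyRegular (ModuleCat.of Q B) (rs := zs') ?_
      ((isWeaklyRegular_map_algebraMap_iff B B zs').1 hz) ?_ hk (by simpa [add_comm] using hlen)
    · intro r hr
      have := hzm _ (List.mem_map_of_mem hr)
      exact (hmem r).1 this
    · refine eq_closedPoint_of_mem_support t fun r hr x => ?_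
      induction x using Submodule.Quotient.induction_on with
      | _ x =>
      rw [← Submodule.Quotient.mk_smul, Submodule.Quotient.mk_eq_zero]
      have h1 : algebraMap Q B r ^ t ∈ Ideal.ofList (zs'.map (algebraMap Q B)) :=
        ht (Ideal.pow_mem_pow ((hmem r).2 hr) t)
      rw [← Ideal.map_ofList] at h1
      have h2 : (r ^ t • x : B) ∈ (Ideal.ofList zs').map (algebraMap Q B) • (⊤ : Submodule B B) := by
        rw [show (r ^ t • x : B) = (x : B) • algebraMap Q B r ^ t by
          rw [Algebra.smul_def, map_pow, smul_eq_mul, mul_comm], smul_eq_mul, Ideal.mul_top]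
        exact Submodule.smul_mem _ _ h1
      rw [← Submodule.restrictScalars_mem Q, Ideal.smul_restrictScalars] at h2
      simpa using h2
  let K := RingHom.ker (algebraMap Q B)
  have hex : Function.Exact (Submodule.subtype K) (Algebra.linearMap Q B) := by
    rw [LinearMap.exact_iff, Submodule.range_subtype]
    rfl
  have hses := sesOf_shortExact hex K.injective_subtype hsurj
  have hproj : Module.Projective Q K := by
    have h1 : HasProjectiveDimensionLT (sesOf hex).X₂ 1 := by
      rw [← projective_iff_hasProjectiveDimensionLT_one]
      exact (IsProjective.iff_projective Q).1 (inferInstanceAs (Module.Projective Q Q))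
    have h2 := hses.hasProjectiveDimensionLT_X₁ 1 h1 hpd
    rw [← projective_iff_hasProjectiveDimensionLT_one] at h2
    exact (IsProjective.iff_projective K).2 h2
  have hK : K ≠ ⊥ := by
    intro h0
    have e : Q ≃+* B := RingEquiv.ofBijective (algebraMap Q B)
      ⟨(RingHom.injective_iff_ker_eq_bot _).2 h0, hsurj⟩
    have h1 := ringKrullDim_eq_length_of_isRegular hrreg 1 (by rw [pow_one, hm])
    have h2 := ringKrullDim_eq_length_of_isRegular hzreg t ht
    rw [ringKrullDim_eq_of_ringEquiv e, h2, hlen] at h1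
    norm_cast at h1
    omega
  obtain ⟨f, hf, hreg⟩ := exists_eq_span_singleton_of_projective K hK
  exact ⟨f, hsurj, hf, hreg⟩

end HyperQuotient


section Coordinates

open RingTheory.Sequence

lemma eq_closedPoint_of_mem_support_quotient {R M : Type*} [CommRing R] [IsLocalRing R]
    [AddCommGroup M] [Module R M] [Module.Finite R M] (I : Ideal R) (t : ℕ)
    (h : ∀ r ∈ maximalIdeal R, ∀ x : M, r ^ t • x ∈ (I • ⊤ : Submodule R M))
    (p : PrimeSpectrum R) (hp : p ∈ Module.support R (M ⧸ I • (⊤ : Submodule R M))) :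
    p = closedPoint R := by
  refine eq_closedPoint_of_mem_support t (fun r hr x => ?_) p hp
  induction x using Submodule.Quotient.induction_on with
  | _ x =>
  rw [← Submodule.Quotient.mk_smul, Submodule.Quotient.mk_eq_zero]
  exact h r hr x

lemma mem_ofList_map_smul_top {A B M : Type*} [CommRing A] [CommRing B] [Algebra A B]
    [AddCommGroup M] [Module A M] [Module B M] [IsScalarTower A B M] (xs : List A) (x : M) :
    x ∈ (Ideal.ofList (xs.map (algebraMap A B)) • ⊤ : Submodule B M) ↔
      x ∈ (Ideal.ofList xs • ⊤ : Submodule A M) := by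
  rw [← Ideal.map_ofList, ← Submodule.restrictScalars_mem A, Ideal.smul_restrictScalars,
    Submodule.restrictScalars_top]

theorem rigid_of_tower {A Q B M σ : Type u} [CommRing A] [CommRing Q] [CommRing B]
    [Fintype σ] [Algebra (MvPolynomial σ A) Q] [Algebra A Q]
    [IsScalarTower A (MvPolynomial σ A) Q] [Algebra Q B] [Algebra A B] [IsScalarTower A Q B]
    [IsLocalRing B] [IsNoetherianRing B] [IsAdicComplete (maximalIdeal B) B]
    [AddCommGroup M] [Module B M] [Module Q M] [Module (MvPolynomial σ A) M] [Module A M]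
    [IsScalarTower Q B M] [IsScalarTower (MvPolynomial σ A) Q M]
    [IsScalarTower A (MvPolynomial σ A) M] [IsScalarTower A B M] [IsScalarTower A Q M]
    [Module.Finite B M] [Nontrivial M]
    {I : Ideal A} [IsAdicComplete I A] (hAB : ResidueData I (algebraMap A B))
    {J : Ideal (MvPolynomial σ A)} (hJ : J = MvPolynomial.idealOfVars σ A ⊔ I.map MvPolynomial.C)
    (hQ : CompletionData J Q)
    (hQB : ResidueData (J.map (algebraMap (MvPolynomial σ A) Q)) (algebraMap Q B))
    (hm : (J.map (algebraMap (MvPolynomial σ A) Q)).map (algebraMap Q B) = maximalIdeal B)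
    {xs : List A} {π : A} (hI : Ideal.ofList (xs ++ [π]) = I) (hA : IsWeaklyRegular A (xs ++ [π]))
    (hxs : IsWeaklyRegular M xs) (t : ℕ)
    (ht : maximalIdeal B ^ t • ⊤ ≤ (Ideal.ofList (xs.map (algebraMap A B)) • ⊤ : Submodule B M))
    {zs : List B} (hz : IsWeaklyRegular B zs) (hzm : ∀ z ∈ zs, z ∈ maximalIdeal B) (t' : ℕ)
    (ht' : maximalIdeal B ^ t' ≤ Ideal.ofList zs) (hlen : zs.length = xs.length + Fintype.card σ)
    {g₁ g : ℕ} (hg₁ : ∀ l, g₁ < l →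
      Subsingleton (Abelian.Ext (ModuleCat.of B M) (ModuleCat.of B (ResidueField B)) l))
    (hg : ¬ Subsingleton (Abelian.Ext (ModuleCat.of B M) (ModuleCat.of B (ResidueField B)) g))
    (N : ModuleCat.{u} B) [Module.Finite B N] {n : ℕ} (hn : n < g)
    (h : Subsingleton (Abelian.Ext (ModuleCat.of B M) N n)) :
    ∀ l ≤ n, Subsingleton (Abelian.Ext (ModuleCat.of B M) N l) := by
  classical
  have := hQ.noetherian
  have := hQ.flat
  have := hQ.complete
  have : IsLocalRing Q := hQB.isLocalRing
  have hmQ : maximalIdeal Q = J.map (algebraMap _ Q) := hQB.maximalIdeal_eq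
  have hsurj : Function.Surjective (algebraMap Q B) := by
    have : IsHausdorff ((J.map (algebraMap _ Q)).map (algebraMap Q B)) B := by
      rw [hm]; infer_instance
    refine surjective_of_mk_map_comp_surjective _ (I := J.map (algebraMap _ Q)) fun b => ?_
    obtain ⟨b, rfl⟩ := Ideal.Quotient.mk_surjective b
    obtain ⟨q, hq⟩ := hQB.surj b
    refine ⟨q, ?_⟩
    rw [RingHom.comp_apply, eq_comm, Ideal.Quotient.eq, hm]
    exact hq
  have hQBm (q : Q) (hq : q ∈ maximalIdeal Q) : algebraMap Q B q ∈ maximalIdeal B := by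
    rw [hmQ] at hq
    exact (hQB.mem_iff q).2 hq
  have hAQ : (MvPolynomial.C : A →+* MvPolynomial σ A) = algebraMap A _ := rfl
  have hIQ : I.map (algebraMap A Q) ≤ maximalIdeal Q := by
    rw [hmQ, IsScalarTower.algebraMap_eq A (MvPolynomial σ A) Q, ← Ideal.map_map]
    exact Ideal.map_mono (hJ ▸ le_sup_right)
  have hImem (a : A) (ha : a ∈ I) : algebraMap A Q a ∈ maximalIdeal Q :=
    hIQ (Ideal.mem_map_of_mem _ ha)
  have hxsI (a : A) (ha : a ∈ xs ++ [π]) : a ∈ I := hI ▸ Ideal.subset_span ha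
  have hkey (b : B) (hb : b ∈ maximalIdeal B ^ t) (m : M) :
      b • m ∈ (Ideal.ofList xs • ⊤ : Submodule A M) :=
    (mem_ofList_map_smul_top (B := B) xs _).1 (ht (Submodule.smul_mem_smul hb trivial))
  have hXI : Ideal.ofList xs ≤ I := hI ▸ Ideal.span_mono fun a ha => List.mem_append_left _ ha
  have hfin : Module.Finite A M := by
    refine hAB.finite t (ht.trans (Submodule.smul_mono ?_ le_rfl))
    rw [← Ideal.map_ofList]
    exact Ideal.map_mono hXI
  have hfinQ : Module.Finite Q M := Module.Finite.of_restrictScalars_finite A Q M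
  obtain ⟨a, e, hae, haM⟩ := exists_annihilator_of_pow_smul_mem (M := M) (Ideal.ofList xs) π t
    fun m => by
      rw [← algebraMap_smul B (π ^ t) m, map_pow]
      exact hkey _ (Ideal.pow_mem_pow ((hAB.mem_iff _).2 (hxsI π (by simp))) _) _
  have hflatA : Module.Flat A Q := Module.Flat.trans A (MvPolynomial σ A) Q
  have haQ : IsSMulRegular Q (algebraMap (MvPolynomial σ A) Q (MvPolynomial.C a)) := by
    rw [hAQ, ← IsScalarTower.algebraMap_apply]
    have h1 := IsWeaklyRegular.of_flat (S := Q) hA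
    rw [List.map_append, List.map_singleton] at h1
    refine isSMulRegular_of_sub_pow_mem h1 ?_ e ?_
    · intro x hx
      obtain ⟨y, hy, rfl⟩ := List.mem_map.1 hx
      exact hImem y (hXI (Ideal.subset_span hy))
    · rw [← map_pow, ← map_sub, ← Ideal.map_ofList]
      exact Ideal.mem_map_of_mem _ hae
  have hM : IsBaseChange Q (LinearMap.id : M →ₗ[MvPolynomial σ A] M) := by
    refine isBaseChange_of_completion hQ (I := I) (fun h0 => ?_) t fun j hj m => ?_
    · rw [h0, top_le_iff] at hIQ
      exact Ideal.IsPrime.ne_top' hIQ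
    · rw [← algebraMap_smul Q j m, ← algebraMap_smul B (algebraMap _ Q j) m]
      refine Submodule.smul_mono hXI le_rfl (hkey _ ?_ m)
      rw [← hm, ← Ideal.map_pow, ← Ideal.map_pow]
      exact Ideal.mem_map_of_mem _ (Ideal.mem_map_of_mem _ hj)
  let rs : List Q := (((Finset.univ : Finset σ).toList.map MvPolynomial.X ++
    (xs ++ [π]).map MvPolynomial.C).map (algebraMap (MvPolynomial σ A) Q))
  have hrs : IsWeaklyRegular Q rs := IsWeaklyRegular.of_flat
    (isWeaklyRegular_mvPolynomial _ (Finset.nodup_toList _) (by simp) hA)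
  have hrsm : Ideal.ofList rs = maximalIdeal Q := by
    rw [hmQ, hJ, ← Ideal.map_ofList, Ideal.ofList_append, ofList_map_X _ (by simp),
      ← Ideal.map_ofList, hI]
  have hrsl : rs.length = Fintype.card σ + (xs.length + 1) := by simp [rs]
  obtain ⟨f, H⟩ := exists_isHyperQuotient hsurj hrs hrsm hz hzm t' ht' (by omega)
  have hrsm' : ∀ r ∈ rs, r ∈ maximalIdeal Q := fun r hr => hrsm ▸ Ideal.subset_span hr
  have hxsQ : ∀ r ∈ xs.map (algebraMap A Q), r ∈ maximalIdeal Q := by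
    intro x hx
    obtain ⟨y, hy, rfl⟩ := List.mem_map.1 hx
    exact hImem y (hXI (Ideal.subset_span hy))
  have hxsM : IsWeaklyRegular M (xs.map (algebraMap A Q)) :=
    (isWeaklyRegular_map_algebraMap_iff Q M xs).2 hxs
  have hsupp : ∀ p ∈ Module.support Q (M ⧸ Ideal.ofList (xs.map (algebraMap A Q)) •
      (⊤ : Submodule Q M)), p = closedPoint Q := by
    refine eq_closedPoint_of_mem_support_quotient _ t fun r hr x => ?_
    rw [mem_ofList_map_smul_top, ← algebraMap_smul B (r ^ t) x, map_pow]
    exact hkey _ (Ideal.pow_mem_pow (hQBm r hr) t) x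
  have hvan : ∀ l ≤ Fintype.card σ,
      Subsingleton (Abelian.Ext (ModuleCat.of Q M) (ModuleCat.of Q Q) l) := fun l hl =>
    subsingleton_ext_ring (ModuleCat.of Q M) hxsQ hxsM hsupp hrsm' hrs l
      (by rw [hrsl, List.length_map]; omega)
  have hpd : HasProjectiveDimensionLE (ModuleCat.of Q M) (Fintype.card σ + 1) :=
    hasProjectiveDimensionLE_of_isWeaklyRegular (ModuleCat.of Q M) hxsQ hxsM hsupp
      (hasProjectiveDimensionLT_residueField
        (isRegular_of_isWeaklyRegular_maximalIdeal hrs hrsm') hrsm)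
      (by rw [hrsl, List.length_map]; omega)
  have hgc : g ≤ Fintype.card σ := by
    by_contra hlt
    exact hg (subsingleton_ext_of_hyperQuotient H _ hpd _ hg₁ g (by omega))
  exact rigid_of_hyperQuotient hM a haM haQ H hvan N (by omega) h

/-- Extension of a ring homomorphism to a power series ring. -/
lemma exists_powerSeries_lift {V B τ : Type u} [CommRing V] [IsNoetherianRing V] [CommRing B]
    [IsLocalRing B] [IsAdicComplete (maximalIdeal B) B] [Finite τ] {I : Ideal V}
    {φ : V →+* B} (hφ : ResidueData I φ) (x : τ → B) (hx : ∀ i, x i ∈ maximalIdeal B) :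
    ∃ (A : Type u) (_ : CommRing A) (_ : Algebra (MvPolynomial τ V) A) (ψ : A →+* B),
      CompletionData (MvPolynomial.idealOfVars τ V ⊔ I.map MvPolynomial.C) A ∧
      ψ.comp (algebraMap (MvPolynomial τ V) A) = MvPolynomial.eval₂Hom φ x ∧
      ResidueData ((MvPolynomial.idealOfVars τ V ⊔ I.map MvPolynomial.C).map
        (algebraMap (MvPolynomial τ V) A)) ψ := by
  have hA := completionData_adicCompletion (MvPolynomial.idealOfVars τ V ⊔ I.map MvPolynomial.C)
  have h1 := hφ.mvPolynomial x hx
  obtain ⟨ψ, hψ⟩ := hA.lift B (maximalIdeal B) _ h1.map_le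
  exact ⟨_, _, _, ψ, hA, hψ, h1.completion hA ψ hψ⟩

theorem rigid_of_coordinates {V B M σ τ : Type u} [CommRing V] [IsNoetherianRing V] [CommRing B]
    [IsLocalRing B] [IsNoetherianRing B] [IsAdicComplete (maximalIdeal B) B]
    [AddCommGroup M] [Module B M] [Module.Finite B M] [Nontrivial M] [Fintype σ] [Fintype τ]
    {φ : V →+* B} {π : V} (hπ : IsSMulRegular V π) (hφ : ResidueData (Ideal.span {π}) φ)
    (x : τ → B) (y : σ → B)
    (hm : Ideal.span (Set.range y) ⊔ (Ideal.span (Set.range x) ⊔ Ideal.span {φ π}) =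
      maximalIdeal B)
    {l : List τ} (hl : l.Nodup) (hl' : ∀ i, i ∈ l) (hx : IsWeaklyRegular M (l.map x)) (t : ℕ)
    (ht : maximalIdeal B ^ t • ⊤ ≤ (Ideal.ofList (l.map x) • ⊤ : Submodule B M))
    {zs : List B} (hz : IsWeaklyRegular B zs) (hzm : ∀ z ∈ zs, z ∈ maximalIdeal B) (t' : ℕ)
    (ht' : maximalIdeal B ^ t' ≤ Ideal.ofList zs)
    (hlen : zs.length = Fintype.card τ + Fintype.card σ)
    {g₁ g : ℕ} (hg₁ : ∀ l, g₁ < l →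
      Subsingleton (Abelian.Ext (ModuleCat.of B M) (ModuleCat.of B (ResidueField B)) l))
    (hg : ¬ Subsingleton (Abelian.Ext (ModuleCat.of B M) (ModuleCat.of B (ResidueField B)) g))
    (N : ModuleCat.{u} B) [Module.Finite B N] {n : ℕ} (hn : n < g)
    (h : Subsingleton (Abelian.Ext (ModuleCat.of B M) N n)) :
    ∀ l ≤ n, Subsingleton (Abelian.Ext (ModuleCat.of B M) N l) := by
  classical
  have hym (i : σ) : y i ∈ maximalIdeal B :=
    hm ▸ Ideal.mem_sup_left (Ideal.subset_span ⟨i, rfl⟩)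
  have hxm (i : τ) : x i ∈ maximalIdeal B :=
    hm ▸ Ideal.mem_sup_right (Ideal.mem_sup_left (Ideal.subset_span ⟨i, rfl⟩))
  obtain ⟨A, _, _, ψA, hA, hψA, hAB⟩ := exists_powerSeries_lift hφ x hxm
  set I := (MvPolynomial.idealOfVars τ V ⊔ (Ideal.span {π}).map MvPolynomial.C).map
    (algebraMap (MvPolynomial τ V) A) with hI
  have := hA.noetherian
  have := hA.flat
  have hIA : IsAdicComplete I A := hA.complete
  obtain ⟨Q, _, _, ψQ, hQ, hψQ, hQB⟩ := exists_powerSeries_lift hAB y hym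
  let _ : Algebra A B := ψA.toAlgebra
  let _ : Algebra Q B := ψQ.toAlgebra
  let _ : Algebra A Q := ((algebraMap (MvPolynomial σ A) Q).comp MvPolynomial.C).toAlgebra
  let _ : Module A M := Module.compHom M ψA
  let _ : Module Q M := Module.compHom M ψQ
  let _ : Module (MvPolynomial σ A) M :=
    Module.compHom M (algebraMap (MvPolynomial σ A) Q)
  have : IsScalarTower A (MvPolynomial σ A) Q := IsScalarTower.of_algebraMap_eq fun _ => rfl
  have hψQ' (p : MvPolynomial σ A) : ψQ (algebraMap (MvPolynomial σ A) Q p) =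
      MvPolynomial.eval₂Hom ψA y p := RingHom.congr_fun hψQ p
  have hψA' (p : MvPolynomial τ V) : ψA (algebraMap (MvPolynomial τ V) A p) =
      MvPolynomial.eval₂Hom φ x p := RingHom.congr_fun hψA p
  have : IsScalarTower A Q B := IsScalarTower.of_algebraMap_eq fun a => by
    change ψA a = ψQ (algebraMap (MvPolynomial σ A) Q (MvPolynomial.C a))
    rw [hψQ', MvPolynomial.coe_eval₂Hom, MvPolynomial.eval₂_C]
  have : IsScalarTower Q B M := IsScalarTower.of_algebraMap_smul fun _ _ => rfl
  have : IsScalarTower (MvPolynomial σ A) Q M := IsScalarTower.of_algebraMap_smul fun _ _ => rfl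
  have : IsScalarTower A B M := IsScalarTower.of_algebraMap_smul fun _ _ => rfl
  have : IsScalarTower A Q M := IsScalarTower.of_algebraMap_smul fun a m => by
    change ψQ (algebraMap A Q a) • m = ψA a • m
    congr 1
    exact (IsScalarTower.algebraMap_apply A Q B a).symm
  have : IsScalarTower A (MvPolynomial σ A) M := IsScalarTower.of_algebraMap_smul fun a m => by
    change algebraMap A Q a • m = a • m
    exact algebraMap_smul Q a m
  let xs : List A := l.map fun i => algebraMap (MvPolynomial τ V) A (MvPolynomial.X i)
  let π' : A := algebraMap (MvPolynomial τ V) A (MvPolynomial.C π)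
  have hxs : xs.map (algebraMap A B) = l.map x := by
    rw [List.map_map]
    congr 1
    ext i
    exact (hψA' _).trans (by simp)
  have hlist : xs ++ [π'] = (l.map MvPolynomial.X ++ [π].map MvPolynomial.C).map
      (algebraMap (MvPolynomial τ V) A) := by
    simp [xs, π']
  refine rigid_of_tower (A := A) (Q := Q) (σ := σ) (xs := xs) (π := π') hAB rfl hQ hQB ?_ ?_ ?_ ?_
    t ?_ hz hzm t' ht' ?_ hg₁ hg N hn h
  · rw [Ideal.map_sup, Ideal.map_sup, ← hm, Ideal.map_map, Ideal.map_map]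
    have e1 : (MvPolynomial.idealOfVars σ A).map
        ((algebraMap Q B).comp (algebraMap (MvPolynomial σ A) Q)) = Ideal.span (Set.range y) := by
      rw [MvPolynomial.idealOfVars, Ideal.map_span, ← Set.range_comp]
      congr 2
      ext i
      exact (hψQ' _).trans (by simp)
    have e2 : (I.map MvPolynomial.C).map
        ((algebraMap Q B).comp (algebraMap (MvPolynomial σ A) Q)) =
        Ideal.span (Set.range x) ⊔ Ideal.span {φ π} := by
      have : ((algebraMap Q B).comp (algebraMap (MvPolynomial σ A) Q)).comp MvPolynomial.C =
          ψA := by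
        ext a
        exact (hψQ' _).trans (by simp)
      rw [Ideal.map_map, this, hI, Ideal.map_map, hψA, Ideal.map_sup, MvPolynomial.idealOfVars,
        Ideal.map_span, ← Set.range_comp, Ideal.map_map, Ideal.map_span, Set.image_singleton]
      have h1 : (MvPolynomial.eval₂Hom φ x) ∘ MvPolynomial.X = x := by
        ext i
        simp
      have h2 : (MvPolynomial.eval₂Hom φ x).comp MvPolynomial.C π = φ π := by simp
      rw [h1, h2]
    rw [e1, e2]
  · rw [hlist, ← Ideal.map_ofList, Ideal.ofList_append, ofList_map_X _ hl', ← Ideal.map_ofList,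
      Ideal.ofList_singleton]
  · rw [hlist]
    exact IsWeaklyRegular.of_flat (isWeaklyRegular_mvPolynomial _ hl hl'
      ((isWeaklyRegular_singleton_iff V π).2 hπ))
  · rw [← isWeaklyRegular_map_algebraMap_iff B M xs, hxs]
    exact hx
  · rw [hxs]
    exact ht
  · rw [hlen, List.length_map, ← Finset.card_univ, ← List.toFinset_card_of_nodup hl]
    congr 2
    ext i
    simp [hl']

end Coordinates


section Avoidance

open RingTheory.Sequence Abelian

/-- Prime avoidance for a coset of an ideal. -/
lemma exists_add_notMem_of_forall_not_le {R : Type*} [CommRing R] (J : Ideal R) (g : R)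
    (s : Finset (Ideal R)) (hp : ∀ P ∈ s, P.IsPrime) (h : ∀ P ∈ s, ¬ Ideal.span {g} ⊔ J ≤ P) :
    ∃ a ∈ J, ∀ P ∈ s, g + a ∉ P := by
  classical
  induction hn : s.card generalizing s with
  | zero => exact ⟨0, zero_mem _, by simp [Finset.card_eq_zero.1 hn]⟩
  | succ n ih =>
    obtain ⟨P, hP⟩ := s.exists_minimal (Finset.card_pos.1 (by omega))
    have hPs := hP.prop
    obtain ⟨a, haJ, ha⟩ := ih (s.erase P) (fun Q hQ => hp Q (Finset.mem_of_mem_erase hQ))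
      (fun Q hQ => h Q (Finset.mem_of_mem_erase hQ)) (by rw [Finset.card_erase_of_mem hPs, hn]; rfl)
    have hPp := hp P hPs
    by_cases hga : g + a ∈ P
    · have hJ : ¬ J ≤ P := fun hJP => h P hPs (sup_le (by
        rw [Ideal.span_singleton_le_iff_mem]
        simpa using sub_mem hga (hJP haJ)) hJP)
      have hprod : ¬ J * ∏ Q ∈ s.erase P, Q ≤ P := by
        rw [hPp.mul_le, hPp.prod_le]
        rintro (h1 | ⟨Q, hQ, hQP⟩)
        · exact hJ h1
        · have := hP.le_of_le (Finset.mem_of_mem_erase hQ) hQP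
          exact (Finset.ne_of_mem_erase hQ) (le_antisymm hQP this)
      obtain ⟨b, hb, hbP⟩ := SetLike.not_le_iff_exists.1 hprod
      have hbJ : b ∈ J ∧ b ∈ ∏ Q ∈ s.erase P, Q := Ideal.mul_le_inf hb
      refine ⟨a + b, add_mem haJ hbJ.1, fun Q hQ hmem => ?_⟩
      by_cases hQP : Q = P
      · subst hQP
        exact hbP (by simpa [← add_assoc] using Q.sub_mem hmem hga)
      · have hQe : Q ∈ s.erase P := Finset.mem_erase_of_ne_of_mem hQP hQ
        have hle := Ideal.prod_le_inf.trans (Finset.inf_le (f := fun I : Ideal R => I) hQe)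
        have hbQ : b ∈ Q := hle hbJ.2
        exact ha Q hQe
          (by simpa [← add_assoc] using Q.sub_mem hmem hbQ)
    · refine ⟨a, haJ, fun Q hQ => ?_⟩
      by_cases hQP : Q = P
      · exact hQP ▸ hga
      · exact ha Q (Finset.mem_erase_of_ne_of_mem hQP hQ)

lemma exists_isSMulRegular_add {R : Type*} [CommRing R] [IsNoetherianRing R] {M : Type*}
    [AddCommGroup M] [Module R M] [Module.Finite R M] (J : Ideal R) (g : R)
    (h : ∃ r ∈ Ideal.span {g} ⊔ J, IsSMulRegular M r) : ∃ a ∈ J, IsSMulRegular M (g + a) := by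
  obtain ⟨r, hr, hreg⟩ := h
  have key (x : R) : IsSMulRegular M x ↔ ∀ P ∈ associatedPrimes R M, x ∉ P := by
    have := biUnion_associatedPrimes_eq_compl_regular R M
    have h2 := Set.ext_iff.1 this x
    simp only [Set.mem_iUnion, Set.mem_compl_iff, Set.mem_ofPred_eq, SetLike.mem_coe] at h2
    rw [← not_iff_not, ← h2]
    push Not
    simp
  obtain ⟨a, ha, h⟩ := exists_add_notMem_of_forall_not_le J g
    (associatedPrimes.finite R M).toFinset (fun P hP => ((Set.Finite.mem_toFinset _).1 hP).isPrime)
    (fun P hP hle => (key r).1 hreg P ((Set.Finite.mem_toFinset _).1 hP) (hle hr))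
  exact ⟨a, ha, (key _).2 fun P hP => h P ((Set.Finite.mem_toFinset _).2 hP)⟩

variable {R : Type u} [CommRing R]

lemma subsingleton_ext_X₃ (X : ModuleCat.{u} R) {S : ShortComplex (ModuleCat.{u} R)}
    (hS : S.ShortExact) (n : ℕ) (h₂ : Subsingleton (Ext X S.X₂ n))
    (h₁ : Subsingleton (Ext X S.X₁ (n + 1))) : Subsingleton (Ext X S.X₃ n) := by
  refine subsingleton_of_forall_eq 0 fun e => ?_
  obtain ⟨y, rfl⟩ := Ext.covariant_sequence_exact₃ X hS e rfl (h₁.elim _ _)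
  rw [h₂.elim y 0, Ext.zero_comp]

variable [IsLocalRing R] [IsNoetherianRing R]

lemma exists_isSMulRegular_of_subsingleton_ext (M : ModuleCat.{u} R) [Module.Finite R M]
    (h : Subsingleton (Ext (ModuleCat.of R (ResidueField R)) M 0)) :
    ∃ r ∈ maximalIdeal R, IsSMulRegular M r := by
  have h1 : Subsingleton (ModuleCat.of R (ResidueField R) ⟶ M) :=
    Ext.homEquiv₀.symm.injective.subsingleton
  have h2 : Subsingleton (ResidueField R →ₗ[R] M) :=
    (ModuleCat.homEquiv (M := ModuleCat.of R (ResidueField R)) (N := M)).symm.injective.subsingleton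
  obtain ⟨r, hr, hreg⟩ := IsSMulRegular.subsingleton_linearMap_iff.1 h2
  refine ⟨r, ?_, hreg⟩
  have : Module.annihilator R (R ⧸ maximalIdeal R) = maximalIdeal R := Ideal.annihilator_quotient
  rw [← this]
  exact hr

theorem exists_isWeaklyRegular_coordinates (s c : ℕ) (M : ModuleCat.{u} R) [Module.Finite R M]
    (h : ∀ j < s, Subsingleton (Ext (ModuleCat.of R (ResidueField R)) M j)) (J : Ideal R)
    (gs : List R) (hgs : gs.length = s + c) (hJ : J ⊔ Ideal.ofList gs = maximalIdeal R) :
    ∃ xs ys : List R, xs.length = s ∧ ys.length = c ∧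
      J ⊔ Ideal.ofList xs ⊔ Ideal.ofList ys = maximalIdeal R ∧ IsWeaklyRegular M xs := by
  induction s generalizing M J gs with
  | zero => exact ⟨[], gs, rfl, by omega, by simpa using hJ, IsWeaklyRegular.nil R M⟩
  | succ s ih =>
    match gs, hgs with
    | [], hgs => rw [List.length_nil] at hgs; omega
    | g :: gs, hgs =>
      rw [Ideal.ofList_cons] at hJ
      obtain ⟨a, ha, hreg⟩ := exists_isSMulRegular_add (M := M) (J ⊔ Ideal.ofList gs) g (by
        obtain ⟨r, hr, h'⟩ := exists_isSMulRegular_of_subsingleton_ext M (h 0 (by omega))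
        exact ⟨r, by rwa [sup_left_comm, hJ], h'⟩)
      obtain ⟨xs, ys, hxs, hys, hxy, hw⟩ := ih (ModuleCat.of R (QuotSMulTop (g + a) M))
        (fun j hj => subsingleton_ext_X₃ _ hreg.smulShortComplex_shortExact j (h j (by omega))
          (h (j + 1) (by omega))) (J ⊔ Ideal.span {g + a}) gs
        (by rw [List.length_cons] at hgs; omega) (by
          refine le_antisymm (sup_le (sup_le (le_sup_left.trans hJ.le) ?_)
            ((le_sup_right.trans le_sup_right).trans hJ.le)) ?_
          · rw [Ideal.span_singleton_le_iff_mem, ← hJ, sup_left_comm]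
            exact Submodule.add_mem_sup (Ideal.mem_span_singleton_self g) ha
          · rw [← hJ]
            refine sup_le (le_sup_left.trans le_sup_left) (sup_le ?_ le_sup_right)
            rw [Ideal.span_singleton_le_iff_mem]
            have h1 : a ∈ J ⊔ Ideal.span {g + a} ⊔ Ideal.ofList gs :=
              (show J ⊔ Ideal.ofList gs ≤ J ⊔ Ideal.span {g + a} ⊔ Ideal.ofList gs from
                sup_le_sup_right le_sup_left _) ha
            have h2 : g + a ∈ J ⊔ Ideal.span {g + a} ⊔ Ideal.ofList gs :=
              Ideal.mem_sup_left (Ideal.mem_sup_right (Ideal.mem_span_singleton_self _))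
            simpa using sub_mem h2 h1)
      refine ⟨(g + a) :: xs, ys, by rw [List.length_cons, hxs], hys, ?_, ?_⟩
      · rw [Ideal.ofList_cons, ← hxy]
        simp only [sup_assoc]
      · exact (isWeaklyRegular_cons_iff M (g + a) xs).2 ⟨hreg, hw⟩

lemma exists_pow_smul_top_le_of_supportDim {M : Type u} [AddCommGroup M] [Module R M]
    [Module.Finite R M] [Nontrivial M] {xs : List R} (hx : IsWeaklyRegular M xs)
    (hxm : ∀ x ∈ xs, x ∈ maximalIdeal R) (hd : Module.supportDim R M = xs.length) :
    ∃ t, maximalIdeal R ^ t • ⊤ ≤ (Ideal.ofList xs • ⊤ : Submodule R M) := by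
  have hreg : IsRegular M xs :=
    (isRegular_iff_isWeaklyRegular_of_subset_maximalIdeal hxm).2 hx
  have h1 := Module.supportDim_add_length_eq_supportDim_of_isRegular xs hreg
  rw [hd] at h1
  have hnt : Nontrivial (M ⧸ (Ideal.ofList xs • ⊤ : Submodule R M)) :=
    Submodule.Quotient.nontrivial_iff.2 hreg.2.symm
  have h2 : Module.supportDim R (M ⧸ (Ideal.ofList xs • ⊤ : Submodule R M)) = 0 := by
    obtain ⟨e, he⟩ : ∃ e : ℕ∞, Module.supportDim R (M ⧸ (Ideal.ofList xs • ⊤ : Submodule R M)) = e := by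
      have := Module.supportDim_ne_bot_of_nontrivial R (M ⧸ (Ideal.ofList xs • ⊤ : Submodule R M))
      exact ⟨_, (WithBot.coe_unbot _ this).symm⟩
    rw [he] at h1 ⊢
    have h3 : e + (xs.length : ℕ∞) = 0 + (xs.length : ℕ∞) := by
      rw [zero_add]; exact_mod_cast h1
    have h4 := (WithTop.add_right_inj (ENat.natCast_ne_top _)).1 h3
    rw [h4]; rfl
  rw [Module.supportDim_eq_ringKrullDim_quotient_annihilator] at h2
  set I := Module.annihilator R (M ⧸ (Ideal.ofList xs • ⊤ : Submodule R M)) with hI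
  have : Nontrivial (R ⧸ I) := by
    rw [Ideal.Quotient.nontrivial_iff, hI, ne_eq, Module.annihilator_eq_top_iff]
    exact not_subsingleton _
  rw [← ringKrullDimZero_iff_ringKrullDim_eq_zero,
      Ideal.krullDimLE_zero_quotient_iff_forall_minimalPrimes_isMaximal] at h2
  have hrad : maximalIdeal R ≤ I.radical := by
    rw [← Ideal.sInf_minimalPrimes]
    exact le_sInf fun P hP => (IsLocalRing.eq_maximalIdeal (h2 P hP)).ge
  obtain ⟨t, ht⟩ := Ideal.exists_pow_le_of_le_radical_of_fg hrad (Ideal.fg_of_isNoetherianRing _)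
  refine ⟨t, Submodule.smul_le.2 fun r hr m _ => ?_⟩
  rw [← Submodule.Quotient.mk_eq_zero, Submodule.Quotient.mk_smul]
  exact Module.mem_annihilator.1 (ht hr) _

end Avoidance


section CoefficientRing

open Polynomial

lemma exists_maximal_subring {W : Type*} [CommRing W] (I : Ideal W) (K : Set W)
    {T₀ U : Subring W} (h₀ : T₀ ≤ U) (hK : ∀ t ∈ T₀, t ∈ I → t ∈ K) :
    ∃ T : Subring W, T₀ ≤ T ∧ T ≤ U ∧ (∀ t ∈ T, t ∈ I → t ∈ K) ∧
      ∀ t ∈ U, (∀ f : T[X], f.eval₂ T.subtype t ∈ I → f.eval₂ T.subtype t ∈ K) → t ∈ T := by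
  obtain ⟨T, hT, hmax⟩ := zorn_le_nonempty₀
    {T : Subring W | T ≤ U ∧ ∀ t ∈ T, t ∈ I → t ∈ K} (fun c hc hchain y hy => by
      refine ⟨sSup c, ⟨sSup_le fun z hz => (hc hz).1, fun t ht => ?_⟩, fun z hz => le_sSup hz⟩
      obtain ⟨z, hz, htz⟩ := (Subring.mem_sSup_of_directedOn ⟨y, hy⟩ hchain.directedOn).1 ht
      exact (hc hz).2 t htz) T₀ ⟨h₀, hK⟩
  refine ⟨T, hT, hmax.prop.1, hmax.prop.2, fun t ht hf => ?_⟩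
  have hle : T ≤ (eval₂RingHom T.subtype t).range := fun s hs => ⟨C ⟨s, hs⟩, by simp⟩
  refine hmax.le_of_ge (y := (eval₂RingHom T.subtype t).range) ⟨?_, ?_⟩ hle ⟨X, by simp⟩
  · rintro _ ⟨f, rfl⟩
    rw [coe_eval₂RingHom, eval₂_eq_sum_range]
    exact sum_mem fun i _ => mul_mem (hmax.prop.1 (f.coeff i).2) (pow_mem ht i)
  · rintro _ ⟨f, rfl⟩ h
    exact hf f h

variable {W : Type u} [CommRing W] [IsLocalRing W]

/-- A subring `V` of a local ring `W` with `V ∩ m = p V` that surjects onto the residue field and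
is closed under inverses. -/
structure IsCoefficientSubring (V : Subring W) (p : W) : Prop where
  exists_mul : ∀ v ∈ V, v ∈ maximalIdeal W → ∃ u ∈ V, v = p * u
  exists_sub_mem : ∀ w : W, ∃ v ∈ V, w - v ∈ maximalIdeal W
  inv_mem : ∀ v ∈ V, ∀ w, v * w = 1 → w ∈ V

/-- In residue characteristic zero, a complete local ring contains a coefficient field. -/
theorem exists_isCoefficientSubring_of_charZero [IsAdicComplete (maximalIdeal W) W]
    (h : ∀ n : ℕ, n ≠ 0 → (n : W) ∉ maximalIdeal W) :
    ∃ V : Subring W, IsCoefficientSubring V 0 := by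
  obtain ⟨T, -, -, hT, hmax⟩ := exists_maximal_subring (maximalIdeal W) {0}
    (T₀ := (Int.castRingHom W).range) (U := ⊤) le_top (by
      rintro _ ⟨n, rfl⟩ hn
      by_contra h0
      have hn0 : n ≠ 0 := by rintro rfl; simp at h0
      refine h n.natAbs (by simpa using hn0) ?_
      obtain h1 | h1 := Int.natAbs_eq n
      · rw [h1] at hn; simpa using hn
      · rw [h1] at hn; simpa using hn)
  have hinv : ∀ v ∈ T, ∀ w, v * w = 1 → w ∈ T := by
    refine fun v hv w hvw => hmax w trivial fun f hf => ?_
    have key : ∀ f : T[X], ∃ N, v ^ N * f.eval₂ T.subtype w ∈ T := by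
      intro f
      refine ⟨f.natDegree, ?_⟩
      rw [eval₂_eq_sum_range, Finset.mul_sum]
      refine sum_mem fun i hi => ?_
      obtain ⟨j, hj⟩ := Nat.exists_eq_add_of_le (Nat.lt_succ_iff.1 (Finset.mem_range.1 hi))
      have : v ^ f.natDegree * (T.subtype (f.coeff i) * w ^ i) =
          T.subtype (f.coeff i) * v ^ j * (v * w) ^ i := by rw [hj]; ring
      rw [this, hvw, one_pow, mul_one]
      exact mul_mem (f.coeff i).2 (pow_mem hv j)
    obtain ⟨N, hN⟩ := key f
    have h0 : v ^ N * f.eval₂ T.subtype w = 0 := hT _ hN (Ideal.mul_mem_left _ _ hf)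
    have : f.eval₂ T.subtype w = (v * w) ^ N * f.eval₂ T.subtype w := by rw [hvw]; simp
    rw [Set.mem_singleton_iff, this, mul_pow, mul_right_comm, h0, zero_mul]
  have hfield : IsField T := by
    refine ⟨⟨0, 1, zero_ne_one⟩, mul_comm, fun {a} ha => ?_⟩
    have hu : IsUnit (a : W) := by
      by_contra hna
      exact ha (Subtype.ext (hT a a.2 ((mem_maximalIdeal _).2 hna)))
    obtain ⟨w, hw⟩ := hu.exists_right_inv
    exact ⟨⟨w, hinv a a.2 w hw⟩, Subtype.ext hw⟩
  let _ : Field T := hfield.toField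
  let _ : Algebra T (ResidueField W) := ((residue W).comp T.subtype).toAlgebra
  have hchar : CharZero T := by
    refine charZero_of_inj_zero fun n hn => ?_
    by_contra h0
    have : (n : W) = 0 := congrArg Subtype.val hn
    exact h n h0 (by rw [this]; exact zero_mem _)
  have haeval (t : W) (f : T[X]) : aeval (residue W t) f = residue W (f.eval₂ T.subtype t) := by
    rw [aeval_def, hom_eval₂]; rfl
  have hlift (α : ResidueField W) : ∃ t : W, residue W t = α ∧
      ∀ f : T[X], aeval α f = 0 → f.eval₂ T.subtype t = 0 := by
    obtain ⟨t, rfl⟩ := residue_surjective α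
    by_cases hα : IsIntegral T (residue W t)
    · have hsep : (minpoly T (residue W t)).Separable := (minpoly.irreducible hα).separable
      have : HenselianRing W (maximalIdeal W) := inferInstance
      obtain ⟨a, ha, hat⟩ := this.is_henselian ((minpoly T (residue W t)).map T.subtype)
        ((minpoly.monic hα).map _) t (by
          rw [Polynomial.eval_map, ← residue_eq_zero_iff, ← haeval, minpoly.aeval]) (by
          rw [derivative_map, Polynomial.eval_map]
          refine IsUnit.mk0 (G₀ := ResidueField W) _ ?_
          exact (haeval t _).symm.trans_ne
            (hsep.aeval_derivative_ne_zero (minpoly.aeval _ _)))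
      refine ⟨a, ?_, fun f hf => ?_⟩
      · rw [← sub_eq_zero, ← map_sub, residue_eq_zero_iff]; exact hat
      · obtain ⟨g, rfl⟩ := minpoly.dvd T _ hf
        rw [eval₂_mul, ← Polynomial.eval_map, ha, zero_mul]
    · refine ⟨t, rfl, fun f hf => ?_⟩
      by_cases hf0 : f = 0
      · simp [hf0]
      · exact absurd (isAlgebraic_iff_isIntegral.1 ⟨f, hf0, hf⟩) hα
  refine ⟨T, ⟨fun v hv hvm => ⟨0, zero_mem _, by simpa using hT v hv hvm⟩, fun w => ?_, hinv⟩⟩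
  obtain ⟨t, ht, ht'⟩ := hlift (residue W w)
  refine ⟨t, hmax t trivial fun f hf => ht' f ?_, ?_⟩
  · rw [← ht, haeval, residue_eq_zero_iff]; exact hf
  · rw [← residue_eq_zero_iff, map_sub, ht, sub_self]

/-- A subring approximating a coefficient subring modulo the `n`-th power of the maximal ideal. -/
structure IsApproxCoefficientSubring (U : Subring W) (p : W) (n : ℕ) : Prop where
  mem_of_mem_pow : ∀ z ∈ maximalIdeal W ^ n, z ∈ U
  exists_mul : ∀ u ∈ U, u ∈ maximalIdeal W → ∃ v ∈ U, u - p * v ∈ maximalIdeal W ^ n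
  exists_sub_mem : ∀ w : W, ∃ u ∈ U, w - u ∈ maximalIdeal W

/-- The subring of elements that are `p`-th powers of elements of `U`, modulo `p U + J`. -/
def frobeniusSubring (U : Subring W) {p : ℕ} (hp : p.Prime) (J : Ideal W) :
    Subring W where
  carrier := {w | ∃ x ∈ U, ∃ y ∈ U, ∃ z ∈ J, w = x ^ p + p * y + z}
  one_mem' := ⟨1, one_mem _, 0, zero_mem _, 0, zero_mem _, by simp⟩
  zero_mem' := ⟨0, zero_mem _, 0, zero_mem _, 0, zero_mem _, by simp [hp.ne_zero]⟩
  add_mem' := by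
    rintro _ _ ⟨x, hx, y, hy, z, hz, rfl⟩ ⟨x', hx', y', hy', z', hz', rfl⟩
    obtain ⟨r, hr⟩ := exists_add_pow_prime_eq hp (⟨x, hx⟩ : U) ⟨x', hx'⟩
    have hr' : (x + x') ^ p = x ^ p + x' ^ p + p * x * x' * r := by
      simpa using congrArg U.subtype hr
    refine ⟨x + x', add_mem hx hx', y + y' - x * x' * r,
      sub_mem (add_mem hy hy') (mul_mem (mul_mem hx hx') r.2), z + z', add_mem hz hz', ?_⟩
    rw [hr']; ring
  mul_mem' := by
    rintro _ _ ⟨x, hx, y, hy, z, hz, rfl⟩ ⟨x', hx', y', hy', z', hz', rfl⟩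
    refine ⟨x * x', mul_mem hx hx', x ^ p * y' + y * (x' ^ p + p * y'),
      add_mem (mul_mem (pow_mem hx p) hy') (mul_mem hy (add_mem (pow_mem hx' p)
        (mul_mem (natCast_mem _ _) hy'))), z * (x' ^ p + p * y' + z') + (x ^ p + p * y) * z',
      add_mem (Ideal.mul_mem_right _ _ hz) (Ideal.mul_mem_left _ _ hz'), ?_⟩
    ring
  neg_mem' := by
    rintro _ ⟨x, hx, y, hy, z, hz, rfl⟩
    obtain ⟨r, hr⟩ := exists_add_pow_prime_eq hp (⟨x, hx⟩ : U) ⟨-x, neg_mem hx⟩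
    have hr' : (x + -x) ^ p = x ^ p + (-x) ^ p + p * x * (-x) * r := by
      simpa using congrArg U.subtype hr
    rw [add_neg_cancel, zero_pow hp.ne_zero] at hr'
    refine ⟨-x, neg_mem hx, x * (-x) * r - y,
      sub_mem (mul_mem (mul_mem hx (neg_mem hx)) r.2) hy, -z, neg_mem hz, ?_⟩
    linear_combination hr'

lemma IsApproxCoefficientSubring.exists_succ {U : Subring W} {p : ℕ} (hp : p.Prime)
    (hpm : (p : W) ∈ maximalIdeal W) {n : ℕ} (hn : n ≠ 0)
    (hU : IsApproxCoefficientSubring U (p : W) n) :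
    ∃ T ≤ U, IsApproxCoefficientSubring T (p : W) (n + 1) ∧
      ∀ u ∈ U, ∃ t ∈ T, u - t ∈ maximalIdeal W ^ n := by
  have hle : maximalIdeal W ^ (n + 1) ≤ maximalIdeal W ^ n := Ideal.pow_le_pow_right (by omega)
  obtain ⟨T, hT₀, hTU, hT, hmax⟩ := exists_maximal_subring (maximalIdeal W)
    {w | ∃ v ∈ U, w - p * v ∈ maximalIdeal W ^ (n + 1)}
    (T₀ := frobeniusSubring U hp (maximalIdeal W ^ (n + 1))) (U := U) (by
      rintro _ ⟨x, hx, y, hy, z, hz, rfl⟩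
      exact add_mem (add_mem (pow_mem hx p) (mul_mem (natCast_mem _ _) hy))
        (hU.mem_of_mem_pow z (hle hz))) (by
      rintro _ ⟨x, hx, y, hy, z, hz, rfl⟩ hmem
      have hxm : x ∈ maximalIdeal W := by
        have h1 : x ^ p ∈ maximalIdeal W := by
          have h2 := sub_mem (sub_mem hmem (Ideal.pow_le_self (by omega) hz))
            (Ideal.mul_mem_right y _ hpm)
          simpa using h2
        exact (maximalIdeal.isMaximal W).isPrime.mem_of_pow_mem p h1
      obtain ⟨v, hv, hz'⟩ := hU.exists_mul x hx hxm
      obtain ⟨r, hr⟩ := exists_add_pow_prime_eq hp (⟨p * v, mul_mem (natCast_mem _ _) hv⟩ : U)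
        ⟨x - p * v, hU.mem_of_mem_pow _ hz'⟩
      have hr' : (p * v + (x - p * v)) ^ p =
          (p * v) ^ p + (x - p * v) ^ p + p * (p * v) * (x - p * v) * r := by
        simpa using congrArg U.subtype hr
      rw [add_sub_cancel] at hr'
      obtain ⟨q, rfl⟩ : ∃ q, p = q + 1 := ⟨p - 1, (Nat.succ_pred hp.ne_zero).symm⟩
      refine ⟨(((q + 1 : ℕ) : W) * v) ^ q * v + ((q + 1 : ℕ) : W) * v *
          (x - ((q + 1 : ℕ) : W) * v) * r + y, add_mem (add_mem (mul_mem (pow_mem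
            (mul_mem (natCast_mem _ _) hv) _) hv) (mul_mem (mul_mem
              (mul_mem (natCast_mem _ _) hv) (hU.mem_of_mem_pow _ hz')) r.2)) hy, ?_⟩
      have h3 : (x - ((q + 1 : ℕ) : W) * v) ^ (q + 1) ∈ maximalIdeal W ^ (n + 1) := by
        have h4 := Ideal.pow_mem_pow hz' (q + 1)
        rw [← pow_mul] at h4
        refine Ideal.pow_le_pow_right ?_ h4
        have := hp.two_le
        calc n + 1 ≤ n * 2 := by omega
          _ ≤ n * (q + 1) := Nat.mul_le_mul_left _ this
      have h5 := add_mem h3 hz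
      convert h5 using 1
      rw [hr']
      ring)
  have hpow : ∀ x ∈ U, x ^ p ∈ T := fun x hx =>
    hT₀ ⟨x, hx, 0, zero_mem _, 0, zero_mem _, by simp⟩
  have hmul : ∀ y ∈ U, (p : W) * y ∈ T := fun y hy =>
    hT₀ ⟨0, zero_mem _, y, hy, 0, zero_mem _, by simp [hp.ne_zero]⟩
  have hmem : ∀ z ∈ maximalIdeal W ^ (n + 1), z ∈ T := fun z hz =>
    hT₀ ⟨0, zero_mem _, 0, zero_mem _, z, hz, by simp [hp.ne_zero]⟩
  let F : Subfield (ResidueField W) :=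
    { ((residue W).comp T.subtype).range with
      inv_mem' := by
        rintro _ ⟨c, rfl⟩
        generalize hx : ((residue W).comp T.subtype) c = x
        by_cases hx0 : x = 0
        · rw [hx0, inv_zero]; exact zero_mem ((residue W).comp T.subtype).range
        obtain ⟨w, hw⟩ := residue_surjective x⁻¹
        obtain ⟨d, hd, hwd⟩ := hU.exists_sub_mem w
        have hd' : residue W d = x⁻¹ := by
          rw [← hw, eq_comm, ← sub_eq_zero, ← map_sub, residue_eq_zero_iff]; exact hwd
        refine ⟨c ^ (p - 1) * ⟨d ^ p, hpow d hd⟩, ?_⟩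
        rw [map_mul, map_pow, hx]
        change x ^ (p - 1) * residue W (d ^ p) = x⁻¹
        obtain ⟨q, rfl⟩ : ∃ q, p = q + 1 := ⟨p - 1, (Nat.succ_pred hp.ne_zero).symm⟩
        rw [map_pow, hd', Nat.add_sub_cancel, pow_succ, ← mul_assoc, ← mul_pow,
          mul_inv_cancel₀ hx0, one_pow, one_mul] }
  let ψ : T →+* F := ((residue W).comp T.subtype).codRestrict F fun c => ⟨c, rfl⟩
  have hψ (c : T) : ((ψ c : F) : ResidueField W) = residue W c := rfl
  have hsurj : ∀ w : W, ∃ v ∈ T, w - v ∈ maximalIdeal W := by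
    intro w
    by_contra! hw
    obtain ⟨t, ht, hwt⟩ := hU.exists_sub_mem w
    refine hw t (hmax t ht fun f hf => ?_) hwt
    have hα : residue W t ∉ F := by
      rintro ⟨c, hc⟩
      refine hw c c.2 ?_
      rw [← sub_add_sub_cancel w t c]
      refine add_mem hwt ?_
      rw [← residue_eq_zero_iff, map_sub, ← hc]
      exact sub_self _
    let a : T := ⟨t ^ p, hpow t ht⟩
    have hmon : (X ^ p - C a : T[X]).Monic := monic_X_pow_sub_C a hp.ne_zero
    have hfr : f.eval₂ T.subtype t = (f %ₘ (X ^ p - C a)).eval₂ T.subtype t := by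
      conv_lhs => rw [← modByMonic_add_div f (X ^ p - C a)]
      simp [eval₂_add, eval₂_mul, a]
    have hchar : ((p : ℕ) : ResidueField W) = 0 := by
      rw [← map_natCast (residue W), residue_eq_zero_iff]; exact hpm
    have hcp : CharP (ResidueField W) p := by
      obtain ⟨q, hq⟩ := CharP.exists (ResidueField W)
      have h1 : q ∣ p := (CharP.cast_eq_zero_iff _ q p).1 hchar
      rcases (Nat.dvd_prime hp).1 h1 with rfl | rfl
      · exact absurd rfl (CharP.char_ne_one (ResidueField W) 1)
      · exact hq
    have hfact : Fact p.Prime := ⟨hp⟩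
    have hirr : Irreducible (X ^ p - C (ψ a) : F[X]) := by
      refine X_pow_sub_C_irreducible_of_prime hp fun b hb => hα ?_
      have h1 : (b : ResidueField W) ^ p = (residue W t) ^ p := by
        rw [← map_pow]; exact congrArg Subtype.val hb
      have h2 : (b : ResidueField W) = residue W t := by
        rw [← sub_eq_zero, ← pow_eq_zero_iff hp.ne_zero, sub_pow_char, h1, sub_self]
      rw [← h2]; exact b.2
    have hmin := minpoly.eq_of_irreducible_of_monic (x := residue W t) hirr (by
      simp only [map_sub, map_pow, aeval_X, aeval_C]
      rw [sub_eq_zero, ← map_pow]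
      rfl) (monic_X_pow_sub_C _ hp.ne_zero)
    have hzero : (f %ₘ (X ^ p - C a)).map ψ = 0 := by
      by_contra h0
      have h1 := minpoly.degree_le_of_ne_zero F (residue W t) h0 (by
        rw [aeval_def, eval₂_map]
        change eval₂ ((residue W).comp T.subtype) (residue W t) _ = 0
        rw [← hom_eval₂, ← hfr, residue_eq_zero_iff]
        exact hf)
      rw [← hmin, degree_X_pow_sub_C hp.pos] at h1
      have h2 := (degree_map_le (f := ψ) (p := f %ₘ (X ^ p - C a))).trans_lt
        (degree_modByMonic_lt f hmon)
      rw [degree_X_pow_sub_C hp.pos] at h2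
      exact absurd (h1.trans_lt h2) (lt_irrefl _)
    rw [hfr, eval₂_eq_sum_range]
    have hc (i : ℕ) : ∃ v ∈ U, T.subtype ((f %ₘ (X ^ p - C a)).coeff i) - p * v ∈
        maximalIdeal W ^ (n + 1) := by
      refine hT _ (Subtype.mem _) ?_
      rw [← residue_eq_zero_iff]
      have := congrArg (fun g : F[X] => ((g.coeff i : F) : ResidueField W)) hzero
      simpa [coeff_map, hψ] using this
    choose v hvU hv using hc
    refine ⟨∑ i ∈ Finset.range ((f %ₘ (X ^ p - C a)).natDegree + 1), v i * t ^ i,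
      sum_mem fun i _ => mul_mem (hvU i) (pow_mem ht i), ?_⟩
    rw [Finset.mul_sum, ← Finset.sum_sub_distrib]
    refine sum_mem fun i _ => ?_
    rw [← mul_assoc, ← sub_mul]
    exact Ideal.mul_mem_right _ _ (hv i)
  have happrox : ∀ u ∈ U, ∃ t ∈ T, u - t ∈ maximalIdeal W ^ n := by
    intro u hu
    obtain ⟨t, ht, hut⟩ := hsurj u
    obtain ⟨v, hv, hv'⟩ := hU.exists_mul (u - t) (sub_mem hu (hTU ht)) hut
    exact ⟨t + p * v, add_mem ht (hmul v hv), by rwa [← sub_sub]⟩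
  refine ⟨T, hTU, ⟨hmem, fun u hu hum => ?_, hsurj⟩, happrox⟩
  obtain ⟨v, hv, huv⟩ := hT u hu hum
  obtain ⟨t, ht, hvt⟩ := happrox v hv
  refine ⟨t, ht, ?_⟩
  have h1 : (p : W) * (v - t) ∈ maximalIdeal W ^ (n + 1) := by
    rw [pow_succ']; exact Ideal.mul_mem_mul hpm hvt
  have := add_mem huv h1
  rwa [mul_sub, sub_add_sub_cancel] at this

end CoefficientRing


section CoefficientRingExistence

lemma exists_sub_mem_pow {W : Type*} [CommRing W] (I : Ideal W) [IsPrecomplete I W] {u : ℕ → W}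
    (h : ∀ n, u (n + 1) - u n ∈ I ^ n) : ∃ L, ∀ n, L - u n ∈ I ^ n := by
  have hc (m : ℕ) (k : ℕ) : u (m + k) - u m ∈ I ^ m := by
    induction k with
    | zero => simp
    | succ k ih =>
      have := add_mem (Ideal.pow_le_pow_right (Nat.le_add_right m k) (h (m + k))) ih
      rwa [sub_add_sub_cancel] at this
  obtain ⟨L, hL⟩ := IsPrecomplete.prec (I := I) inferInstance (f := u) (fun {m n} hmn => by
    obtain ⟨k, rfl⟩ := Nat.exists_eq_add_of_le hmn
    rw [SModEq.sub_mem, smul_eq_mul, Ideal.mul_top, ← neg_sub]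
    exact neg_mem (hc m k))
  refine ⟨L, fun n => ?_⟩
  have := hL n
  rw [SModEq.sub_mem, smul_eq_mul, Ideal.mul_top, ← neg_sub] at this
  exact neg_mem_iff.1 this

lemma eq_zero_of_forall_mem_pow {W : Type*} [CommRing W] (I : Ideal W) [IsHausdorff I W] {w : W}
    (h : ∀ n, w ∈ I ^ n) : w = 0 :=
  IsHausdorff.haus (I := I) inferInstance w fun n => by
    rw [SModEq.sub_mem, smul_eq_mul, Ideal.mul_top, sub_zero]
    exact h n

variable {W : Type u} [CommRing W] [IsLocalRing W] [IsNoetherianRing W]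
  [IsAdicComplete (maximalIdeal W) W]

omit [IsNoetherianRing W] in
lemma IsCoefficientSubring.of_iInf {p : W} (U : ℕ → Subring W)
    (hU : ∀ n, IsApproxCoefficientSubring (U n) p (n + 1))
    (hstep : ∀ n, ∀ u ∈ U n, ∃ t ∈ U (n + 1), u - t ∈ maximalIdeal W ^ (n + 1))
    (hmul : ∀ v ∈ ⨅ n, U n, v ∈ maximalIdeal W → ∃ u ∈ ⨅ n, U n, v = p * u) :
    IsCoefficientSubring (⨅ n, U n) p := by
  refine ⟨hmul, fun w => ?_, fun v hv w hvw => ?_⟩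
  · obtain ⟨u₀, hu₀, hw⟩ := (hU 0).exists_sub_mem w
    choose t ht ht' using hstep
    obtain ⟨s, hs0, hs⟩ : ∃ s : ∀ n, U n, (s 0 : W) = u₀ ∧
        ∀ n, (s (n + 1) : W) - (s n).1 ∈ maximalIdeal W ^ (n + 1) := by
      refine ⟨fun n => Nat.rec ⟨u₀, hu₀⟩ (fun n x => ⟨t n x x.2, ht n x x.2⟩) n, rfl, fun n => ?_⟩
      rw [← neg_sub]; exact neg_mem (ht' n _ (Subtype.mem _))
    obtain ⟨L, hL⟩ := exists_sub_mem_pow (maximalIdeal W) (u := fun n => (s n).1)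
      (fun n => Ideal.pow_le_pow_right (Nat.le_succ n) (hs n))
    have hL' (n : ℕ) : L - (s n).1 ∈ maximalIdeal W ^ (n + 1) := by
      have := add_mem (hL (n + 1)) (hs n)
      rwa [sub_add_sub_cancel] at this
    refine ⟨L, Subring.mem_iInf.2 fun n => ?_, ?_⟩
    · rw [← sub_add_cancel L (s n).1]
      exact add_mem ((hU n).mem_of_mem_pow _ (hL' n)) (s n).2
    · have h1 : L - u₀ ∈ maximalIdeal W := by simpa [hs0] using hL' 0
      have := sub_mem hw h1
      rwa [sub_sub_sub_cancel_right] at this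
  · refine Subring.mem_iInf.2 fun n => ?_
    have hvn : v ∈ U n := Subring.mem_iInf.1 hv n
    obtain ⟨u, hu, hwu⟩ := (hU n).exists_sub_mem w
    have hz : 1 - u * v ∈ maximalIdeal W := by
      rw [← hvw, mul_comm v w, ← sub_mul]; exact Ideal.mul_mem_right _ _ hwu
    have hzU : 1 - u * v ∈ U n := sub_mem (one_mem _) (mul_mem hu hvn)
    have hgeom := geom_sum_mul_neg (1 - u * v) (n + 1)
    have hw : w = u * (∑ i ∈ Finset.range (n + 1), (1 - u * v) ^ i) + w * (1 - u * v) ^ (n + 1) := by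
      linear_combination (-w) * hgeom + (∑ i ∈ Finset.range (n + 1), (1 - u * v) ^ i) * u * hvw
    rw [hw]
    exact add_mem (mul_mem hu (sum_mem fun i _ => pow_mem hzU i))
      ((hU n).mem_of_mem_pow _ (Ideal.mul_mem_left _ _ (Ideal.pow_mem_pow hz _)))

/-- Coefficient rings of complete Noetherian local rings of positive residue characteristic. -/
theorem exists_isCoefficientSubring_of_prime {p : ℕ} (hp : p.Prime)
    (hpm : (p : W) ∈ maximalIdeal W) (h : (p : W) = 0 ∨ IsSMulRegular W (p : W)) :
    ∃ V : Subring W, IsCoefficientSubring V (p : W) := by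
  have hstep (n : ℕ) (U : {U : Subring W // IsApproxCoefficientSubring U (p : W) (n + 1)}) :
      ∃ T : {U : Subring W // IsApproxCoefficientSubring U (p : W) (n + 1 + 1)}, T.1 ≤ U.1 ∧
        ∀ u ∈ U.1, ∃ t ∈ T.1, u - t ∈ maximalIdeal W ^ (n + 1) := by
    obtain ⟨T, hT, hT', hT''⟩ := U.2.exists_succ hp hpm (Nat.succ_ne_zero n)
    exact ⟨⟨T, hT'⟩, hT, hT''⟩
  choose g hg hg' using hstep
  let U : ∀ n : ℕ, {U : Subring W // IsApproxCoefficientSubring U (p : W) (n + 1)} := fun n =>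
    Nat.rec ⟨⊤, ⟨fun _ _ => trivial, fun u _ hu => ⟨0, zero_mem _, by simpa using hu⟩,
      fun w => ⟨w, trivial, by simp⟩⟩⟩ g n
  have hanti : Antitone fun n => (U n).1 := antitone_nat_of_succ_le fun n => hg n (U n)
  refine ⟨_, IsCoefficientSubring.of_iInf (fun n => (U n).1) (fun n => (U n).2)
    (fun n => hg' n (U n)) fun v hv hvm => ?_⟩
  have hex (n : ℕ) := (U n).2.exists_mul v (Subring.mem_iInf.1 hv n) hvm
  choose u hu huv using hex
  obtain h0 | hreg := h
  · refine ⟨0, zero_mem _, ?_⟩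
    rw [mul_zero]
    refine eq_zero_of_forall_mem_pow (maximalIdeal W) fun n => ?_
    have := huv n
    rw [h0, zero_mul, sub_zero] at this
    exact Ideal.pow_le_pow_right (Nat.le_succ n) this
  obtain ⟨c, hc⟩ := Ideal.exists_pow_inf_eq_pow_smul (maximalIdeal W) (Ideal.span {(p : W)})
  have hcauchy (n : ℕ) : u (n + c + 1) - u (n + c) ∈ maximalIdeal W ^ (n + 1) := by
    have h1 : (p : W) * (u (n + c + 1) - u (n + c)) ∈ maximalIdeal W ^ (n + c + 1) := by
      have := sub_mem (huv (n + c)) (Ideal.pow_le_pow_right (Nat.le_succ _) (huv (n + c + 1)))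
      rwa [sub_sub_sub_cancel_left, ← mul_sub] at this
    have h2 : (p : W) * (u (n + c + 1) - u (n + c)) ∈
        maximalIdeal W ^ (n + c + 1) • (⊤ : Ideal W) ⊓ Ideal.span {(p : W)} :=
      ⟨by rw [smul_eq_mul, Ideal.mul_top]; exact h1, Ideal.mul_mem_right _ _
        (Ideal.mem_span_singleton_self _)⟩
    rw [hc (n + c + 1) (by omega), show n + c + 1 - c = n + 1 by omega] at h2
    have h3 : maximalIdeal W ^ (n + 1) • (maximalIdeal W ^ c • (⊤ : Ideal W) ⊓ Ideal.span {(p : W)}) ≤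
        maximalIdeal W ^ (n + 1) * Ideal.span {(p : W)} := Ideal.mul_mono_right inf_le_right
    obtain ⟨d, hd, hd'⟩ := Ideal.mem_mul_span_singleton.1 (h3 h2)
    rw [mul_comm] at hd'
    rwa [← hreg hd']
  obtain ⟨L, hL⟩ := exists_sub_mem_pow (maximalIdeal W) (u := fun n => u (n + c)) (fun n => by
    have := Ideal.pow_le_pow_right (Nat.le_succ n) (hcauchy n)
    rwa [add_right_comm] at this)
  have hL' (n : ℕ) : L - u (n + c) ∈ maximalIdeal W ^ (n + 1) := by
    have h1 := hcauchy n
    rw [add_right_comm] at h1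
    have := add_mem (hL (n + 1)) h1
    rwa [sub_add_sub_cancel] at this
  refine ⟨L, Subring.mem_iInf.2 fun n => ?_, ?_⟩
  · rw [← sub_add_cancel L (u (n + c))]
    exact add_mem ((U n).2.mem_of_mem_pow _ (hL' n)) (hanti (Nat.le_add_right n c) (hu (n + c)))
  · rw [← sub_eq_zero]
    refine eq_zero_of_forall_mem_pow (maximalIdeal W) fun n => ?_
    have h1 := Ideal.pow_le_pow_right (show n ≤ n + c + 1 by omega) (huv (n + c))
    have h2 := Ideal.pow_le_pow_right (Nat.le_succ n) (Ideal.mul_mem_left _ (p : W) (hL' n))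
    have := sub_mem h1 h2
    rwa [mul_sub, sub_sub_sub_cancel_right] at this

omit [IsNoetherianRing W] in
lemma IsCoefficientSubring.isNoetherianRing {V : Subring W} {p : W} (hpV : p ∈ V)
    (hpm : p ∈ maximalIdeal W) (hV : IsCoefficientSubring V p) : IsNoetherianRing V := by
  have key (v : V) (hv : v ≠ 0) : ∃ (k : ℕ) (w : V), IsUnit w ∧ v = ⟨p, hpV⟩ ^ k * w := by
    classical
    have hex : ∃ k, ¬ ∃ u : V, v = ⟨p, hpV⟩ ^ k * u := by
      by_contra! hall
      refine hv (Subtype.ext (eq_zero_of_forall_mem_pow (maximalIdeal W) fun n => ?_))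
      obtain ⟨u, hu⟩ := hall n
      rw [hu]
      exact Ideal.mul_mem_right _ _ (Ideal.pow_mem_pow hpm n)
    obtain ⟨k, hk⟩ : ∃ k, Nat.find hex = k + 1 :=
      Nat.exists_eq_succ_of_ne_zero fun h0 => Nat.find_spec hex (by rw [h0]; exact ⟨v, by simp⟩)
    obtain ⟨u, hu⟩ := not_not.1 (Nat.find_min hex (m := k) (by omega))
    refine ⟨k, u, ?_, hu⟩
    have hum : (u : W) ∉ maximalIdeal W := by
      intro hum
      obtain ⟨w, hw, huw⟩ := hV.exists_mul u u.2 hum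
      refine Nat.find_spec hex ?_
      rw [hk]
      refine ⟨⟨w, hw⟩, ?_⟩
      rw [hu, pow_succ, mul_assoc]
      congr 1
      exact Subtype.ext huw
    obtain ⟨w, hw⟩ := (notMem_maximalIdeal.1 hum).exists_right_inv
    exact IsUnit.of_mul_eq_one ⟨w, hV.inv_mem u u.2 w hw⟩ (Subtype.ext hw)
  refine ⟨fun I => ?_⟩
  by_cases hI : I = ⊥
  · rw [hI]; exact Submodule.fg_bot
  classical
  have hex : ∃ k, (⟨p, hpV⟩ : V) ^ k ∈ I := by
    obtain ⟨v, hv, hv0⟩ := Submodule.exists_mem_ne_zero_of_ne_bot hI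
    obtain ⟨k, w, hw, rfl⟩ := key v hv0
    exact ⟨k, (Ideal.mul_unit_mem_iff_mem I hw).1 hv⟩
  refine ⟨{(⟨p, hpV⟩ : V) ^ Nat.find hex}, ?_⟩
  rw [Finset.coe_singleton]
  refine le_antisymm ((Ideal.span_singleton_le_iff_mem I).2 (Nat.find_spec hex)) fun v hv => ?_
  by_cases hv0 : v = 0
  · rw [hv0]; exact zero_mem _
  obtain ⟨k, w, hw, rfl⟩ := key v hv0
  exact Ideal.mem_span_singleton.2 (dvd_mul_of_dvd_left (pow_dvd_pow _
    (Nat.find_min' hex ((Ideal.mul_unit_mem_iff_mem I hw).1 hv))) _)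

/-- A complete equicharacteristic Noetherian local ring receives a local map from a polynomial ring
in one variable over a coefficient field, with the variable mapping to any given element. -/
theorem exists_residueData_of_equalChar {p : ℕ} (hp : ∀ n : ℕ, (n : W) ∈ maximalIdeal W ↔ p ∣ n)
    (h0 : (p : W) = 0) (w : W) (hw : w ∈ maximalIdeal W) :
    ∃ (V : Type u) (_ : CommRing V) (_ : IsNoetherianRing V) (π : V) (φ : V →+* W),
      IsSMulRegular V π ∧ ResidueData (Ideal.span {π}) φ ∧ φ π = w := by
  obtain ⟨V, hV⟩ : ∃ V : Subring W, IsCoefficientSubring V 0 := by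
    by_cases hp0 : p = 0
    · exact exists_isCoefficientSubring_of_charZero fun n hn hnm => hn (by
        simpa [hp0] using (hp n).1 hnm)
    · have hpp : p.Prime := by
        have hcp : CharP (ResidueField W) p := ⟨fun n => by
          rw [← map_natCast (residue W), residue_eq_zero_iff, hp]⟩
        exact (CharP.char_is_prime_or_zero (ResidueField W) p).resolve_right hp0
      rw [← h0]
      exact exists_isCoefficientSubring_of_prime hpp (by rw [h0]; exact zero_mem _) (.inl h0)
  have := hV.isNoetherianRing (zero_mem V) (zero_mem _)
  refine ⟨Polynomial V, inferInstance, inferInstance, Polynomial.X,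
    Polynomial.eval₂RingHom V.subtype w, ?_, ⟨fun f => ?_, fun b => ?_⟩, by simp⟩
  · exact Polynomial.isRegular_X.left.isSMulRegular
  · rw [Ideal.mem_span_singleton, Polynomial.X_dvd_iff]
    have hf := Polynomial.divX_mul_X_add f
    have h1 : Polynomial.eval₂RingHom V.subtype w f ∈ maximalIdeal W ↔
        (f.coeff 0 : W) ∈ maximalIdeal W := by
      conv_lhs => rw [← hf]
      rw [map_add, map_mul]
      simp only [Polynomial.coe_eval₂RingHom, Polynomial.eval₂_X, Polynomial.eval₂_C]
      exact Ideal.add_mem_iff_right _ (Ideal.mul_mem_left _ _ hw)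
    rw [h1]
    constructor
    · intro h
      obtain ⟨u, -, hu⟩ := hV.exists_mul _ (Subtype.mem _) h
      exact Subtype.ext (by rw [hu, zero_mul]; rfl)
    · intro h
      rw [h]; exact zero_mem _
  · obtain ⟨v, hv, hbv⟩ := hV.exists_sub_mem b
    exact ⟨Polynomial.C ⟨v, hv⟩, by simpa using hbv⟩

/-- Coefficient rings in mixed characteristic. -/
theorem exists_residueData_of_mixedChar {p : ℕ} (hp : p.Prime) (hpm : (p : W) ∈ maximalIdeal W)
    (hreg : IsSMulRegular W (p : W)) :
    ∃ (V : Type u) (_ : CommRing V) (_ : IsNoetherianRing V) (π : V) (φ : V →+* W),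
      IsSMulRegular V π ∧ ResidueData (Ideal.span {π}) φ ∧ φ π = p := by
  obtain ⟨V, hV⟩ := exists_isCoefficientSubring_of_prime hp hpm (.inr hreg)
  refine ⟨V, inferInstance, hV.isNoetherianRing (natCast_mem V p) hpm, p, V.subtype,
    fun a b hab => Subtype.ext (hreg (by simpa using congrArg V.subtype hab)),
    ⟨fun v => ?_, fun b => ?_⟩, by simp⟩
  · rw [Ideal.mem_span_singleton]
    constructor
    · intro h
      obtain ⟨u, hu, hvu⟩ := hV.exists_mul v v.2 h
      exact ⟨⟨u, hu⟩, Subtype.ext hvu⟩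
    · rintro ⟨u, rfl⟩
      simpa using Ideal.mul_mem_right (u : W) _ hpm
  · obtain ⟨v, hv, hbv⟩ := hV.exists_sub_mem b
    exact ⟨⟨v, hv⟩, hbv⟩

end CoefficientRingExistence


section RegularLocal

open RingTheory.Sequence

lemma isWeaklyRegular_cons_of_quotient {R : Type*} [CommRing R] {r : R} {rs : List R}
    (hr : IsSMulRegular R r)
    (h : IsWeaklyRegular (R ⧸ Ideal.span {r}) (rs.map (Ideal.Quotient.mk (Ideal.span {r})))) :
    IsWeaklyRegular R (r :: rs) := by
  refine (isWeaklyRegular_cons_iff R r rs).2 ⟨hr, ?_⟩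
  have he : (r • ⊤ : Submodule R R) = Ideal.span {r} := by
    rw [← Submodule.ideal_span_singleton_smul, smul_eq_mul, Ideal.mul_top]
  exact ((Submodule.quotEquivOfEq _ _ he).isWeaklyRegular_congr rs).2
    ((isWeaklyRegular_map_algebraMap_iff (R ⧸ Ideal.span {r}) (R ⧸ Ideal.span {r}) rs).1 h)

lemma map_ofList_quotient {R : Type*} [CommRing R] {r : R} {rs : List R} {I : Ideal R}
    (h : Ideal.ofList (r :: rs) = I) :
    Ideal.ofList (rs.map (Ideal.Quotient.mk (Ideal.span {r}))) =
      I.map (Ideal.Quotient.mk (Ideal.span {r})) := by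
  rw [← h, Ideal.ofList_cons, Ideal.map_sup, Ideal.map_quotient_self, bot_sup_eq, Ideal.map_ofList]

/-- A local ring of dimension at least `d` whose maximal ideal is generated by `d` elements is a
domain, and the `d` elements form a regular sequence. -/
theorem isDomain_and_isWeaklyRegular (d : ℕ) (R : Type u) [CommRing R] [IsLocalRing R]
    [IsNoetherianRing R] (rs : List R) (hl : rs.length = d) (hm : Ideal.ofList rs = maximalIdeal R)
    (hd : (d : WithBot ℕ∞) ≤ ringKrullDim R) : IsDomain R ∧ IsWeaklyRegular R rs := by
  induction d generalizing R with
  | zero =>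
    obtain rfl := List.length_eq_zero_iff.1 hl
    rw [Ideal.ofList_nil] at hm
    have := (isField_iff_maximalIdeal_eq.2 hm.symm)
    exact ⟨this.isDomain, IsWeaklyRegular.nil R R⟩
  | succ d ih =>
    obtain ⟨u, us, rfl⟩ := List.exists_cons_of_length_eq_add_one hl
    have hl' : us.length = d := by simpa using hl
    have key (x : R) (hx : Ideal.ofList (x :: us) = maximalIdeal R) :
        ∃ _ : IsDomain (R ⧸ Ideal.span {x}),
          IsWeaklyRegular (R ⧸ Ideal.span {x}) (us.map (Ideal.Quotient.mk (Ideal.span {x}))) := by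
      have hxm : x ∈ maximalIdeal R := by
        rw [← hx, Ideal.ofList_cons]
        exact Ideal.mem_sup_left (Ideal.mem_span_singleton_self x)
      have hnt : Nontrivial (R ⧸ Ideal.span {x}) := Ideal.Quotient.nontrivial_iff.2 fun h => by
        rw [Ideal.span_singleton_eq_top] at h
        exact (mem_maximalIdeal x).1 hxm h
      have := IsLocalRing.of_surjective' (Ideal.Quotient.mk (Ideal.span {x}))
        Ideal.Quotient.mk_surjective
      have hdim := ringKrullDim_le_ringKrullDim_quotient_add_card {x} (by
        rw [Finset.coe_singleton, Set.singleton_subset_iff, IsLocalRing.ringJacobson_eq_maximalIdeal]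
        exact hxm)
      rw [Finset.coe_singleton, Finset.card_singleton, Nat.cast_one] at hdim
      have hle := hd.trans hdim
      rw [Nat.cast_add, Nat.cast_one, ENat.WithBot.add_le_add_one_right_iff] at hle
      obtain ⟨h1, h2⟩ := ih (R ⧸ Ideal.span {x}) (us.map (Ideal.Quotient.mk _)) (by simpa using hl')
        (by rw [map_ofList_quotient hx,
              IsLocalRing.map_maximalIdeal_of_surjective _ Ideal.Quotient.mk_surjective]) hle
      exact ⟨h1, h2⟩
    have hdom : IsDomain R := by
      have hfin : (minimalPrimes R).Finite := minimalPrimes.finite_of_isNoetherianRing R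
      obtain ⟨a, ha, hav⟩ := exists_add_notMem_of_forall_not_le (Ideal.ofList us) u hfin.toFinset
        (fun P hP => Ideal.IsMinimalPrime.isPrime (hfin.mem_toFinset.1 hP)) (by
        intro P hP hle
        rw [← Ideal.ofList_cons, hm] at hle
        have hP' := (Set.Finite.mem_toFinset _).1 hP
        have hPp : P.IsPrime := Ideal.IsMinimalPrime.isPrime hP'
        have hPm : P = maximalIdeal R := le_antisymm (le_maximalIdeal hPp.ne_top) hle
        have h0 : (maximalIdeal R).height = 0 := by
          rw [← hPm]; exact Ideal.height_eq_zero_iff.2 hP'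
        rw [← IsLocalRing.maximalIdeal_height_eq_ringKrullDim, h0] at hd
        exact absurd (show d + 1 ≤ 0 by exact_mod_cast hd) (by omega))
      have hx : Ideal.ofList ((u + a) :: us) = maximalIdeal R := by
        rw [← hm, Ideal.ofList_cons, Ideal.ofList_cons]
        refine le_antisymm (sup_le ?_ le_sup_right) (sup_le ?_ le_sup_right)
        · rw [Ideal.span_singleton_le_iff_mem]
          exact Submodule.add_mem_sup (Ideal.mem_span_singleton_self u) ha
        · rw [Ideal.span_singleton_le_iff_mem]
          have := Submodule.add_mem_sup (Ideal.mem_span_singleton_self (u + a)) (neg_mem ha)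
          simpa using this
      obtain ⟨hq, -⟩ := key _ hx
      have hprime : (Ideal.span {u + a}).IsPrime := (Ideal.Quotient.isDomain_iff_prime _).1 hq
      obtain ⟨P, hP, hPle⟩ := Ideal.exists_minimalPrimes_le (I := ⊥) (J := Ideal.span {u + a}) bot_le
      have hPp : P.IsPrime := Ideal.IsMinimalPrime.isPrime hP
      have hxP : u + a ∉ P := hav P ((Set.Finite.mem_toFinset _).2 hP)
      have hPbot : P = ⊥ := by
        refine Submodule.eq_bot_of_le_smul_of_le_jacobson_bot (Ideal.span {u + a}) P
          (Ideal.fg_of_isNoetherianRing P) (fun y hy => ?_) ?_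
        · obtain ⟨c, rfl⟩ := Ideal.mem_span_singleton'.1 (hPle hy)
          rw [mul_comm]
          exact Ideal.mul_mem_mul (Ideal.mem_span_singleton_self _)
            ((hPp.mem_or_mem hy).resolve_right hxP)
        · rw [IsLocalRing.jacobson_eq_maximalIdeal _ bot_ne_top, ← hx, Ideal.ofList_cons]
          exact le_sup_left
      rw [hPbot] at hPp
      exact IsDomain.of_bot_isPrime R
    refine ⟨hdom, ?_⟩
    have hu0 : u ≠ 0 := by
      rintro rfl
      have h1 := ringKrullDim_le_spanFinrank_maximalIdeal R
      rw [← hm, Ideal.ofList_cons, Ideal.span_singleton_zero, bot_sup_eq] at h1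
      have h2 := hd.trans h1
      have h3 : (Ideal.ofList us).spanFinrank ≤ us.length := by
        classical
        have := Submodule.spanFinrank_span_le_ncard_of_finite (R := R) (s := {r | r ∈ us})
          us.finite_toSet
        refine this.trans ?_
        rw [show {r | r ∈ us} = (us.toFinset : Set R) by ext; simp, Set.ncard_coe_finset]
        exact List.toFinset_card_le us
      have h4 : d + 1 ≤ (Ideal.ofList us).spanFinrank := by exact_mod_cast h2
      omega
    obtain ⟨-, hw⟩ := key u hm
    exact isWeaklyRegular_cons_of_quotient (isSMulRegular_iff_right_eq_zero_of_smul.2 fun x hx =>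
      (mul_eq_zero.1 hx).resolve_left hu0) hw

lemma exists_isWeaklyRegular_of_isRegularLocal {R : Type u} [CommRing R] [IsLocalRing R]
    (h : IsRegularLocal R) : IsNoetherianRing R ∧ IsDomain R ∧ ∃ rs : List R,
      IsWeaklyRegular R rs ∧ Ideal.ofList rs = maximalIdeal R := by
  obtain ⟨hN, s, hs, hd⟩ := h
  have hs' : Ideal.ofList s.toList = maximalIdeal R := by
    rw [← hs, Ideal.ofList]; congr 1; ext; simp
  obtain ⟨h1, h2⟩ := isDomain_and_isWeaklyRegular s.card R s.toList (by simp) hs' hd.le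
  exact ⟨hN, h1, s.toList, h2, hs'⟩

end RegularLocal


section FaithfullyFlatBaseChange

open Abelian

variable {R : Type u} [CommRing R]

lemma subsingleton_ext_zero_iff (X Y : Type u) [AddCommGroup X] [Module R X] [AddCommGroup Y]
    [Module R Y] :
    Subsingleton (Ext (ModuleCat.of R X) (ModuleCat.of R Y) 0) ↔ Subsingleton (X →ₗ[R] Y) :=
  ((Equiv.ofBijective _ (Ext.mk₀_bijective _ _)).symm.trans
    (ModuleCat.homEquiv (M := ModuleCat.of R X) (N := ModuleCat.of R Y))).subsingleton_congr

variable {K F X : Type u} [AddCommGroup K] [Module R K] [AddCommGroup F] [Module R F]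
  [AddCommGroup X] [Module R X] {f : K →ₗ[R] F} {g : F →ₗ[R] X} [Module.Projective R F]

lemma subsingleton_ext_one_iff (hfg : Function.Exact f g) (hf : Function.Injective f)
    (hg : Function.Surjective g) (Y : Type u) [AddCommGroup Y] [Module R Y] :
    Subsingleton (Ext (ModuleCat.of R X) (ModuleCat.of R Y) 1) ↔
      Function.Surjective (f.lcomp R Y) := by
  have : Projective (sesOf hfg).X₂ := inferInstanceAs (Projective (ModuleCat.of R F))
  have hS := sesOf_shortExact hfg hf hg
  constructor
  · intro h φ
    obtain ⟨y, hy⟩ := Ext.contravariant_sequence_exact₁ hS (ModuleCat.of R Y)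
      (Ext.mk₀ (ModuleCat.ofHom φ)) (add_zero 1) (h.elim _ _)
    obtain ⟨ψ, rfl⟩ := (Ext.mk₀_bijective _ _).2 y
    rw [Ext.mk₀_comp_mk₀] at hy
    refine ⟨ψ.hom, ?_⟩
    have := (Ext.mk₀_bijective _ _).1 hy
    exact congr(($this).hom)
  · intro h
    refine subsingleton_of_forall_eq 0 fun e => ?_
    obtain ⟨y, rfl⟩ := Ext.contravariant_sequence_exact₃ hS (ModuleCat.of R Y) e
      ((Ext.subsingleton_of_projective _ _ 0).elim _ _) (add_zero 1)
    obtain ⟨φ, rfl⟩ := (Ext.mk₀_bijective _ _).2 y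
    obtain ⟨ψ, hψ⟩ := h φ.hom
    have hφ : φ = (sesOf hfg).f ≫ ModuleCat.ofHom ψ := ModuleCat.hom_ext hψ.symm
    rw [hφ, ← Ext.mk₀_comp_mk₀]
    exact ShortComplex.ShortExact.extClass_comp_assoc hS _ (h := add_zero 1)

lemma subsingleton_ext_add_two_iff (hfg : Function.Exact f g) (hf : Function.Injective f)
    (hg : Function.Surjective g) (Y : Type u) [AddCommGroup Y] [Module R Y] (n : ℕ) :
    Subsingleton (Ext (ModuleCat.of R X) (ModuleCat.of R Y) (n + 2)) ↔
      Subsingleton (Ext (ModuleCat.of R K) (ModuleCat.of R Y) (n + 1)) := by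
  have : Projective (sesOf hfg).X₂ := inferInstanceAs (Projective (ModuleCat.of R F))
  have hS := sesOf_shortExact hfg hf hg
  have h1 : Function.Injective (ExtR.connect (Q := R) (ModuleCat.of R Y) (n + 1) hS) :=
    ExtR.connect_injective _ _ hS
  have h2 : Function.Surjective (ExtR.connect (Q := R) (ModuleCat.of R Y) (n + 1) hS) :=
    ExtR.connect_surjective _ _ hS
  exact (Equiv.ofBijective _ ⟨h1, h2⟩).symm.subsingleton_congr

variable (B : Type u) [CommRing B] [Algebra R B] [Module.FaithfullyFlat R B]

lemma subsingleton_hom_baseChange_iff (X Y : Type u) [AddCommGroup X]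
    [Module R X] [Module.FinitePresentation R X] [AddCommGroup Y] [Module R Y] :
    Subsingleton ((B ⊗[R] X) →ₗ[B] (B ⊗[R] Y)) ↔ Subsingleton (X →ₗ[R] Y) := by
  have h := Module.FinitePresentation.isBaseChange_map R X Y B
  rw [← Module.FaithfullyFlat.subsingleton_tensorProduct_iff_right (R := R) (M := B)
    (N := X →ₗ[R] Y)]
  exact h.equiv.toEquiv.symm.subsingleton_congr

omit [Module.Projective R F] in
lemma surjective_lcomp_baseChange_iff [Module.FinitePresentation R K]
    [Module.FinitePresentation R F] (f : K →ₗ[R] F) (Y : Type u) [AddCommGroup Y] [Module R Y] :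
    Function.Surjective ((f.baseChange B).lcomp B (B ⊗[R] Y)) ↔
      Function.Surjective (f.lcomp R Y) := by
  have h1 := Module.FinitePresentation.isBaseChange_map R F Y B
  have h2 := Module.FinitePresentation.isBaseChange_map R K Y B
  rw [← Module.FaithfullyFlat.lTensor_surjective_iff_surjective R B]
  have key : ∀ z, h2.equiv ((f.lcomp R Y).lTensor B z) =
      (f.baseChange B).lcomp B (B ⊗[R] Y) (h1.equiv z) := by
    intro z
    induction z using TensorProduct.induction_on with
    | zero => simp
    | add a b ha hb => rw [map_add, map_add, map_add, map_add, ha, hb]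
    | tmul b φ =>
      rw [LinearMap.lTensor_tmul, IsBaseChange.equiv_tmul, IsBaseChange.equiv_tmul, map_smul]
      congr 1
      exact TensorProduct.AlgebraTensorModule.curry_injective
        (LinearMap.ext fun s ↦ (LinearMap.ext fun m ↦ (by simp)))
  have h3 : ⇑((f.baseChange B).lcomp B (B ⊗[R] Y)) ∘ h1.equiv =
    h2.equiv ∘ (f.lcomp R Y).lTensor B := funext fun z => (key z).symm
  rw [← h1.equiv.surjective.of_comp_iff, h3, Function.Surjective.of_comp_iff' h2.equiv.bijective]

/-- Vanishing of `Ext` out of a finitely generated module can be tested after a faithfully flat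
base change. -/
theorem subsingleton_ext_baseChange_iff [IsNoetherianRing R] (X Y : Type u) [AddCommGroup X]
    [Module R X] [Module.Finite R X] [AddCommGroup Y] [Module R Y] (n : ℕ) :
    Subsingleton (Ext (ModuleCat.of B (B ⊗[R] X)) (ModuleCat.of B (B ⊗[R] Y)) n) ↔
      Subsingleton (Ext (ModuleCat.of R X) (ModuleCat.of R Y) n) := by
  induction n generalizing X with
  | zero =>
    have hpX := Module.finitePresentation_of_finite R X
    rw [subsingleton_ext_zero_iff, subsingleton_ext_zero_iff]
    exact subsingleton_hom_baseChange_iff B X Y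
  | succ n ih =>
    obtain ⟨r, g, hg⟩ := Module.Finite.exists_fin' R X
    let e : (ULift.{u} (Fin r) → R) ≃ₗ[R] (Fin r → R) :=
      LinearEquiv.funCongrLeft R R Equiv.ulift.symm
    let g' : (ULift.{u} (Fin r) → R) →ₗ[R] X := g ∘ₗ e.toLinearMap
    have hg' : Function.Surjective g' := hg.comp e.surjective
    let f := (LinearMap.ker g').subtype
    have hf : Function.Injective f := Subtype.val_injective
    have hfg : Function.Exact f g' := LinearMap.exact_subtype_ker_map g'
    have hf' : Function.Injective (f.baseChange B) :=
      Module.Flat.lTensor_preserves_injective_linearMap f hf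
    have hfg' : Function.Exact (f.baseChange B) (g'.baseChange B) := lTensor_exact B hfg hg'
    have hgB : Function.Surjective (g'.baseChange B) := LinearMap.lTensor_surjective B hg'
    cases n with
    | zero =>
      have hpK := Module.finitePresentation_of_finite R (LinearMap.ker g')
      rw [subsingleton_ext_one_iff hfg hf hg', subsingleton_ext_one_iff hfg' hf' hgB]
      exact surjective_lcomp_baseChange_iff B f Y
    | succ n =>
      rw [subsingleton_ext_add_two_iff hfg hf hg', subsingleton_ext_add_two_iff hfg' hf' hgB]
      exact ih _

end FaithfullyFlatBaseChange


section Coordinates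

open Abelian RingTheory.Sequence

variable {B : Type u} [CommRing B] [IsLocalRing B] [IsNoetherianRing B]

lemma supportDim_eq_length_of_isRegular {M : Type u} [AddCommGroup M] [Module B M]
    [Module.Finite B M] {ws : List B} (h : IsRegular M ws) (t : ℕ)
    (ht : maximalIdeal B ^ t • ⊤ ≤ (Ideal.ofList ws • ⊤ : Submodule B M)) :
    Module.supportDim B M = ws.length := by
  rw [← Module.supportDim_add_length_eq_supportDim_of_isRegular ws h]
  have hnt : Nontrivial (M ⧸ (Ideal.ofList ws • ⊤ : Submodule B M)) :=
    Submodule.Quotient.nontrivial_iff.2 h.2.symm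
  have h0 (p : PrimeSpectrum B)
      (hp : p ∈ Module.support B (M ⧸ (Ideal.ofList ws • ⊤ : Submodule B M))) :
      p = closedPoint B := by
    refine eq_closedPoint_of_mem_support t (fun r hr x => ?_) p hp
    obtain ⟨x, rfl⟩ := Submodule.mkQ_surjective _ x
    rw [← map_smul]
    exact (Submodule.Quotient.mk_eq_zero _).2
      (ht (Submodule.smul_mem_smul (Ideal.pow_mem_pow hr t) trivial))
  have hne : Nonempty (Module.support B (M ⧸ (Ideal.ofList ws • ⊤ : Submodule B M))) :=
    (Module.nonempty_support_of_nontrivial (R := B)).to_subtype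
  have hss : Subsingleton (Module.support B (M ⧸ (Ideal.ofList ws • ⊤ : Submodule B M))) :=
    ⟨fun p q => Subtype.ext ((h0 _ p.2).trans (h0 _ q.2).symm)⟩
  have : Module.supportDim B (M ⧸ (Ideal.ofList ws • ⊤ : Submodule B M)) = 0 :=
    Order.krullDim_eq_zero
  rw [this, zero_add]

/-- A local ring `B` has coordinates if it receives a map, inducing a surjection on residue fields,
from a ring `V` with a nonzerodivisor `π` generating the contraction of the maximal ideal, such that
modulo `π` the maximal ideal of `B` is generated by as many elements as the dimension of `B`, and
`B` is Cohen–Macaulay. -/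
def HasCoordinates (B : Type u) [CommRing B] [IsLocalRing B] : Prop :=
  ∃ (w : B) (gs zs : List B) (t : ℕ),
    Ideal.span {w} ⊔ Ideal.ofList gs = maximalIdeal B ∧ gs.length = zs.length ∧
    IsWeaklyRegular B zs ∧ (∀ z ∈ zs, z ∈ maximalIdeal B) ∧ maximalIdeal B ^ t ≤ Ideal.ofList zs ∧
    ∃ (V : Type u) (_ : CommRing V) (_ : IsNoetherianRing V) (π : V) (φ : V →+* B),
      IsSMulRegular V π ∧ ResidueData (Ideal.span {π}) φ ∧ φ π = w

lemma exists_ulift_list {α : Type*} (xs : List α) :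
    ∃ (f : ULift.{u} (Fin xs.length) → α) (l : List (ULift.{u} (Fin xs.length))), l.Nodup ∧
      (∀ i, i ∈ l) ∧ l.map f = xs ∧ Set.range f = {a | a ∈ xs} := by
  refine ⟨fun i => xs.get i.down, (List.finRange xs.length).map ULift.up,
    (List.nodup_finRange _).map ULift.up_injective, fun i => ?_, ?_, ?_⟩
  · exact List.mem_map.2 ⟨i.down, List.mem_finRange _, rfl⟩
  · rw [List.map_map]
    exact (List.ofFn_eq_map (f := xs.get)).symm.trans (List.ofFn_get xs)
  · ext a
    simp only [Set.mem_range, Set.mem_ofPred_eq, List.mem_iff_get]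
    exact ⟨fun ⟨i, hi⟩ => ⟨i.down, hi⟩, fun ⟨i, hi⟩ => ⟨⟨i⟩, hi⟩⟩

theorem rigid_of_hasCoordinates [IsAdicComplete (maximalIdeal B) B] (hB : HasCoordinates B)
    (M : Type u) [AddCommGroup M] [Module B M] [Module.Finite B M] [Nontrivial M] (s : ℕ)
    (hs : ∀ j < s, Subsingleton (Ext (ModuleCat.of B (ResidueField B)) (ModuleCat.of B M) j))
    (hd : Module.supportDim B M = s) {g : ℕ}
    (hg₁ : ∀ l, g < l → Subsingleton (Ext (ModuleCat.of B M) (ModuleCat.of B (ResidueField B)) l))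
    (hg : ¬ Subsingleton (Ext (ModuleCat.of B M) (ModuleCat.of B (ResidueField B)) g))
    (N : ModuleCat.{u} B) [Module.Finite B N] {n : ℕ} (hn : n < g)
    (h : Subsingleton (Ext (ModuleCat.of B M) N n)) :
    ∀ l ≤ n, Subsingleton (Ext (ModuleCat.of B M) N l) := by
  obtain ⟨w, gs, zs, t', hgen, hlen, hz, hzm, ht', V, _, _, π, φ, hπ, hφ, rfl⟩ := hB
  have hdim : ringKrullDim B = zs.length := ringKrullDim_eq_length_of_isRegular
    ((isRegular_iff_isWeaklyRegular_of_subset_maximalIdeal hzm).2 hz) t' ht'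
  have hsd : s ≤ zs.length := by
    have := Module.supportDim_le_ringKrullDim B M
    rw [hd, hdim] at this
    exact_mod_cast this
  obtain ⟨c, hc⟩ := Nat.exists_eq_add_of_le hsd
  obtain ⟨xs, ys, hxs, hys, hxy, hw⟩ := exists_isWeaklyRegular_coordinates s c (ModuleCat.of B M) hs
    (Ideal.span {φ π}) gs (hlen.trans hc) hgen
  have hxm : ∀ x ∈ xs, x ∈ maximalIdeal B := fun x hx => by
    rw [← hxy]
    exact Ideal.mem_sup_left (Ideal.mem_sup_right (Ideal.subset_span hx))
  obtain ⟨t, ht⟩ := exists_pow_smul_top_le_of_supportDim hw hxm (by rw [hxs]; exact hd)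
  obtain ⟨x, l, hl, hl', hlx, hrx⟩ := exists_ulift_list.{u} xs
  obtain ⟨y, -, -, -, -, hry⟩ := exists_ulift_list.{u} ys
  refine rigid_of_coordinates hπ hφ x y ?_ hl hl' (by rw [hlx]; exact hw) t
    (by rw [hlx]; exact ht) hz hzm t' ht' ?_ hg₁ hg N hn h
  · rw [hrx, hry, ← hxy]
    change Ideal.ofList ys ⊔ (Ideal.ofList xs ⊔ _) = _
    rw [sup_comm, sup_comm (Ideal.ofList xs)]
  · rw [Fintype.card_ulift, Fintype.card_fin, Fintype.card_ulift, Fintype.card_fin, hxs, hys, hc]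

end Coordinates


section Descent

open Abelian RingTheory.Sequence

variable {R : Type u} [CommRing R] [IsLocalRing R] (B : Type u) [CommRing B] [IsLocalRing B]
  [Algebra R B]

/-- If the maximal ideal of `R` generates that of `B`, then the residue field of `B` is the base
change of that of `R`. -/
noncomputable def residueFieldBaseChange
    (hm : (maximalIdeal R).map (algebraMap R B) = maximalIdeal B) :
    (B ⊗[R] ResidueField R) ≃ₗ[B] ResidueField B :=
  (Algebra.TensorProduct.quotIdealMapEquivTensorQuot B (maximalIdeal R)).symm.toLinearEquiv ≪≫ₗ
    Submodule.quotEquivOfEq _ _ hm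

lemma pow_smul_top_le_baseChange (hm : (maximalIdeal R).map (algebraMap R B) = maximalIdeal B)
    {M : Type u} [AddCommGroup M] [Module R M] {ws : List R} {t : ℕ}
    (ht : maximalIdeal R ^ t • ⊤ ≤ (Ideal.ofList ws • ⊤ : Submodule R M)) :
    maximalIdeal B ^ t • ⊤ ≤
      (Ideal.ofList (ws.map (algebraMap R B)) • ⊤ : Submodule B (B ⊗[R] M)) := by
  have h1 (b : B) (m : M) (h : m ∈ (Ideal.ofList ws • ⊤ : Submodule R M)) :
      b ⊗ₜ[R] m ∈ (Ideal.ofList (ws.map (algebraMap R B)) • ⊤ : Submodule B (B ⊗[R] M)) := by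
    induction h using Submodule.smul_induction_on' with
    | smul r hr m _ =>
      rw [← TensorProduct.smul_tmul, Algebra.smul_def, ← smul_eq_mul, ← TensorProduct.smul_tmul']
      rw [← Ideal.map_ofList]
      exact Submodule.smul_mem_smul (Ideal.mem_map_of_mem _ hr) trivial
    | add x _ y _ hx hy =>
      rw [TensorProduct.tmul_add]
      exact add_mem hx hy
  rw [← hm, ← Ideal.map_pow]
  refine Submodule.smul_le.2 fun b hb z _ => ?_
  induction hb using Submodule.span_induction generalizing z with
  | mem b hb =>
    obtain ⟨r, hr, rfl⟩ := hb
    induction z using TensorProduct.induction_on with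
    | zero => rw [smul_zero]; exact zero_mem _
    | add x y hx hy => rw [smul_add]; exact add_mem (hx trivial) (hy trivial)
    | tmul c m =>
      rw [algebraMap_smul, TensorProduct.smul_tmul', TensorProduct.smul_tmul]
      exact h1 _ _ (ht (Submodule.smul_mem_smul hr trivial))
  | zero => rw [zero_smul]; exact zero_mem _
  | add x y _ _ hx hy => rw [add_smul]; exact add_mem (hx z trivial) (hy z trivial)
  | smul a x _ hx => rw [smul_assoc]; exact Submodule.smul_mem _ _ (hx z trivial)

variable [IsNoetherianRing R] [IsNoetherianRing B] [IsAdicComplete (maximalIdeal B) B]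
  [Module.FaithfullyFlat R B]

theorem rigid_of_hasCoordinates_baseChange (hB : HasCoordinates B)
    (hm : (maximalIdeal R).map (algebraMap R B) = maximalIdeal B)
    (M : Type u) [AddCommGroup M] [Module R M] [Module.Finite R M] [Nontrivial M] {ws : List R}
    (hw : IsRegular M ws) (hwm : ∀ w ∈ ws, w ∈ maximalIdeal R) (t : ℕ)
    (ht : maximalIdeal R ^ t • ⊤ ≤ (Ideal.ofList ws • ⊤ : Submodule R M)) {g : ℕ}
    (hg₁ : ∀ l, g < l → Subsingleton (Ext (ModuleCat.of R M) (ModuleCat.of R (ResidueField R)) l))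
    (hg : ¬ Subsingleton (Ext (ModuleCat.of R M) (ModuleCat.of R (ResidueField R)) g))
    (N : Type u) [AddCommGroup N] [Module R N] [Module.Finite R N] {n : ℕ} (hn : n < g)
    (h : Subsingleton (Ext (ModuleCat.of R M) (ModuleCat.of R N) n)) :
    ∀ l ≤ n, Subsingleton (Ext (ModuleCat.of R M) (ModuleCat.of R N) l) := by
  have e := (residueFieldBaseChange B hm).toModuleIso
  have hk (l : ℕ) : Subsingleton (Ext (ModuleCat.of B (B ⊗[R] M))
      (ModuleCat.of B (ResidueField B)) l) ↔
      Subsingleton (Ext (ModuleCat.of R M) (ModuleCat.of R (ResidueField R)) l) := by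
    exact Iff.trans ⟨subsingleton_ext_congr_right _ e.symm l, subsingleton_ext_congr_right _ e l⟩
      (subsingleton_ext_baseChange_iff B M (ResidueField R) l)
  have hfin : Module.Finite R (ResidueField R) :=
    inferInstanceAs (Module.Finite R (R ⧸ maximalIdeal R))
  have hdepth (j : ℕ) (hj : j < ws.length) :
      Subsingleton (Ext (ModuleCat.of R (ResidueField R)) (ModuleCat.of R M) j) := by
    refine ModuleCat.subsingleton_ext_of_exists_isRegular (maximalIdeal R)
      (ModuleCat.of R (ResidueField R)) ?_ (ModuleCat.of R M) ?_ ws hwm hw j hj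
    · change Module.support R (R ⧸ maximalIdeal R) ⊆ _
      rw [Module.support_eq_zeroLocus, Ideal.annihilator_quotient]
    · refine Ne.lt_top fun h0 => not_subsingleton M ?_
      have := Submodule.eq_bot_of_le_smul_of_le_jacobson_bot (maximalIdeal R) (⊤ : Submodule R M)
        Module.Finite.fg_top h0.ge (IsLocalRing.maximalIdeal_le_jacobson _)
      exact (Submodule.subsingleton_iff R).1 (subsingleton_of_bot_eq_top this.symm)
  have hnt : Nontrivial (B ⊗[R] M) :=
    (Module.FaithfullyFlat.nontrivial_tensorProduct_iff_right R B).2 inferInstance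
  have hw' : IsRegular (B ⊗[R] M) (ws.map (algebraMap R B)) :=
    hw.of_faithfullyFlat_of_isBaseChange (TensorProduct.isBaseChange R M B)
  have hd := supportDim_eq_length_of_isRegular hw' t (pow_smul_top_le_baseChange B hm ht)
  have key := rigid_of_hasCoordinates hB (B ⊗[R] M) ws.length (fun j hj => by
      refine subsingleton_ext_congr_left e _ j ?_
      exact (subsingleton_ext_baseChange_iff B _ _ j).2 (hdepth j hj))
    (by rw [hd, List.length_map]) (fun l hl => (hk l).2 (hg₁ l hl)) (fun h => hg ((hk g).1 h))
    (ModuleCat.of B (B ⊗[R] N)) hn ((subsingleton_ext_baseChange_iff B _ _ n).2 h)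
  exact fun l hl => (subsingleton_ext_baseChange_iff B _ _ l).1 (key l hl)

end Descent


section Assembly

open Abelian RingTheory.Sequence

variable {R : Type u} [CommRing R]

lemma subsingleton_extMod_iff (n : ℕ) (X Y : Type u) [AddCommGroup X] [Module R X] [AddCommGroup Y]
    [Module R Y] : Subsingleton (extMod R n X Y) ↔
      Subsingleton (Ext (ModuleCat.of R X) (ModuleCat.of R Y) n) :=
  subsingleton_derivedExt_iff (ModuleCat.of R X) (ModuleCat.of R Y) n

variable [IsLocalRing R] [IsNoetherianRing R] (M : Type u) [AddCommGroup M] [Module R M]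
  [Module.Finite R M]

lemma exists_projDim_eq [Nontrivial M] (h : projDim R M < ⊤) : ∃ g : ℕ, projDim R M = g ∧
    (∀ i, g < i → ∀ N : ModuleCat.{u} R, Subsingleton (Ext (ModuleCat.of R M) N i)) ∧
    ¬ Subsingleton (Ext (ModuleCat.of R M) (ModuleCat.of R (ResidueField R)) g) := by
  obtain ⟨g, hg⟩ := ENat.ne_top_iff_exists.1 h.ne
  have hmem : projDim R M ∈ {n : ℕ∞ | ∀ i : ℕ, n < (i : ℕ∞) → ∀ N : ModuleCat.{u} R,
      Subsingleton (((Ext R (ModuleCat.{u} R) i).obj (Opposite.op (ModuleCat.of R M))).obj N)} := by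
    refine csInf_mem ⟨⊤, fun i hi => ?_⟩
    exact absurd hi (not_lt.2 le_top)
  refine ⟨g, hg.symm, fun i hi N => ?_, fun hk => ?_⟩
  · refine (subsingleton_derivedExt_iff _ _ _).1 (hmem i ?_ N)
    rw [← hg]
    exact_mod_cast hi
  · have hlt := hasProjectiveDimensionLT_of_residueField (ModuleCat.of R M) g hk
    cases g with
    | zero =>
      have := isZero_of_hasProjectiveDimensionLT_zero (ModuleCat.of R M)
      exact not_subsingleton M (ModuleCat.subsingleton_of_isZero this)
    | succ g =>
      have hle : projDim R M ≤ g := by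
        refine csInf_le' fun i hi N => (subsingleton_derivedExt_iff _ _ _).2 ?_
        have hi' : g < i := by exact_mod_cast hi
        exact HasProjectiveDimensionLT.subsingleton (ModuleCat.of R M) (g + 1) i hi' N
      rw [← hg] at hle
      exact absurd (show g + 1 ≤ g by exact_mod_cast hle) (by omega)

lemma exists_isRegular_of_isCohenMacaulayModule [Nontrivial M] (h : IsCohenMacaulayModule R M) :
    ∃ ws : List R, IsRegular M ws ∧ (∀ w ∈ ws, w ∈ maximalIdeal R) ∧
      ∃ t, maximalIdeal R ^ t • ⊤ ≤ (Ideal.ofList ws • ⊤ : Submodule R M) := by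
  have hfin : Module.Finite R (ResidueField R) :=
    inferInstanceAs (Module.Finite R (R ⧸ maximalIdeal R))
  have hlt : maximalIdeal R • (⊤ : Submodule R M) < ⊤ := by
    refine Ne.lt_top fun h0 => not_subsingleton M ?_
    have := Submodule.eq_bot_of_le_smul_of_le_jacobson_bot (maximalIdeal R) (⊤ : Submodule R M)
      Module.Finite.fg_top h0.ge (IsLocalRing.maximalIdeal_le_jacobson _)
    exact (Submodule.subsingleton_iff R).1 (subsingleton_of_bot_eq_top this.symm)
  have hsupp : Module.support R (ResidueField R) = PrimeSpectrum.zeroLocus (maximalIdeal R) := by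
    change Module.support R (R ⧸ maximalIdeal R) = _
    rw [Module.support_eq_zeroLocus, Ideal.annihilator_quotient]
  obtain ⟨ws, hl, hwm, hw⟩ := ModuleCat.exists_isRegular_of_exists_subsingleton_ext
    (maximalIdeal R) (moduleDepth R M) (ModuleCat.of R M) hlt (ModuleCat.of R (ResidueField R)) hsupp
    (fun i hi => (subsingleton_extMod_iff i _ _).1 (not_not.1 (Nat.notMem_of_lt_sInf hi)))
  refine ⟨ws, hw, hwm, exists_pow_smul_top_le_of_supportDim hw.1 hwm ?_⟩
  rw [Module.supportDim_eq_ringKrullDim_quotient_annihilator, hl]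
  exact h

omit [IsNoetherianRing R] [Module.Finite R M] in
lemma subsingleton_of_subsingleton_ext {N : Type u} [AddCommGroup N] [Module R N]
    [Module.Finite R N] {g : ℕ}
    (hg₁ : ∀ L : ModuleCat.{u} R, Subsingleton (Ext (ModuleCat.of R M) L (g + 1)))
    (hg : ¬ Subsingleton (Ext (ModuleCat.of R M) (ModuleCat.of R (ResidueField R)) g))
    (h : Subsingleton (Ext (ModuleCat.of R M) (ModuleCat.of R N) g)) : Subsingleton N := by
  by_contra hN
  rw [not_subsingleton_iff_nontrivial] at hN
  obtain ⟨f, hf⟩ : ∃ f : N →ₗ[R] ResidueField R, Function.Surjective f := by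
    obtain ⟨P, hP, -⟩ := (eq_top_or_exists_le_coatom (⊥ : Submodule R N)).resolve_left bot_ne_top
    obtain ⟨I, hI, ⟨e⟩⟩ := isSimpleModule_iff_quot_maximal.1 (isSimpleModule_iff_isCoatom.2 hP)
    obtain rfl := IsLocalRing.eq_maximalIdeal hI
    exact ⟨e.toLinearMap ∘ₗ P.mkQ, e.surjective.comp P.mkQ_surjective⟩
  have hS := sesOf_shortExact (LinearMap.exact_subtype_ker_map f) Subtype.val_injective hf
  exact hg (subsingleton_ext_X₃ _ hS g h (hg₁ _))

theorem ext_rigid_of_hasCoordinates (B : Type u) [CommRing B] [IsLocalRing B]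
    [Algebra R B] [IsNoetherianRing B] [IsAdicComplete (maximalIdeal B) B]
    [Module.FaithfullyFlat R B] (hB : HasCoordinates B)
    (hm : (maximalIdeal R).map (algebraMap R B) = maximalIdeal B) [Nontrivial M]
    (hCM : IsCohenMacaulayModule R M) (hpd : projDim R M < ⊤) :
    (∀ (N : Type u) (iN : AddCommGroup N) (jN : Module R N), Module.Finite R N →
        ∀ n : ℕ, (n : ℕ∞) ≤ projDim R M →
          Subsingleton (@extMod R _ n M _ _ N iN jN) →
            ∀ i ≤ n, Subsingleton (@extMod R _ i M _ _ N iN jN)) ∧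
      (∀ n : ℕ, 1 ≤ n → Subsingleton (extMod R n M M) → projDim R M < (n : ℕ∞)) := by
  obtain ⟨g, hg, hg₁, hg₂⟩ := exists_projDim_eq M hpd
  obtain ⟨ws, hw, hwm, t, ht⟩ := exists_isRegular_of_isCohenMacaulayModule M hCM
  have key (N : Type u) (iN : AddCommGroup N) (jN : Module R N) (_ : Module.Finite R N) (n : ℕ)
      (hn : (n : ℕ∞) ≤ projDim R M) (h : Subsingleton (extMod R n M N)) (i : ℕ) (hi : i ≤ n) :
      Subsingleton (extMod R i M N) := by
    rw [hg] at hn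
    rw [subsingleton_extMod_iff] at h ⊢
    obtain hn | rfl := (show n ≤ g by exact_mod_cast hn).lt_or_eq
    · exact rigid_of_hasCoordinates_baseChange B hB hm M hw hwm t ht (fun l hl => hg₁ l hl _) hg₂ N
        hn h i hi
    · have := subsingleton_of_subsingleton_ext M (hg₁ _ (Nat.lt_succ_self n)) hg₂ h
      exact subsingleton_ext_of_subsingleton_right _ _ _
  refine ⟨key, fun n _ h => ?_⟩
  by_contra hlt
  have h0 := (subsingleton_extMod_iff _ _ _).1
    (key M _ _ inferInstance n (not_lt.1 hlt) h 0 (Nat.zero_le n))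
  rw [subsingleton_ext_zero_iff] at h0
  refine not_subsingleton M ⟨fun x y => ?_⟩
  rw [← LinearMap.id_apply (R := R) x, ← LinearMap.id_apply (R := R) y,
    Subsingleton.elim (LinearMap.id : M →ₗ[R] M) 0]
  rfl

end Assembly


section CompletionCoordinates

open Abelian RingTheory.Sequence

lemma ResidueData.comp {S W B : Type*} [CommRing S] [CommRing W] [IsLocalRing W] [CommRing B]
    [IsLocalRing B] {I : Ideal S} {φ : S →+* W} (h : ResidueData I φ) (ψ : W →+* B)
    (hψ : (maximalIdeal W).map ψ ≤ maximalIdeal B)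
    (hsurj : ∀ b, ∃ w, b - ψ w ∈ maximalIdeal B) : ResidueData I (ψ.comp φ) where
  mem_iff s := by
    rw [← h.mem_iff]
    refine ⟨fun hs => ?_, fun hs => hψ (Ideal.mem_map_of_mem ψ hs)⟩
    by_contra hu
    rw [mem_maximalIdeal, mem_nonunits_iff, not_not] at hu
    exact (mem_maximalIdeal _).1 hs (hu.map ψ)
  surj b := by
    obtain ⟨w, hw⟩ := hsurj b
    obtain ⟨s, hs⟩ := h.surj w
    refine ⟨s, ?_⟩
    have := add_mem hw (hψ (Ideal.mem_map_of_mem ψ hs))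
    rwa [map_sub, sub_add_sub_cancel] at this

lemma exists_span_singleton_sup_ofList {Q : Type*} [CommRing Q] [IsLocalRing Q] (us : List Q)
    (hus : Ideal.ofList us ≤ maximalIdeal Q) {p : Q} (hp : p ∈ Ideal.ofList us)
    (hp2 : p ∉ maximalIdeal Q ^ 2) :
    ∃ vs : List Q, vs.length + 1 = us.length ∧
      Ideal.span {p} ⊔ Ideal.ofList vs = Ideal.ofList us := by
  induction us generalizing p with
  | nil =>
    rw [Ideal.ofList_nil, Ideal.mem_bot] at hp
    exact absurd (hp ▸ zero_mem _) hp2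
  | cons u us ih =>
    rw [Ideal.ofList_cons] at hp hus
    obtain ⟨y, hy, q, hq, rfl⟩ := Submodule.mem_sup.1 hp
    obtain ⟨a, rfl⟩ := Ideal.mem_span_singleton'.1 hy
    by_cases ha : IsUnit a
    · refine ⟨us, rfl, ?_⟩
      rw [Ideal.ofList_cons]
      refine le_antisymm (sup_le ?_ le_sup_right) (sup_le ?_ le_sup_right)
      · rwa [Ideal.span_singleton_le_iff_mem]
      · rw [Ideal.span_singleton_le_iff_mem, ← Ideal.unit_mul_mem_iff_mem _ ha]
        have := Submodule.add_mem_sup (Ideal.mem_span_singleton_self (a * u + q)) (neg_mem hq)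
        simpa using this
    · have hau : a * u ∈ maximalIdeal Q ^ 2 := by
        rw [pow_two]
        exact Ideal.mul_mem_mul ((mem_maximalIdeal a).2 ha)
          (hus (Ideal.mem_sup_left (Ideal.mem_span_singleton_self u)))
      obtain ⟨vs, hl, hvs⟩ := ih (le_sup_right.trans hus) hq
        fun h => hp2 (add_mem hau h)
      refine ⟨u :: vs, by simp [hl], ?_⟩
      rw [Ideal.ofList_cons, Ideal.ofList_cons, ← hvs, ← sup_assoc, ← sup_assoc]
      congr 1
      refine le_antisymm (sup_le ?_ le_sup_left) (sup_le le_sup_right ?_)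
      · rw [Ideal.span_singleton_le_iff_mem]
        exact Submodule.add_mem_sup hy (Ideal.mem_span_singleton_self q)
      · rw [Ideal.span_singleton_le_iff_mem]
        have := Submodule.add_mem_sup (Ideal.mem_span_singleton_self (a * u + q)) (neg_mem hy)
        simpa using this

lemma exists_isWeaklyRegular_of_surjective {Q B : Type u} [CommRing Q] [IsLocalRing Q]
    [IsNoetherianRing Q] [CommRing B] [IsLocalRing B] [Algebra Q B]
    (hsurj : Function.Surjective (algebraMap Q B)) {x : Q}
    (hker : RingHom.ker (algebraMap Q B) = Ideal.span {x}) (hx : x ∈ nonZeroDivisors Q) {us : List Q}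
    (hus : IsWeaklyRegular Q us) (hm : Ideal.ofList us = maximalIdeal Q) :
    ∃ zs : List B, zs.length + 1 = us.length ∧ IsWeaklyRegular B zs ∧
      (∀ z ∈ zs, z ∈ maximalIdeal B) ∧ ∃ t, maximalIdeal B ^ t ≤ Ideal.ofList zs := by
  have hum : ∀ r ∈ us, r ∈ maximalIdeal Q := fun r hr => hm ▸ Ideal.subset_span hr
  have hreg := (isRegular_iff_isWeaklyRegular_of_subset_maximalIdeal hum).2 hus
  have hdim : ringKrullDim Q = us.length :=
    ringKrullDim_eq_length_of_isRegular hreg 1 (by rw [pow_one, hm])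
  have hfin : Module.Finite Q B := .of_surjective (Algebra.linearMap Q B) hsurj
  have hmB : (maximalIdeal Q).map (algebraMap Q B) = maximalIdeal B :=
    IsLocalRing.map_maximalIdeal_of_surjective _ hsurj
  have hann : Module.annihilator Q B = Ideal.span {x} := by
    rw [← hker]
    ext r
    rw [Module.mem_annihilator, RingHom.mem_ker]
    refine ⟨fun h => by simpa [Algebra.smul_def] using h 1, fun h b => ?_⟩
    rw [Algebra.smul_def, h, zero_mul]
  have hxm : x ∈ maximalIdeal Q := by
    rw [mem_maximalIdeal, mem_nonunits_iff]
    intro hu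
    have : algebraMap Q B x = 0 := by
      rw [← RingHom.mem_ker, hker]; exact Ideal.mem_span_singleton_self x
    exact not_isUnit_zero (this ▸ hu.map (algebraMap Q B))
  have hdB : ringKrullDim (Q ⧸ Ideal.span {x}) + 1 = us.length := by
    rw [← hdim]
    exact ringKrullDim_quotient_span_singleton_succ_eq_ringKrullDim_of_mem_nonZeroDivisors hx hxm
  obtain ⟨e, he⟩ : ∃ e, us.length = e + 1 := by
    refine Nat.exists_eq_succ_of_ne_zero fun h0 => ?_
    rw [List.length_eq_zero_iff.1 h0, Ideal.ofList_nil] at hm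
    rw [← hm, Ideal.mem_bot] at hxm
    exact zero_notMem_nonZeroDivisors (hxm ▸ hx)
  have hdB' : ringKrullDim (Q ⧸ Ideal.span {x}) = e := by
    rw [he, Nat.cast_add, Nat.cast_one] at hdB
    exact le_antisymm (ENat.WithBot.add_le_add_one_right_iff.1 hdB.le)
      (ENat.WithBot.add_le_add_one_right_iff.1 hdB.ge)
  have hk : Module.Finite Q (ResidueField Q) :=
    inferInstanceAs (Module.Finite Q (Q ⧸ maximalIdeal Q))
  have hsupp : Module.support Q (ResidueField Q) = PrimeSpectrum.zeroLocus (maximalIdeal Q) := by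
    change Module.support Q (Q ⧸ maximalIdeal Q) = _
    rw [Module.support_eq_zeroLocus, Ideal.annihilator_quotient]
  have hExt := ModuleCat.subsingleton_ext_of_exists_isRegular (maximalIdeal Q)
    (ModuleCat.of Q (ResidueField Q)) hsupp.le (ModuleCat.of Q Q)
    (by rw [smul_eq_mul, Ideal.mul_top]; exact (maximalIdeal.isMaximal Q).ne_top.lt_top) us hum hreg
  have hexact : Function.Exact (LinearMap.mulLeft Q x) (Algebra.linearMap Q B) := by
    intro y
    rw [Algebra.linearMap_apply, ← RingHom.mem_ker, hker, Ideal.mem_span_singleton]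
    exact ⟨fun ⟨c, hc⟩ => ⟨c, hc.symm⟩, fun ⟨c, hc⟩ => ⟨c, hc.symm⟩⟩
  have hS := sesOf_shortExact hexact
    (fun a b hab => (mul_cancel_left_mem_nonZeroDivisors hx).1 hab) hsurj
  obtain ⟨xs, ys, hxl, -, hxy, hxs⟩ := exists_isWeaklyRegular_coordinates e 1 (ModuleCat.of Q B)
    (fun j hj => subsingleton_ext_X₃ _ hS j (hExt j (by omega)) (hExt (j + 1) (by omega))) ⊥ us he
    (by rw [bot_sup_eq, hm])
  have hxm' : ∀ z ∈ xs, z ∈ maximalIdeal Q := fun z hz =>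
    hxy ▸ Ideal.mem_sup_left (Ideal.mem_sup_right (Ideal.subset_span hz))
  obtain ⟨t, ht⟩ := exists_pow_smul_top_le_of_supportDim (M := B) hxs hxm' (by
    rw [Module.supportDim_eq_ringKrullDim_quotient_annihilator, hann, hdB', hxl])
  refine ⟨xs.map (algebraMap Q B), by simp [hxl, he],
    (isWeaklyRegular_map_algebraMap_iff B B xs).2 hxs, ?_, t, ?_⟩
  · intro z hz
    obtain ⟨y, hy, rfl⟩ := List.mem_map.1 hz
    exact hmB ▸ Ideal.mem_map_of_mem _ (hxm' y hy)
  · rw [Ideal.smul_top_eq_map, Ideal.smul_top_eq_map, Ideal.map_pow, hmB, Ideal.map_ofList] at ht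
    exact ht

end CompletionCoordinates


section MainTheorem

open RingTheory.Sequence

lemma natCast_mem_maximalIdeal_iff (R : Type*) [CommRing R] [IsLocalRing R] (n : ℕ) :
    (n : R) ∈ maximalIdeal R ↔ ringChar (ResidueField R) ∣ n := by
  rw [← residue_eq_zero_iff, map_natCast, ringChar.spec]

variable {R : Type u} [CommRing R] [IsLocalRing R] [IsNoetherianRing R]

instance isNoetherianRing_adicCompletion :
    IsNoetherianRing (AdicCompletion (maximalIdeal R) R) :=
  (completionData_adicCompletion (maximalIdeal R)).noetherian

instance faithfullyFlat_adicCompletion :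
    Module.FaithfullyFlat R (AdicCompletion (maximalIdeal R) R) :=
  have := (completionData_adicCompletion (maximalIdeal R)).flat
  Module.FaithfullyFlat.of_flat_of_isLocalHom

lemma natCast_mem_maximalIdeal_adicCompletion_iff (n : ℕ) :
    (n : AdicCompletion (maximalIdeal R) R) ∈ maximalIdeal (AdicCompletion (maximalIdeal R) R) ↔
      ringChar (ResidueField R) ∣ n := by
  rw [← natCast_mem_maximalIdeal_iff R, ← map_natCast (algebraMap R _), mem_maximalIdeal,
    mem_nonunits_iff, isUnit_map_iff, ← mem_nonunits_iff, ← mem_maximalIdeal]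

omit [IsNoetherianRing R] in
lemma prime_ringChar_of_natCast_ne_zero (h : (ringChar (ResidueField R) : R) ≠ 0) :
    (ringChar (ResidueField R)).Prime :=
  (CharP.char_is_prime_or_zero (ResidueField R) _).resolve_right fun h0 => h (by simp [h0])

lemma isSMulRegular_natCast_adicCompletion [IsDomain R] {p : ℕ} (h : (p : R) ≠ 0) :
    IsSMulRegular (AdicCompletion (maximalIdeal R) R) (p : AdicCompletion (maximalIdeal R) R) := by
  have h1 : IsSMulRegular R (p : R) := isSMulRegular_iff_right_eq_zero_of_smul.2 fun x hx =>
      (mul_eq_zero.1 hx).resolve_left h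
  have h2 := h1.of_flat (S := AdicCompletion (maximalIdeal R) R)
  rwa [map_natCast] at h2

lemma hasCoordinates_adicCompletion_of_isRegularLocal (hR : IsRegularLocal R) :
    HasCoordinates (AdicCompletion (maximalIdeal R) R) := by
  obtain ⟨-, _, us, hus, hm⟩ := exists_isWeaklyRegular_of_isRegularLocal hR
  set B := AdicCompletion (maximalIdeal R) R
  have hm' : Ideal.ofList (us.map (algebraMap R B)) = maximalIdeal B := by
    rw [← Ideal.map_ofList, hm]
    exact AdicCompletion.maximalIdeal_eq_map.symm
  have hmem : ∀ z ∈ us.map (algebraMap R B), z ∈ maximalIdeal B := fun z hz =>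
    hm' ▸ Ideal.subset_span hz
  have hreg : IsWeaklyRegular B (us.map (algebraMap R B)) := hus.of_flat
  by_cases hp : (ringChar (ResidueField R) : R) = 0
  · refine ⟨0, _, _, 1, ?_, rfl, hreg, hmem, by rw [pow_one, hm'],
      exists_residueData_of_equalChar natCast_mem_maximalIdeal_adicCompletion_iff
        (by rw [← map_natCast (algebraMap R B), hp, map_zero]) 0 (zero_mem _)⟩
    rw [Ideal.span_singleton_zero, bot_sup_eq, hm']
  · have hpm := (natCast_mem_maximalIdeal_adicCompletion_iff (R := R) _).2 dvd_rfl
    refine ⟨_, _, _, 1, ?_, rfl, hreg, hmem, by rw [pow_one, hm'],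
      exists_residueData_of_mixedChar (prime_ringChar_of_natCast_ne_zero hp) hpm
        (isSMulRegular_natCast_adicCompletion hp)⟩
    rw [hm', sup_eq_right, Ideal.span_singleton_le_iff_mem]
    exact hpm

lemma hasCoordinates_adicCompletion_of_hypersurfacePresentation (hR : IsUnramifiedLocal R)
    (P : HypersurfacePresentation R) : HasCoordinates (AdicCompletion (maximalIdeal R) R) := by
  obtain ⟨Q, hQ, x, -, hx, e⟩ := P
  obtain ⟨_, _, us, hus, hm⟩ := exists_isWeaklyRegular_of_isRegularLocal hQ
  set B := AdicCompletion (maximalIdeal R) R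
  let f : Q →+* B := (e.symm : Q ⧸ Ideal.span {x} →+* B).comp (Ideal.Quotient.mk (Ideal.span {x}))
  have hf : Function.Surjective f := e.symm.surjective.comp Ideal.Quotient.mk_surjective
  have hker : RingHom.ker f = Ideal.span {x} := by
    ext q
    rw [RingHom.mem_ker, ← Ideal.Quotient.eq_zero_iff_mem]
    exact map_eq_zero_iff e.symm e.symm.injective
  have hmB : (maximalIdeal Q).map f = maximalIdeal B :=
    IsLocalRing.map_maximalIdeal_of_surjective _ hf
  let _ := f.toAlgebra
  obtain ⟨zs, hzl, hz, hzm, t, ht⟩ := exists_isWeaklyRegular_of_surjective hf hker hx hus hm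
  have hgen {v : Q} {vs : List Q} (hv : Ideal.span {v} ⊔ Ideal.ofList vs = Ideal.ofList us) :
      Ideal.span {f v} ⊔ Ideal.ofList (vs.map f) = maximalIdeal B := by
    rw [← hmB, ← hm, ← hv, Ideal.map_sup, Ideal.map_span, Set.image_singleton, Ideal.map_ofList]
  by_cases hp : (ringChar (ResidueField R) : R) = 0
  · obtain ⟨v, vs, rfl⟩ := List.exists_cons_of_length_eq_add_one hzl.symm
    have hg := hgen (v := v) (vs := vs) (Ideal.ofList_cons v vs).symm
    refine ⟨f v, vs.map f, zs, t, hg, by simpa using hzl.symm, hz, hzm, ht,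
      exists_residueData_of_equalChar natCast_mem_maximalIdeal_adicCompletion_iff
        (by rw [← map_natCast (algebraMap R B), hp, map_zero]) _ ?_⟩
    exact hg ▸ Ideal.mem_sup_left (Ideal.mem_span_singleton_self _)
  · have hpm := (natCast_mem_maximalIdeal_adicCompletion_iff (R := R) _).2 dvd_rfl
    have hpp := prime_ringChar_of_natCast_ne_zero hp
    have hp2 : (ringChar (ResidueField R) : R) ∉ maximalIdeal R ^ 2 := by
      refine (hR.resolve_left fun h => hp ?_).2
      rw [← h]
      exact ringChar.Nat.cast_ringChar
    generalize ringChar (ResidueField R) = p at hp hpm hpp hp2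
    have hpQ2 : (p : Q) ∉ maximalIdeal Q ^ 2 := by
      intro h
      have h1 := Ideal.mem_map_of_mem f h
      rw [Ideal.map_pow, hmB, map_natCast, AdicCompletion.maximalIdeal_eq_map, ← Ideal.map_pow,
        ← map_natCast (algebraMap R B), ← Ideal.mem_comap,
        Ideal.comap_map_eq_self_of_faithfullyFlat] at h1
      exact hp2 h1
    have hpQ : (p : Q) ∈ maximalIdeal Q := by
      rw [mem_maximalIdeal, mem_nonunits_iff]
      intro hu
      have := hu.map f
      rw [map_natCast] at this
      exact (mem_maximalIdeal _).1 hpm this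
    have hp0 : (p : Q) ≠ 0 := fun h => hpQ2 (h ▸ zero_mem _)
    obtain ⟨vs, hvl, hvs⟩ := exists_span_singleton_sup_ofList us hm.le (hm.symm ▸ hpQ) hpQ2
    have hpW : (p : AdicCompletion (maximalIdeal Q) Q) ∈
        maximalIdeal (AdicCompletion (maximalIdeal Q) Q) := by
      rw [AdicCompletion.maximalIdeal_eq_map, ← map_natCast (algebraMap Q _)]
      exact Ideal.mem_map_of_mem _ hpQ
    obtain ⟨V, _, _, π, φ, hπ, hφ, hφπ⟩ := exists_residueData_of_mixedChar hpp hpW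
      (isSMulRegular_natCast_adicCompletion hp0)
    obtain ⟨ψ, hψ⟩ := (completionData_adicCompletion (maximalIdeal Q)).lift B (maximalIdeal B) f
      hmB.le
    refine ⟨f p, vs.map f, zs, t, hgen hvs, by rw [List.length_map]; omega, hz, hzm, ht, V, _, ‹_›, π,
      ψ.comp φ, hπ, hφ.comp ψ ?_ fun b => ?_, ?_⟩
    · rw [AdicCompletion.maximalIdeal_eq_map, Ideal.map_map, hψ, hmB]
    · obtain ⟨q, rfl⟩ := hf b
      refine ⟨algebraMap Q _ q, ?_⟩
      rw [← RingHom.comp_apply ψ, hψ, sub_self]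
      exact zero_mem _
    · rw [RingHom.comp_apply, hφπ, map_natCast, map_natCast]

end MainTheorem

end ExtRigidity

/-- Over a regular local ring or an unramified hypersurface, a nonzero finitely generated
Cohen–Macaulay module `M` of finite projective dimension satisfies: (1) for every finitely
generated `N`, if `Ext^n(M, N) = 0` for some `n ≤ pd M`, then `Ext^i(M, N) = 0` for all
`i ≤ n`; (2) if `Ext^n(M, M) = 0` for some `n ≥ 1`, then `pd M < n`. -/
theorem ext_rigid_of_cohenMacaulay
    (R : Type u) [CommRing R] [IsLocalRing R] [IsNoetherianRing R]
    (hR : IsRegularLocal R ∨ (IsUnramifiedLocal R ∧ IsHypersurface R))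
    (M : Type u) [AddCommGroup M] [Module R M] [Module.Finite R M] (hM : Nontrivial M)
    (hCM : IsCohenMacaulayModule R M) (hpd : projDim R M < ⊤) :
    ((∀ (N : Type u) (iN : AddCommGroup N) (jN : Module R N), Module.Finite R N →
        ∀ n : ℕ, (n : ℕ∞) ≤ projDim R M →
          Subsingleton (@extMod R _ n M _ _ N iN jN) →
            ∀ i ≤ n, Subsingleton (@extMod R _ i M _ _ N iN jN)) ∧
      (∀ n : ℕ, 1 ≤ n → Subsingleton (extMod R n M M) → projDim R M < (n : ℕ∞))) := by
  refine ExtRigidity.ext_rigid_of_hasCoordinates M (AdicCompletion (maximalIdeal R) R) ?_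
    AdicCompletion.maximalIdeal_eq_map.symm hCM hpd
  obtain hR | ⟨hu, -, ⟨P⟩⟩ := hR
  · exact ExtRigidity.hasCoordinates_adicCompletion_of_isRegularLocal hR
  · exact ExtRigidity.hasCoordinates_adicCompletion_of_hypersurfacePresentation hu P
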